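/- Suppose N > 1, s < -1 and 1 ≤ p < ∞, and let u ∈ D'(ℝ^N) satisfy ∇u ∈ (L^p_s)^N. Then there is a unique constant c_u ∈ ℝ, independent of s and p and given by c_u = lim_{r→∞} (Nω_N)^{-1} ∫_{S^{N-1}} u(rσ) dσ, such that u - c_u ∈ L^q_{s+1} for every q ∈ I_{1,p}, and for each such q there is a constant C = C(s,p,q) > 0 independent of u such that ||u - c_u||_{L^q_{s+1}} ≤ C ||\,|∇u|\,||_{L^p_s}. Furthermore, if p > N, then lim_{|x|→∞} |x|^{-(s+1)} (u(x) - c_u) = 0. -/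

import Mathlib

open MeasureTheory Metric Filter Topology ENNReal

noncomputable section

/-- Euclidean space `ℝ^N`. -/
abbrev Euc (N : ℕ) := EuclideanSpace ℝ (Fin N)

/-- Iterated classical partial derivative along a list of coordinate directions. -/
def pderivList {N : ℕ} : List (Fin N) → (Euc N → ℝ) → Euc N → ℝ
  | [], φ => φ
  | i :: l, φ => pderivList l fun x => fderiv ℝ φ x (EuclideanSpace.single i 1)

/-- `g` is the weak (distributional) partial derivative of `u` of order given by the
list `l` of coordinate directions, i.e. `g = ∂_{l₁} ⋯ ∂_{l_r} u` in `D'(ℝ^N)`. -/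
def IsWeakDerivList {N : ℕ} (l : List (Fin N)) (u g : Euc N → ℝ) : Prop :=
  LocallyIntegrable u volume ∧ LocallyIntegrable g volume ∧
    ∀ φ : Euc N → ℝ, ContDiff ℝ (⊤ : ℕ∞) φ → HasCompactSupport φ →
      ∫ x, u x * pderivList l φ x = (-1 : ℝ) ^ l.length * ∫ x, g x * φ x

/-- `g` is the weak partial derivative `∂ᵢ u`. -/
def IsWeakPartialDeriv {N : ℕ} (i : Fin N) (u g : Euc N → ℝ) : Prop :=
  IsWeakDerivList [i] u g

/-- The weight `(1+|x|)^{-s-N/q}` of the space `L^q_s` (with `N/∞ := 0`). -/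
def wt (N : ℕ) (s : ℝ) (q : ℝ≥0∞) (x : Euc N) : ℝ :=
  (1 + ‖x‖) ^ (-s - (N : ℝ) / q.toReal)

/-- Membership in the weighted space `L^q_s`. -/
def MemLs (N : ℕ) (s : ℝ) (q : ℝ≥0∞) (u : Euc N → ℝ) : Prop :=
  MemLp (fun x => wt N s q x * u x) q volume

/-- The norm of the weighted space `L^q_s`. -/
def LsNorm (N : ℕ) (s : ℝ) (q : ℝ≥0∞) (u : Euc N → ℝ) : ℝ :=
  (eLpNorm (fun x => wt N s q x * u x) q volume).toReal

/-- Membership in the exponentially weighted space `L^q_{exp,s}`. -/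
def MemLexp (N : ℕ) (s : ℝ) (q : ℝ≥0∞) (u : Euc N → ℝ) : Prop :=
  MemLp (fun x => Real.exp (-(s * ‖x‖)) * u x) q volume

/-- The norm of the exponentially weighted space `L^q_{exp,s}`. -/
def LexpNorm (N : ℕ) (s : ℝ) (q : ℝ≥0∞) (u : Euc N → ℝ) : ℝ :=
  (eLpNorm (fun x => Real.exp (-(s * ‖x‖)) * u x) q volume).toReal

/-- The pointwise Euclidean (Frobenius) norm `|∇^k u|` of the `k`-th gradient, whose
components `g m` are indexed by the `k`-tuples `m` of coordinate directions. -/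
def gradNormK {N k : ℕ} (g : (Fin k → Fin N) → Euc N → ℝ) (x : Euc N) : ℝ :=
  Real.sqrt (∑ m : Fin k → Fin N, g m x ^ 2)

/-- The pointwise Euclidean norm `|∇u|` of a first-order gradient. -/
def gradNorm1 {N : ℕ} (g : Fin N → Euc N → ℝ) (x : Euc N) : ℝ :=
  Real.sqrt (∑ i, g i x ^ 2)

/-- The interval `I_{j,p}` of admissible exponents `q`. -/
def Ijp (N j : ℕ) (p : ℝ) : Set ℝ≥0∞ :=
  if p = (N : ℝ) / (j : ℝ) ∧ 1 < N then Set.Ico (ENNReal.ofReal p) ⊤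
  else if p < (N : ℝ) / (j : ℝ) then
    Set.Icc (ENNReal.ofReal p) (ENNReal.ofReal ((N : ℝ) * p / ((N : ℝ) - (j : ℝ) * p)))
  else Set.Icc (ENNReal.ofReal p) ⊤

/-- The average of `u` on the ball `B_ρ`. -/
def ballAvg {N : ℕ} (ρ : ℝ) (u : Euc N → ℝ) : ℝ :=
  (volume (ball (0 : Euc N) ρ)).toReal⁻¹ * ∫ y in ball (0 : Euc N) ρ, u y

/-- The radial symmetrization `u_S(x) = (Nω_N)⁻¹ ∫_{S^{N-1}} u(|x|σ) dσ`. -/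
def radialSymmetrization {N : ℕ} (u : Euc N → ℝ) (x : Euc N) : ℝ :=
  ((N : ℝ) * (volume (ball (0 : Euc N) 1)).toReal)⁻¹ *
    ∫ σ : sphere (0 : Euc N) 1, u (‖x‖ • (σ : Euc N)) ∂((volume : Measure (Euc N)).toSphere)

/-- `u` is radially symmetric: `u x` only depends on `|x|`. -/
def RadSymm {N : ℕ} (u : Euc N → ℝ) : Prop :=
  ∀ x y : Euc N, ‖x‖ = ‖y‖ → u x = u y

/-- Evaluation of a polynomial on `ℝ^N` at a point. -/
def polyEval {N : ℕ} (π : MvPolynomial (Fin N) ℝ) (x : Euc N) : ℝ :=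
  MvPolynomial.eval (fun i => x i) π

lemma aux_jensen {α : Type*} [MeasurableSpace α] (ν : Measure α) {f : α → ℝ≥0∞}
    (hf : AEMeasurable f ν) {p : ℝ} (hp : 1 ≤ p) :
    (∫⁻ x, f x ∂ν) ^ p ≤ ν Set.univ ^ (p - 1) * ∫⁻ x, f x ^ p ∂ν := by
  rcases hp.eq_or_lt with rfl | hp1
  · simp
  have hpq : p.HolderConjugate (p / (p - 1)) := Real.HolderConjugate.conjExponent hp1
  have h := ENNReal.lintegral_mul_le_Lp_mul_Lq ν hpq hf (g := fun _ => 1) aemeasurable_const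
  simp only [Pi.mul_apply, mul_one, ENNReal.one_rpow, lintegral_one] at h
  have h2 := ENNReal.rpow_le_rpow h (by linarith : 0 ≤ p)
  rw [ENNReal.mul_rpow_of_nonneg _ _ (by linarith), ← ENNReal.rpow_mul, ← ENNReal.rpow_mul] at h2
  rw [mul_comm]
  convert h2 using 2
  · rw [one_div, inv_mul_cancel₀ (by linarith), ENNReal.rpow_one]
  · congr 1
    field_simp

lemma aux_lintegral_affine {N : ℕ} (F : Euc N → ℝ≥0∞) (y : Euc N) {r : ℝ} (hr : 0 < r) :
    ∫⁻ z, F (y + r • z) = ENNReal.ofReal r ^ (-(N : ℝ)) * ∫⁻ z, F z := by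
  have h1 : ∫⁻ z, F (y + r • z) = ∫⁻ z, F (y + z) ∂(Measure.map (fun z : Euc N => r • z) volume) := by
    have := lintegral_map_equiv (μ := (volume : Measure (Euc N))) (fun z => F (y + z))
      (Homeomorph.smulOfNeZero r hr.ne').toMeasurableEquiv
    simpa using this.symm
  rw [h1, Measure.map_addHaar_smul _ hr.ne', lintegral_smul_measure]
  rw [lintegral_add_left_eq_self F y]
  simp only [finrank_euclideanSpace, Fintype.card_fin, smul_eq_mul]
  congr 1
  rw [abs_of_pos (by positivity), ENNReal.ofReal_inv_of_pos (by positivity), ENNReal.rpow_neg,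
    ENNReal.rpow_natCast, ENNReal.ofReal_pow hr.le]

lemma aux_rpow_compare {A B C0 : ℝ} (hA : 0 < A) (hB : 0 < B) (hC : 1 ≤ C0)
    (h1 : A ≤ C0 * B) (h2 : B ≤ C0 * A) (a : ℝ) :
    ENNReal.ofReal A ^ a ≤ ENNReal.ofReal C0 ^ |a| * ENNReal.ofReal B ^ a := by
  have hC' : 0 < C0 := by linarith
  rw [ENNReal.ofReal_rpow_of_pos hA, ENNReal.ofReal_rpow_of_pos hB, ENNReal.ofReal_rpow_of_pos hC',
    ← ENNReal.ofReal_mul (by positivity)]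
  apply ENNReal.ofReal_le_ofReal
  rcases le_total 0 a with ha | ha
  · rw [abs_of_nonneg ha, ← Real.mul_rpow hC'.le hB.le]
    exact Real.rpow_le_rpow hA.le h1 ha
  · rw [abs_of_nonpos ha]
    have h3 : B ^ (-a) ≤ C0 ^ (-a) * A ^ (-a) := by
      rw [← Real.mul_rpow hC'.le hA.le]
      exact Real.rpow_le_rpow hB.le h2 (by linarith)
    rw [Real.rpow_neg hB.le, Real.rpow_neg hA.le] at h3
    have hBa : 0 < B ^ a := by positivity
    have hAa : 0 < A ^ a := by positivity
    rw [← div_eq_mul_inv, le_div_iff₀ hAa, inv_mul_le_iff₀ hBa] at h3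
    linarith

/-- The weight `1 + |x|` as an extended nonnegative real. -/
def JJ {N : ℕ} (x : Euc N) : ℝ≥0∞ := ENNReal.ofReal (1 + ‖x‖)

lemma JJ_ne_zero {N : ℕ} (x : Euc N) : JJ x ≠ 0 := by
  have : 0 < 1 + ‖x‖ := by positivity
  simpa [JJ] using this

lemma JJ_ne_top {N : ℕ} (x : Euc N) : JJ x ≠ ⊤ := ENNReal.ofReal_ne_top

lemma measurable_JJ {N : ℕ} : Measurable (JJ (N := N)) := by
  unfold JJ; fun_prop

lemma measurable_JJ_rpow {N : ℕ} (a : ℝ) : Measurable (fun x : Euc N => JJ x ^ a) :=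
  measurable_JJ.pow_const a

lemma JJ_rpow_ne_zero {N : ℕ} (x : Euc N) (a : ℝ) : JJ x ^ a ≠ 0 :=
  (ENNReal.rpow_pos (JJ_ne_zero x).bot_lt (JJ_ne_top x)).ne'

lemma JJ_rpow_ne_top {N : ℕ} (x : Euc N) (a : ℝ) : JJ x ^ a ≠ ⊤ :=
  ENNReal.rpow_ne_top_of_ne_zero (JJ_ne_zero x) (JJ_ne_top x)

lemma JJ_cancel {N : ℕ} (x : Euc N) (a : ℝ) : JJ x ^ (-a) * JJ x ^ a = 1 := by
  rw [← ENNReal.rpow_add _ _ (JJ_ne_zero x) (JJ_ne_top x)]; simp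

/-- Unit ball averages at scale `r` controlled by weighted `L^p` norms. -/
lemma aux_ball_bound {N : ℕ} {F : Euc N → ℝ≥0∞} (hF : Measurable F) {p : ℝ} (hp : 1 ≤ p) (a : ℝ)
    {C0 : ℝ} (hC : 1 ≤ C0) (y : Euc N) {r R : ℝ} (hr : 0 < r) (hR : 0 < R)
    (h1 : ∀ z ∈ ball y r, R ≤ C0 * (1 + ‖z‖)) (h2 : ∀ z ∈ ball y r, 1 + ‖z‖ ≤ C0 * R) :
    (∫⁻ z in ball (0 : Euc N) 1, F (y + r • z)) ^ p ≤
      (volume (ball (0 : Euc N) 1) ^ (p - 1) * ENNReal.ofReal C0 ^ |a|) *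
        (ENNReal.ofReal r ^ (-(N : ℝ)) * ENNReal.ofReal R ^ (-a) *
          ∫⁻ z in ball y r, JJ z ^ a * F z ^ p) := by
  have hm : Measurable fun z : Euc N => F (y + r • z) := hF.comp (by fun_prop)
  refine (aux_jensen _ hm.aemeasurable hp).trans ?_
  rw [Measure.restrict_apply_univ, mul_assoc]
  gcongr
  have h3 : ∀ z ∈ ball y r, F z ^ p ≤
      ENNReal.ofReal C0 ^ |a| * ENNReal.ofReal R ^ (-a) * (JJ z ^ a * F z ^ p) := by
    intro z hz
    have := aux_rpow_compare (A := 1 + ‖z‖) (B := R) (by positivity) hR hC (h2 z hz) (h1 z hz) (-a)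
    calc F z ^ p = JJ z ^ (-a) * (JJ z ^ a * F z ^ p) := by rw [← mul_assoc, JJ_cancel, one_mul]
      _ ≤ _ := by
        gcongr
        simpa [JJ] using this
  have h4 : ∫⁻ z in ball (0 : Euc N) 1, F (y + r • z) ^ p
      = ENNReal.ofReal r ^ (-(N : ℝ)) * ∫⁻ z in ball y r, F z ^ p := by
    rw [← lintegral_indicator measurableSet_ball, ← lintegral_indicator measurableSet_ball,
      ← aux_lintegral_affine _ y hr]
    congr 1
    ext z
    have : y + r • z ∈ ball y r ↔ z ∈ ball (0 : Euc N) 1 := by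
      simp [norm_smul, abs_of_pos hr, hr]
    by_cases hz : z ∈ ball (0 : Euc N) 1
    · rw [Set.indicator_of_mem hz, Set.indicator_of_mem (this.2 hz)]
    · rw [Set.indicator_of_notMem hz, Set.indicator_of_notMem (fun h => hz (this.1 h))]
  rw [h4]
  calc _ ≤ ENNReal.ofReal r ^ (-(N : ℝ)) * ∫⁻ z in ball y r,
        ENNReal.ofReal C0 ^ |a| * ENNReal.ofReal R ^ (-a) * (JJ z ^ a * F z ^ p) := by
        refine mul_le_mul' le_rfl ?_
        exact setLIntegral_mono' measurableSet_ball h3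
    _ = _ := by
        rw [lintegral_const_mul]
        · ring
        · exact (measurable_JJ_rpow a).mul (hF.pow_const p)

lemma aux_jensen_weight {α : Type*} [MeasurableSpace α] (ν : Measure α) {f m : α → ℝ≥0∞}
    (hf : Measurable f) (hm : Measurable m) (h0 : ∀ᵐ x ∂ν, m x ≠ 0) (ht : ∀ᵐ x ∂ν, m x ≠ ⊤)
    {p : ℝ} (hp : 1 ≤ p) :
    (∫⁻ x, f x ∂ν) ^ p ≤ (∫⁻ x, m x ∂ν) ^ (p - 1) * ∫⁻ x, m x ^ (1 - p) * f x ^ p ∂ν := by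
  have hmm : Measurable fun x => (m x)⁻¹ * f x := hm.inv.mul hf
  have hmp : Measurable fun x => ((m x)⁻¹ * f x) ^ p := hmm.pow_const p
  have h := aux_jensen (ν.withDensity m) (f := fun x => (m x)⁻¹ * f x) hmm.aemeasurable hp
  rw [lintegral_withDensity_eq_lintegral_mul _ hm hmm,
    lintegral_withDensity_eq_lintegral_mul _ hm hmp,
    withDensity_apply _ MeasurableSet.univ, Measure.restrict_univ] at h
  have e1 : ∫⁻ x, f x ∂ν = ∫⁻ x, (m * fun x => (m x)⁻¹ * f x) x ∂ν := by
    apply lintegral_congr_ae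
    filter_upwards [h0, ht] with x hx hx'
    simp only [Pi.mul_apply]
    rw [← mul_assoc, ENNReal.mul_inv_cancel hx hx', one_mul]
  have e2 : ∫⁻ x, m x ^ (1 - p) * f x ^ p ∂ν
      = ∫⁻ x, (m * fun x => ((m x)⁻¹ * f x) ^ p) x ∂ν := by
    apply lintegral_congr_ae
    filter_upwards [h0, ht] with x hx hx'
    simp only [Pi.mul_apply]
    rw [ENNReal.mul_rpow_of_nonneg _ _ (by linarith), ← mul_assoc, ENNReal.inv_rpow,
      ← ENNReal.rpow_neg]
    congr 1
    rw [show 1 - p = 1 + -p by ring, ENNReal.rpow_add _ _ hx hx', ENNReal.rpow_one]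
  rw [e1, e2]
  exact h

/-- the rays used in the Hardy inequality -/
def ray {N : ℕ} (e x z : Euc N) (l : ℝ) : Euc N :=
  l • x + (l - 1) • ((3 / 4 : ℝ) • e + (1 / 4 : ℝ) • z)

def PP {N : ℕ} (e : Euc N) (G : Euc N → ℝ≥0∞) (x : Euc N) : ℝ≥0∞ :=
  ∫⁻ l in Set.Ioi (1 : ℝ), ∫⁻ z in ball (0 : Euc N) 1, G (ray e x z l)

lemma eta_norm_le {N : ℕ} {e z : Euc N} (he : ‖e‖ = 1) (hz : ‖z‖ ≤ 1) :
    ‖(3 / 4 : ℝ) • e + (1 / 4 : ℝ) • z‖ ≤ 1 := by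
  have := norm_add_le ((3 / 4 : ℝ) • e) ((1 / 4 : ℝ) • z)
  rw [norm_smul, norm_smul, he] at this
  norm_num at this
  linarith

lemma ray_upper {N : ℕ} {e x z : Euc N} (he : ‖e‖ = 1) (hz : ‖z‖ ≤ 1) {l : ℝ} (hl : 1 ≤ l) :
    1 + ‖ray e x z l‖ ≤ l * (1 + ‖x‖) := by
  have h1 := eta_norm_le he hz
  have := norm_add_le (l • x) ((l - 1) • ((3 / 4 : ℝ) • e + (1 / 4 : ℝ) • z))
  rw [norm_smul, norm_smul, Real.norm_of_nonneg (by linarith),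
    Real.norm_of_nonneg (by linarith)] at this
  unfold ray
  nlinarith

lemma ray_lower {N : ℕ} {e x z : Euc N} (he : ‖e‖ = 1) (hx : 0 ≤ inner ℝ x e) (hz : ‖z‖ ≤ 1)
    {l : ℝ} (hl : 1 ≤ l) :
    l * (1 + ‖x‖) ≤ 4 * (1 + ‖ray e x z l‖) := by
  have h1 := eta_norm_le he hz
  set η := (3 / 4 : ℝ) • e + (1 / 4 : ℝ) • z with hη
  have h2 : ray e x z l = l • (x + η) - η := by
    unfold ray; rw [← hη]; module
  have h3 : 1 / 2 + ‖x‖ / 4 ≤ ‖x + (3 / 4 : ℝ) • e‖ := by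
    apply le_of_sq_le_sq _ (norm_nonneg _)
    rw [norm_add_sq_real, norm_smul, he, inner_smul_right]
    norm_num
    nlinarith [sq_nonneg (‖x‖ - 1/4)]
  have h4 : 1 / 4 + ‖x‖ / 4 ≤ ‖x + η‖ := by
    have : ‖x + (3 / 4 : ℝ) • e‖ ≤ ‖x + η‖ + ‖(1 / 4 : ℝ) • z‖ := by
      have := norm_sub_le (x + η) ((1 / 4 : ℝ) • z)
      rwa [show x + η - (1 / 4 : ℝ) • z = x + (3 / 4 : ℝ) • e by rw [hη]; module] at this
    rw [norm_smul] at this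
    norm_num at this
    linarith
  have h5 : ‖l • (x + η)‖ ≤ ‖ray e x z l‖ + ‖η‖ := by
    have := norm_add_le (ray e x z l) η
    rwa [h2, sub_add_cancel, ← h2] at this
  rw [norm_smul, Real.norm_of_nonneg (by linarith)] at h5
  nlinarith

lemma measurable_ray {N : ℕ} (e : Euc N) :
    Measurable fun q : (Euc N × Euc N) × ℝ => ray e q.1.1 q.1.2 q.2 := by
  unfold ray; fun_prop

lemma aux_I_lt_top {s : ℝ} (hs : s < -1) :
    ∫⁻ l in Set.Ioi (1 : ℝ), ENNReal.ofReal l ^ s < ⊤ := by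
  have h := integrableOn_Ioi_rpow_of_lt hs one_pos
  have h2 := h.2
  refine lt_of_le_of_lt (le_of_eq ?_) h2
  apply setLIntegral_congr_fun measurableSet_Ioi
  intro l hl
  have : (0 : ℝ) < l := lt_trans one_pos hl
  simp only
  rw [ENNReal.ofReal_rpow_of_pos this, Real.enorm_of_nonneg (by positivity)]

lemma hardy_op {N : ℕ} {s p : ℝ} (hs : s < -1) (hp : 1 ≤ p) :
    ∃ C : ℝ≥0∞, C ≠ ⊤ ∧ ∀ (e : Euc N), ‖e‖ = 1 → ∀ G : Euc N → ℝ≥0∞, Measurable G →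
      ∫⁻ x in {x : Euc N | 0 ≤ inner ℝ x e}, JJ x ^ (-s * p - N) * PP e G x ^ p ≤
        C * ∫⁻ x, JJ x ^ (-s * p - N) * G x ^ p := by
  set a : ℝ := -s * p - N with ha
  set I := ∫⁻ l in Set.Ioi (1 : ℝ), ENNReal.ofReal l ^ s with hI
  have hIt : I ≠ ⊤ := (aux_I_lt_top hs).ne
  set b := volume (ball (0 : Euc N) 1) with hb
  have hbt : b ≠ ⊤ := measure_ball_lt_top.ne
  refine ⟨I ^ (p - 1) * b ^ (p - 1) * (ENNReal.ofReal 4 ^ |a| * b * I), ?_, ?_⟩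
  · have h1 : I ^ (p - 1) ≠ ⊤ := ENNReal.rpow_ne_top_of_nonneg (by linarith) hIt
    have h2 : b ^ (p - 1) ≠ ⊤ := ENNReal.rpow_ne_top_of_nonneg (by linarith) hbt
    have h3 : ENNReal.ofReal 4 ^ |a| ≠ ⊤ :=
      ENNReal.rpow_ne_top_of_nonneg (abs_nonneg _) ENNReal.ofReal_ne_top
    finiteness
  intro e he G hG
  set H := {x : Euc N | 0 ≤ inner ℝ x e} with hH
  have hHm : MeasurableSet H := by
    apply measurableSet_le measurable_const
    fun_prop
  set K := ∫⁻ x, JJ x ^ a * G x ^ p with hK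
  have hmG : Measurable fun q : (Euc N × Euc N) × ℝ => G (ray e q.1.1 q.1.2 q.2) :=
    hG.comp (measurable_ray e)
  -- pointwise estimate
  have hpt : ∀ x, PP e G x ^ p ≤ (I ^ (p - 1) * b ^ (p - 1)) *
      ∫⁻ l in Set.Ioi (1 : ℝ), ∫⁻ z in ball (0 : Euc N) 1,
        ENNReal.ofReal l ^ (s * (1 - p)) * G (ray e x z l) ^ p := by
    intro x
    have hm1 : Measurable fun q : ℝ × Euc N => G (ray e x q.2 q.1) :=
      hmG.comp (by fun_prop : Measurable fun q : ℝ × Euc N => ((x, q.2), q.1))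
    have hm2 : Measurable fun l : ℝ => ∫⁻ z in ball (0 : Euc N) 1, G (ray e x z l) :=
      hm1.lintegral_prod_right'
    have hm3 : Measurable fun l : ℝ => ENNReal.ofReal l ^ s := by fun_prop
    have h1 := aux_jensen_weight (volume.restrict (Set.Ioi (1 : ℝ))) hm2 hm3
      (by
        filter_upwards [ae_restrict_mem measurableSet_Ioi] with l hl
        have hl0 : (0 : ℝ) < l := lt_trans one_pos hl
        rw [ENNReal.ofReal_rpow_of_pos hl0]
        simp only [ne_eq, ENNReal.ofReal_eq_zero, not_le]
        positivity)
      (by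
        filter_upwards [ae_restrict_mem measurableSet_Ioi] with l hl
        have hl0 : (0 : ℝ) < l := lt_trans one_pos hl
        rw [ENNReal.ofReal_rpow_of_pos hl0]
        exact ENNReal.ofReal_ne_top) hp
    unfold PP
    refine h1.trans ?_
    rw [mul_assoc]
    refine mul_le_mul' le_rfl ?_
    rw [← lintegral_const_mul']
    swap
    · exact ENNReal.rpow_ne_top_of_nonneg (by linarith) hbt
    apply lintegral_mono
    intro l
    simp only
    rw [← ENNReal.rpow_mul]
    have hm4 : Measurable fun z => G (ray e x z l) := hm1.comp measurable_prodMk_left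
    have h2 := aux_jensen (volume.restrict (ball (0 : Euc N) 1)) hm4.aemeasurable hp
    rw [Measure.restrict_apply_univ] at h2
    rw [lintegral_const_mul _ (hm4.pow_const p)]
    calc _ ≤ ENNReal.ofReal l ^ (s * (1 - p)) *
          (b ^ (p - 1) * ∫⁻ z in ball (0 : Euc N) 1, G (ray e x z l) ^ p) := by gcongr
      _ = _ := by ring
  have hm5 : Measurable fun q : (Euc N × ℝ) × Euc N =>
      JJ q.1.1 ^ a * (ENNReal.ofReal q.1.2 ^ (s * (1 - p)) * G (ray e q.1.1 q.2 q.1.2) ^ p) := by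
    refine Measurable.mul ?_ (Measurable.mul ?_ ?_)
    · exact (measurable_JJ_rpow a).comp (by fun_prop)
    · fun_prop
    · exact (hmG.comp (by fun_prop : Measurable fun q : (Euc N × ℝ) × Euc N =>
        ((q.1.1, q.2), q.1.2))).pow_const p
  calc ∫⁻ x in H, JJ x ^ a * PP e G x ^ p
      ≤ ∫⁻ x in H, (I ^ (p - 1) * b ^ (p - 1)) *
          ∫⁻ l in Set.Ioi (1 : ℝ), ∫⁻ z in ball (0 : Euc N) 1,
          JJ x ^ a * (ENNReal.ofReal l ^ (s * (1 - p)) * G (ray e x z l) ^ p) := by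
        apply lintegral_mono
        intro x
        simp only
        calc JJ x ^ a * PP e G x ^ p ≤ JJ x ^ a * ((I ^ (p - 1) * b ^ (p - 1)) *
              ∫⁻ l in Set.Ioi (1 : ℝ), ∫⁻ z in ball (0 : Euc N) 1,
              ENNReal.ofReal l ^ (s * (1 - p)) * G (ray e x z l) ^ p) :=
                mul_le_mul' le_rfl (hpt x)
          _ = _ := by
            rw [mul_left_comm, ← lintegral_const_mul' _ _ (JJ_rpow_ne_top x a)]
            congr 1
            apply lintegral_congr
            intro l
            rw [← lintegral_const_mul' _ _ (JJ_rpow_ne_top x a)]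
    _ = (I ^ (p - 1) * b ^ (p - 1)) * ∫⁻ x in H,
          ∫⁻ l in Set.Ioi (1 : ℝ), ∫⁻ z in ball (0 : Euc N) 1,
          JJ x ^ a * (ENNReal.ofReal l ^ (s * (1 - p)) * G (ray e x z l) ^ p) := by
        rw [lintegral_const_mul']
        have h1 : I ^ (p - 1) ≠ ⊤ := ENNReal.rpow_ne_top_of_nonneg (by linarith) hIt
        have h2 : b ^ (p - 1) ≠ ⊤ := ENNReal.rpow_ne_top_of_nonneg (by linarith) hbt
        finiteness
    _ = (I ^ (p - 1) * b ^ (p - 1)) * ∫⁻ l in Set.Ioi (1 : ℝ),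
          ∫⁻ z in ball (0 : Euc N) 1, ∫⁻ x in H,
          JJ x ^ a * (ENNReal.ofReal l ^ (s * (1 - p)) * G (ray e x z l) ^ p) := by
        congr 1
        rw [lintegral_lintegral_swap]
        · apply lintegral_congr
          intro l
          rw [lintegral_lintegral_swap]
          exact (hm5.comp (by fun_prop : Measurable fun q : Euc N × Euc N =>
            ((q.1, l), q.2))).aemeasurable
        · exact hm5.lintegral_prod_right'.aemeasurable
    _ ≤ (I ^ (p - 1) * b ^ (p - 1)) * ∫⁻ l in Set.Ioi (1 : ℝ),
          ∫⁻ z in ball (0 : Euc N) 1, (ENNReal.ofReal 4 ^ |a| * K) * ENNReal.ofReal l ^ s := by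
        refine mul_le_mul' le_rfl ?_
        apply setLIntegral_mono' measurableSet_Ioi
        intro l hl
        apply setLIntegral_mono' measurableSet_ball
        intro z hz
        have hl1 : (1 : ℝ) < l := hl
        have hl0 : (0 : ℝ) < l := lt_trans one_pos hl
        have hz1 : ‖z‖ ≤ 1 := by simpa using (mem_ball_zero_iff.1 hz).le
        have hL0 : ENNReal.ofReal l ≠ 0 := by simpa using hl0
        have hLt : ENNReal.ofReal l ≠ ⊤ := ENNReal.ofReal_ne_top
        have hstep : ∀ x ∈ H, JJ x ^ a * (ENNReal.ofReal l ^ (s * (1 - p)) * G (ray e x z l) ^ p)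
            ≤ (ENNReal.ofReal 4 ^ |a| * ENNReal.ofReal l ^ (s + N)) *
              (JJ (ray e x z l) ^ a * G (ray e x z l) ^ p) := by
          intro x hx
          have hc := aux_rpow_compare (A := l * (1 + ‖x‖)) (B := 1 + ‖ray e x z l‖) (C0 := 4)
            (by positivity) (by positivity) (by norm_num) (ray_lower he hx hz1 hl1.le)
            (by
              have := ray_upper (x := x) he hz1 hl1.le
              have h0 : 0 ≤ l * (1 + ‖x‖) := by positivity
              linarith) a
          have hJ : JJ x ^ a = ENNReal.ofReal l ^ (-a) * ENNReal.ofReal (l * (1 + ‖x‖)) ^ a := by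
            rw [ENNReal.ofReal_mul hl0.le, ENNReal.mul_rpow_of_ne_top hLt ENNReal.ofReal_ne_top,
              ← mul_assoc, ← ENNReal.rpow_add _ _ hL0 hLt]
            simp [JJ]
          rw [hJ]
          calc _ ≤ ENNReal.ofReal l ^ (-a) * (ENNReal.ofReal 4 ^ |a| *
                ENNReal.ofReal (1 + ‖ray e x z l‖) ^ a) *
                (ENNReal.ofReal l ^ (s * (1 - p)) * G (ray e x z l) ^ p) := by gcongr
            _ = (ENNReal.ofReal 4 ^ |a| * (ENNReal.ofReal l ^ (-a) *
                ENNReal.ofReal l ^ (s * (1 - p)))) *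
              (JJ (ray e x z l) ^ a * G (ray e x z l) ^ p) := by unfold JJ; ring
            _ = _ := by
              rw [← ENNReal.rpow_add _ _ hL0 hLt]
              congr 3
              rw [ha]; ring
        calc _ ≤ ∫⁻ x in H, (ENNReal.ofReal 4 ^ |a| * ENNReal.ofReal l ^ (s + N)) *
              (JJ (ray e x z l) ^ a * G (ray e x z l) ^ p) := setLIntegral_mono' hHm hstep
          _ ≤ ∫⁻ x, (ENNReal.ofReal 4 ^ |a| * ENNReal.ofReal l ^ (s + N)) *
              (JJ (ray e x z l) ^ a * G (ray e x z l) ^ p) := setLIntegral_le_lintegral _ _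
          _ = (ENNReal.ofReal 4 ^ |a| * ENNReal.ofReal l ^ (s + N)) *
              (ENNReal.ofReal l ^ (-(N : ℝ)) * K) := by
            rw [lintegral_const_mul', hK, ← aux_lintegral_affine (fun x => JJ x ^ a * G x ^ p)
              ((l - 1) • ((3 / 4 : ℝ) • e + (1 / 4 : ℝ) • z)) hl0]
            · simp only [ray, add_comm]
            · exact ENNReal.mul_ne_top
                (ENNReal.rpow_ne_top_of_nonneg (abs_nonneg _) ENNReal.ofReal_ne_top)
                (ENNReal.rpow_ne_top_of_ne_zero hL0 hLt)
          _ = (ENNReal.ofReal 4 ^ |a| * K) * (ENNReal.ofReal l ^ (s + N) *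
                ENNReal.ofReal l ^ (-(N : ℝ))) := by ring
          _ = _ := by
            rw [← ENNReal.rpow_add _ _ hL0 hLt]
            congr 2
            ring
    _ = _ := by
        simp only [lintegral_const, Measure.restrict_apply_univ]
        rw [lintegral_mul_const' _ _ hbt, lintegral_const_mul _ (by fun_prop)]
        ring

/-- pointwise norm of the classical gradient -/
def GG {N : ℕ} (u : Euc N → ℝ) (x : Euc N) : ℝ≥0∞ := ‖fderiv ℝ u x‖ₑ

lemma continuous_GG {N : ℕ} {u : Euc N → ℝ} (hu : ContDiff ℝ 1 u) : Continuous (GG u) :=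
  (hu.continuous_fderiv one_ne_zero).enorm

lemma aux_seg {N : ℕ} {u : Euc N → ℝ} (hu : ContDiff ℝ 1 u) (x v : Euc N) {a b : ℝ} (hab : a ≤ b) :
    ‖u (x + b • v) - u (x + a • v)‖ₑ ≤ ‖v‖ₑ * ∫⁻ t in Set.Ioc a b, GG u (x + t • v) := by
  have hd : ∀ t : ℝ, HasDerivAt (fun t : ℝ => u (x + t • v)) (fderiv ℝ u (x + t • v) v) t := by
    intro t
    have h1 : HasDerivAt (fun t : ℝ => x + t • v) v t := by
      simpa using ((hasDerivAt_id t).smul_const v).const_add x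
    exact ((hu.differentiable one_ne_zero _).hasFDerivAt).comp_hasDerivAt t h1
  have hc : Continuous fun t : ℝ => fderiv ℝ u (x + t • v) v :=
    ((hu.continuous_fderiv one_ne_zero).comp (by fun_prop)).clm_apply continuous_const
  have h := intervalIntegral.integral_eq_sub_of_hasDerivAt (fun t _ => hd t)
    (hc.intervalIntegrable a b)
  rw [← h, intervalIntegral.integral_of_le hab]
  refine (enorm_integral_le_lintegral_enorm _).trans ?_
  rw [← lintegral_const_mul' _ _ enorm_ne_top]
  apply lintegral_mono
  intro t
  simp only [GG]
  rw [mul_comm]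
  exact ContinuousLinearMap.le_opENorm _ _

lemma aux_avg {N : ℕ} {f g : Euc N → ℝ} (hf : Continuous f) (hg : Continuous g) :
    ‖(⨍ z in ball (0 : Euc N) 1, f z) - ⨍ z in ball (0 : Euc N) 1, g z‖ₑ ≤
      (volume (ball (0 : Euc N) 1))⁻¹ * ∫⁻ z in ball (0 : Euc N) 1, ‖f z - g z‖ₑ := by
  have hi : ∀ {f : Euc N → ℝ}, Continuous f → IntegrableOn f (ball 0 1) := fun hf =>
    (hf.continuousOn.integrableOn_compact (isCompact_closedBall (0 : Euc N) 1)).mono_set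
      ball_subset_closedBall
  have hb : volume (ball (0 : Euc N) 1) ≠ 0 := (measure_ball_pos _ _ one_pos).ne'
  have hbt : volume (ball (0 : Euc N) 1) ≠ ⊤ := measure_ball_lt_top.ne
  rw [setAverage_eq, setAverage_eq, ← smul_sub, ← integral_sub (hi hf) (hi hg), enorm_smul]
  gcongr
  · rw [Real.enorm_of_nonneg (by positivity), Measure.real, ← ENNReal.toReal_inv,
      ENNReal.ofReal_toReal (by simpa using hb)]
  · exact enorm_integral_le_lintegral_enorm _

lemma aux_avg_const {N : ℕ} (k : ℝ) : (⨍ _z in ball (0 : Euc N) 1, k) = k :=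
  setAverage_const (measure_ball_pos _ _ one_pos).ne' measure_ball_lt_top.ne k

lemma ray_eq {N : ℕ} (e x z : Euc N) (l : ℝ) : ray e x z l =
    -((3 / 4 : ℝ) • e + (1 / 4 : ℝ) • z) + l • (x + ((3 / 4 : ℝ) • e + (1 / 4 : ℝ) • z)) := by
  unfold ray; module

lemma ray_eq' {N : ℕ} (e x z : Euc N) (l : ℝ) : ray e x z l =
    (l • x + ((l - 1) * (3 / 4)) • e) + ((l - 1) / 4) • z := by
  unfold ray; module

lemma aux_ray_avg {N : ℕ} {u : Euc N → ℝ} (hu : ContDiff ℝ 1 u) {e : Euc N} (he : ‖e‖ = 1)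
    (x : Euc N) {R : ℝ} (hR : 1 ≤ R) :
    ‖(⨍ z in ball (0 : Euc N) 1, u ((R • x + ((R - 1) * (3 / 4)) • e) + ((R - 1) / 4) • z)) - u x‖ₑ
      ≤ (volume (ball (0 : Euc N) 1))⁻¹ * (JJ x * PP e (GG u) x) := by
  have h1 := aux_avg (f := fun z => u ((R • x + ((R - 1) * (3 / 4)) • e) + ((R - 1) / 4) • z))
    (g := fun _ => u x) (hu.continuous.comp (by fun_prop)) continuous_const
  rw [aux_avg_const] at h1
  refine h1.trans ?_
  refine mul_le_mul' le_rfl ?_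
  have hm : Measurable fun q : Euc N × ℝ => GG u (ray e x q.1 q.2) :=
    (continuous_GG hu).measurable.comp ((measurable_ray e).comp
      (by fun_prop : Measurable fun q : Euc N × ℝ => ((x, q.1), q.2)))
  calc _ ≤ ∫⁻ z in ball (0 : Euc N) 1, JJ x * ∫⁻ l in Set.Ioi (1 : ℝ), GG u (ray e x z l) := by
        apply setLIntegral_mono' measurableSet_ball
        intro z hz
        have hz1 : ‖z‖ ≤ 1 := by simpa using (mem_ball_zero_iff.1 hz).le
        have h2 := aux_seg hu (-((3 / 4 : ℝ) • e + (1 / 4 : ℝ) • z))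
          (x + ((3 / 4 : ℝ) • e + (1 / 4 : ℝ) • z)) hR
        simp only [← ray_eq] at h2
        rw [ray_eq' e x z R, show ray e x z 1 = x by simp [ray]] at h2
        refine h2.trans ?_
        refine mul_le_mul' ?_ (lintegral_mono_set Set.Ioc_subset_Ioi_self)
        rw [← ofReal_norm, JJ]
        apply ENNReal.ofReal_le_ofReal
        refine (norm_add_le _ _).trans ?_
        linarith [eta_norm_le he hz1]
    _ = JJ x * PP e (GG u) x := by
        rw [lintegral_const_mul' _ _ (JJ_ne_top x), PP, lintegral_lintegral_swap]
        exact hm.aemeasurable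

/-- oscillation of large ball averages -/
lemma aux_osc {N : ℕ} {s p : ℝ} (hp : 1 ≤ p) {u : Euc N → ℝ} (hu : ContDiff ℝ 1 u)
    (hK : ∫⁻ x, JJ x ^ (-s * p - N) * GG u x ^ p ≠ ⊤) {M : ℝ} (hM : 0 ≤ M) :
    ∃ C : ℝ≥0∞, C ≠ ⊤ ∧ ∀ R : ℝ, 2 ≤ R → ∀ y y' : Euc N,
      (∀ t ∈ Set.Icc (0 : ℝ) 1, (R - 1) / 2 ≤ ‖y + t • (y' - y)‖ ∧ ‖y + t • (y' - y)‖ ≤ M * R) →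
      ‖(⨍ z in ball (0 : Euc N) 1, u (y' + ((R - 1) / 4) • z)) -
        ⨍ z in ball (0 : Euc N) 1, u (y + ((R - 1) / 4) • z)‖ₑ ≤ C * ENNReal.ofReal R ^ (s + 1) := by
  set a : ℝ := -s * p - N with ha
  set K := ∫⁻ x, JJ x ^ a * GG u x ^ p with hKdef
  set b := volume (ball (0 : Euc N) 1) with hb
  have hbt : b ≠ ⊤ := measure_ball_lt_top.ne
  have hb0 : b ≠ 0 := (measure_ball_pos _ _ one_pos).ne'
  have hp0 : 0 < p := by linarith
  set C1 := (b ^ (p - 1) * ENNReal.ofReal (M + 4) ^ |a|) * (ENNReal.ofReal 8 ^ |-(N : ℝ)| * K)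
  have hC1 : C1 ≠ ⊤ := by
    have h1 : b ^ (p - 1) ≠ ⊤ := ENNReal.rpow_ne_top_of_nonneg (by linarith) hbt
    have h2 : ENNReal.ofReal (M + 4) ^ |a| ≠ ⊤ :=
      ENNReal.rpow_ne_top_of_nonneg (abs_nonneg _) ENNReal.ofReal_ne_top
    have h3 : ENNReal.ofReal 8 ^ |-(N : ℝ)| ≠ ⊤ :=
      ENNReal.rpow_ne_top_of_nonneg (abs_nonneg _) ENNReal.ofReal_ne_top
    finiteness
  refine ⟨b⁻¹ * (ENNReal.ofReal (2 * M) * C1 ^ (1 / p)), ?_, ?_⟩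
  · have h1 : b⁻¹ ≠ ⊤ := by simpa using hb0
    have h2 : C1 ^ (1 / p) ≠ ⊤ := ENNReal.rpow_ne_top_of_nonneg (by positivity) hC1
    finiteness
  intro R hR y y' hy
  have hR0 : 0 < R := by linarith
  have hRz : ENNReal.ofReal R ≠ 0 := by simpa using hR0
  have hRt : ENNReal.ofReal R ≠ ⊤ := ENNReal.ofReal_ne_top
  have h1 := aux_avg (f := fun z => u (y' + ((R - 1) / 4) • z))
    (g := fun z => u (y + ((R - 1) / 4) • z)) (hu.continuous.comp (by fun_prop))
      (hu.continuous.comp (by fun_prop))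
  refine h1.trans ?_
  rw [mul_assoc]
  refine mul_le_mul' le_rfl ?_
  have hm : Measurable fun q : Euc N × ℝ => GG u ((y + ((R - 1) / 4) • q.1) + q.2 • (y' - y)) :=
    (continuous_GG hu).measurable.comp (by fun_prop)
  have hd : ‖y' - y‖ₑ ≤ ENNReal.ofReal (2 * M * R) := by
    rw [← ofReal_norm]
    apply ENNReal.ofReal_le_ofReal
    have h0 := (hy 0 (by simp)).2
    have h1 := (hy 1 (by simp)).2
    simp at h0 h1
    have := norm_sub_le y' y
    linarith
  calc _ ≤ ∫⁻ z in ball (0 : Euc N) 1, ‖y' - y‖ₑ * ∫⁻ t in Set.Ioc (0 : ℝ) 1,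
          GG u ((y + ((R - 1) / 4) • z) + t • (y' - y)) := by
        apply lintegral_mono
        intro z
        have h2 := aux_seg hu (y + ((R - 1) / 4) • z) (y' - y) zero_le_one
        simp only [one_smul, zero_smul, add_zero] at h2
        rwa [show y + ((R - 1) / 4) • z + (y' - y) = y' + ((R - 1) / 4) • z by abel] at h2
    _ = ‖y' - y‖ₑ * ∫⁻ t in Set.Ioc (0 : ℝ) 1, ∫⁻ z in ball (0 : Euc N) 1,
          GG u ((y + ((R - 1) / 4) • z) + t • (y' - y)) := by
        rw [lintegral_const_mul' _ _ enorm_ne_top, lintegral_lintegral_swap]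
        exact hm.aemeasurable
    _ ≤ ‖y' - y‖ₑ * ∫⁻ t in Set.Ioc (0 : ℝ) 1, C1 ^ (1 / p) * ENNReal.ofReal R ^ s := by
        refine mul_le_mul' le_rfl ?_
        apply setLIntegral_mono' measurableSet_Ioc
        intro t ht
        obtain ⟨hl, hu'⟩ := hy t ⟨ht.1.le, ht.2⟩
        have h3 := aux_ball_bound (continuous_GG hu).measurable hp a (C0 := M + 4) (by linarith)
          (y + t • (y' - y)) (r := (R - 1) / 4) (R := R) (by linarith) hR0
          (by
            intro z hz
            rw [mem_ball, dist_eq_norm] at hz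
            have := norm_sub_norm_le (y + t • (y' - y)) z
            rw [norm_sub_rev] at this
            have h0 := norm_nonneg z
            nlinarith)
          (by
            intro z hz
            rw [mem_ball, dist_eq_norm] at hz
            have := norm_sub_norm_le z (y + t • (y' - y))
            nlinarith)
        have h4 : ENNReal.ofReal ((R - 1) / 4) ^ (-(N : ℝ)) ≤
            ENNReal.ofReal 8 ^ |-(N : ℝ)| * ENNReal.ofReal R ^ (-(N : ℝ)) :=
          aux_rpow_compare (by linarith) hR0 (by norm_num) (by linarith) (by linarith) _
        have h5 : (∫⁻ z in ball (0 : Euc N) 1, GG u ((y + ((R - 1) / 4) • z) + t • (y' - y))) ^ p ≤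
            C1 * ENNReal.ofReal R ^ (s * p) := by
          calc _ = (∫⁻ z in ball (0 : Euc N) 1,
                GG u ((y + t • (y' - y)) + ((R - 1) / 4) • z)) ^ p := by
                  simp only [add_right_comm]
            _ ≤ _ := h3
            _ ≤ (b ^ (p - 1) * ENNReal.ofReal (M + 4) ^ |a|) *
                ((ENNReal.ofReal 8 ^ |-(N : ℝ)| * ENNReal.ofReal R ^ (-(N : ℝ))) *
                  ENNReal.ofReal R ^ (-a) * K) := by
                gcongr
                exact setLIntegral_le_lintegral _ _
            _ = C1 * (ENNReal.ofReal R ^ (-(N : ℝ)) * ENNReal.ofReal R ^ (-a)) := by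
                simp only [C1]; ring
            _ = _ := by
                rw [← ENNReal.rpow_add _ _ hRz hRt]
                congr 2
                rw [ha]; ring
        have h6 := ENNReal.rpow_le_rpow h5 (by positivity : 0 ≤ 1 / p)
        rw [← ENNReal.rpow_mul, mul_one_div_cancel hp0.ne', ENNReal.rpow_one,
          ENNReal.mul_rpow_of_nonneg _ _ (by positivity), ← ENNReal.rpow_mul,
          show s * p * (1 / p) = s by field_simp] at h6
        exact h6
    _ ≤ ENNReal.ofReal (2 * M * R) * (C1 ^ (1 / p) * ENNReal.ofReal R ^ s) := by
        simp only [lintegral_const, Measure.restrict_apply_univ, Real.volume_Ioc]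
        norm_num
        gcongr
    _ = _ := by
        rw [ENNReal.ofReal_mul (by positivity), ENNReal.rpow_add _ _ hRz hRt, ENNReal.rpow_one]
        ring

lemma aux_tendsto_pow {s : ℝ} (hs : s < -1) {C : ℝ≥0∞} (hC : C ≠ ⊤) :
    Tendsto (fun n : ℕ => C * ENNReal.ofReal ((n : ℝ) + 2) ^ (s + 1)) atTop (𝓝 0) := by
  have h1 : Tendsto (fun n : ℕ => ((n : ℝ) + 2) ^ (-(-(s + 1)))) atTop (𝓝 0) :=
    (tendsto_rpow_neg_atTop (by linarith)).comp
      (tendsto_atTop_add_const_right _ _ tendsto_natCast_atTop_atTop)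
  have h2 := ENNReal.tendsto_ofReal h1
  have h3 := ENNReal.Tendsto.const_mul h2 (Or.inr hC)
  simp only [ENNReal.ofReal_zero, mul_zero] at h3
  refine h3.congr fun n => ?_
  rw [neg_neg, ENNReal.ofReal_rpow_of_pos (by positivity)]

lemma aux_osc_ray {N : ℕ} {s p : ℝ} (hp : 1 ≤ p) {u : Euc N → ℝ}
    (hu : ContDiff ℝ 1 u) (hK : ∫⁻ x, JJ x ^ (-s * p - N) * GG u x ^ p ≠ ⊤)
    {e e2 : Euc N} (he : ‖e‖ = 1) (he2 : ‖e2‖ = 1) (hee : inner ℝ e e2 = 0)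
    {x : Euc N} (hx : 0 ≤ inner ℝ x e) :
    ∃ C : ℝ≥0∞, C ≠ ⊤ ∧ ∀ R : ℝ, 2 ≤ R →
      ‖(⨍ z in ball (0 : Euc N) 1, u ((R • x + ((R - 1) * (3 / 4)) • e) + ((R - 1) / 4) • z)) -
        ⨍ z in ball (0 : Euc N) 1, u (((R - 1) * (3 / 4)) • e2 + ((R - 1) / 4) • z)‖ₑ
        ≤ C * ENNReal.ofReal R ^ (s + 1) := by
  obtain ⟨C, hC, h⟩ := aux_osc (M := ‖x‖ + 1) hp hu hK (by positivity)
  refine ⟨C + C, by finiteness, ?_⟩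
  intro R hR
  have h1 := h R hR (((R - 1) * (3 / 4)) • e) (R • x + ((R - 1) * (3 / 4)) • e) (by
    intro t ht
    have e1 : ((R - 1) * (3 / 4)) • e + t • (R • x + ((R - 1) * (3 / 4)) • e
        - ((R - 1) * (3 / 4)) • e) = ((R - 1) * (3 / 4)) • e + (t * R) • x := by module
    rw [e1]
    have ht0 := ht.1
    have ht1 := ht.2
    have hA : 0 ≤ (R - 1) * (3 / 4) := by nlinarith
    constructor
    · apply le_of_sq_le_sq _ (norm_nonneg _)
      rw [norm_add_sq_real, norm_smul, he, inner_smul_right, inner_smul_left, real_inner_comm]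
      have h3 : 0 ≤ t * R * ((R - 1) * (3 / 4) * inner ℝ x e) := by positivity
      have h4 : 0 ≤ ‖(t * R) • x‖ ^ 2 := by positivity
      rw [Real.norm_of_nonneg hA]
      simp only [conj_trivial]
      nlinarith
    · refine (norm_add_le _ _).trans ?_
      rw [norm_smul, norm_smul, he, Real.norm_of_nonneg hA, Real.norm_of_nonneg (by positivity)]
      have : t * R * ‖x‖ ≤ 1 * R * ‖x‖ := by gcongr
      nlinarith)
  have h2 := h R hR (((R - 1) * (3 / 4)) • e2) (((R - 1) * (3 / 4)) • e) (by
    intro t ht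
    have e1 : ((R - 1) * (3 / 4)) • e2 + t • (((R - 1) * (3 / 4)) • e
        - ((R - 1) * (3 / 4)) • e2) = ((R - 1) * (3 / 4)) • (t • e + (1 - t) • e2) := by module
    rw [e1]
    have ht0 := ht.1
    have ht1 := ht.2
    have hA : 0 ≤ (R - 1) * (3 / 4) := by nlinarith
    rw [norm_smul, Real.norm_of_nonneg hA]
    constructor
    · have h5 : 2 / 3 ≤ ‖t • e + (1 - t) • e2‖ := by
        apply le_of_sq_le_sq _ (norm_nonneg _)
        rw [norm_add_sq_real, norm_smul, norm_smul, he, he2, inner_smul_right, inner_smul_left, hee,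
          Real.norm_of_nonneg ht0, Real.norm_of_nonneg (by linarith)]
        nlinarith [sq_nonneg (t - 1/2)]
      nlinarith
    · have h5 : ‖t • e + (1 - t) • e2‖ ≤ 1 := by
        refine (norm_add_le _ _).trans ?_
        rw [norm_smul, norm_smul, he, he2, Real.norm_of_nonneg ht0,
          Real.norm_of_nonneg (by linarith)]
        linarith
      nlinarith [norm_nonneg x])
  rw [add_mul]
  refine le_trans ?_ (add_le_add h1 h2)
  refine le_trans (le_of_eq ?_) (enorm_add_le _ _)
  congr 1
  abel

lemma aux_exists_const {N : ℕ} (hN : 1 < N) {s p : ℝ} (hs : s < -1) (hp : 1 ≤ p) {u : Euc N → ℝ}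
    (hu : ContDiff ℝ 1 u) (hK : ∫⁻ x, JJ x ^ (-s * p - N) * GG u x ^ p ≠ ⊤)
    {e1 : Euc N} (he1 : ‖e1‖ = 1) {e2 : Euc N} (he2 : ‖e2‖ = 1) (hee : inner ℝ e1 e2 = 0) :
    ∃ c : ℝ, ∀ e : Euc N, (e = e1 ∨ e = -e1) → ∀ x : Euc N, 0 ≤ inner ℝ x e →
      ‖u x - c‖ₑ ≤ (volume (ball (0 : Euc N) 1))⁻¹ * (JJ x * PP e (GG u) x) := by
  set b := volume (ball (0 : Euc N) 1) with hb
  have hbt : b ≠ ⊤ := measure_ball_lt_top.ne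
  have hb0 : b ≠ 0 := (measure_ball_pos _ _ one_pos).ne'
  set Ref : ℕ → ℝ := fun n => ⨍ z in ball (0 : Euc N) 1,
    u (((((n : ℝ) + 2) - 1) * (3 / 4)) • e2 + ((((n : ℝ) + 2) - 1) / 4) • z) with hRef
  -- a point with finite potential
  obtain ⟨x0, hx0, hfin⟩ : ∃ x0 : Euc N, 0 ≤ inner ℝ x0 e1 ∧ PP e1 (GG u) x0 ≠ ⊤ := by
    obtain ⟨C, hC, hH⟩ := hardy_op (N := N) hs hp
    have h1 := hH e1 he1 (GG u) (continuous_GG hu).measurable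
    by_contra hcon
    push Not at hcon
    have h2 : ∫⁻ x in {x : Euc N | 0 ≤ inner ℝ x e1},
        JJ x ^ (-s * p - N) * PP e1 (GG u) x ^ p = ⊤ := by
      have : ∫⁻ x in {x : Euc N | 0 ≤ inner ℝ x e1},
          JJ x ^ (-s * p - N) * PP e1 (GG u) x ^ p
          = ∫⁻ x in {x : Euc N | 0 ≤ inner ℝ x e1}, ⊤ := by
        apply setLIntegral_congr_fun
        · exact measurableSet_le measurable_const (by fun_prop)
        intro x hx
        simp only
        rw [hcon x hx, ENNReal.top_rpow_of_pos (by linarith),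
          ENNReal.mul_top (JJ_rpow_ne_zero x _)]
      rw [this, setLIntegral_const, ENNReal.top_mul]
      have hpos : 0 < volume {x : Euc N | 0 < inner ℝ x e1} := by
        apply IsOpen.measure_pos
        · exact isOpen_lt continuous_const (by fun_prop)
        · refine ⟨e1, ?_⟩
          simp [he1]
      exact (lt_of_lt_of_le hpos (measure_mono fun x (hx : 0 < inner ℝ x e1) => le_of_lt hx)).ne'
    rw [h2, top_le_iff] at h1
    exact (ENNReal.mul_ne_top hC hK) h1
  have key : ∀ e : Euc N, (e = e1 ∨ e = -e1) → ∀ x : Euc N, 0 ≤ inner ℝ x e →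
      ∃ C : ℝ≥0∞, C ≠ ⊤ ∧ ∀ n : ℕ, ‖u x - Ref n‖ₑ ≤ b⁻¹ * (JJ x * PP e (GG u) x) +
        C * ENNReal.ofReal ((n : ℝ) + 2) ^ (s + 1) := by
    intro e hee' x hx
    have he : ‖e‖ = 1 := by rcases hee' with rfl | rfl <;> simp [he1]
    have hee2 : inner ℝ e e2 = 0 := by rcases hee' with rfl | rfl <;> simp [hee]
    obtain ⟨C, hC, h⟩ := aux_osc_ray (s := s) hp hu hK he he2 hee2 hx
    refine ⟨C, hC, fun n => ?_⟩
    have hn : (2 : ℝ) ≤ (n : ℝ) + 2 := by linarith [(Nat.cast_nonneg n : (0 : ℝ) ≤ n)]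
    have h1 := h ((n : ℝ) + 2) hn
    have h2 := aux_ray_avg hu he x (R := (n : ℝ) + 2) (by linarith)
    refine le_trans ?_ (add_le_add h2 h1)
    rw [← enorm_neg (_ - u x)]
    refine le_trans (le_of_eq ?_) (enorm_add_le _ _)
    congr 1
    simp only [hRef]
    abel
  -- boundedness and subsequence
  obtain ⟨C, hC, hk⟩ := key e1 (Or.inl rfl) x0 hx0
  have hT : b⁻¹ * (JJ x0 * PP e1 (GG u) x0) + C * 1 ≠ ⊤ := by
    have h1 : b⁻¹ ≠ ⊤ := by simpa using hb0
    have := JJ_ne_top x0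
    finiteness
  have hbd : ∀ n, Ref n ∈ closedBall (u x0) (b⁻¹ * (JJ x0 * PP e1 (GG u) x0) + C * 1).toReal := by
    intro n
    rw [mem_closedBall, dist_comm, dist_eq_norm, ← toReal_enorm]
    apply ENNReal.toReal_mono hT
    refine (hk n).trans ?_
    gcongr
    rw [ENNReal.ofReal_rpow_of_pos (by positivity), ENNReal.ofReal_le_one]
    apply Real.rpow_le_one_of_one_le_of_nonpos
    · linarith [(Nat.cast_nonneg n : (0 : ℝ) ≤ n)]
    · linarith
  obtain ⟨c, -, φ, hφ, hc⟩ := tendsto_subseq_of_bounded isBounded_closedBall hbd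
  refine ⟨c, fun e he x hx => ?_⟩
  obtain ⟨C, hC, hk⟩ := key e he x hx
  have h1 : Tendsto (fun n => ‖u x - Ref (φ n)‖ₑ) atTop (𝓝 ‖u x - c‖ₑ) :=
    (tendsto_const_nhds.sub hc).enorm
  have h2 : Tendsto (fun n => b⁻¹ * (JJ x * PP e (GG u) x) +
        C * ENNReal.ofReal ((φ n : ℝ) + 2) ^ (s + 1)) atTop
        (𝓝 (b⁻¹ * (JJ x * PP e (GG u) x) + 0)) :=
    tendsto_const_nhds.add ((aux_tendsto_pow hs hC).comp hφ.tendsto_atTop)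
  rw [add_zero] at h2
  exact le_of_tendsto_of_tendsto' h1 h2 fun n => hk (φ n)

/-- Hardy inequality with tails, for smooth functions. -/
lemma hardy_smooth {N : ℕ} (hN : 1 < N) {s p : ℝ} (hs : s < -1) (hp : 1 ≤ p) :
    ∃ C : ℝ≥0∞, C ≠ ⊤ ∧ ∀ u : Euc N → ℝ, ContDiff ℝ 1 u →
      ∫⁻ x, JJ x ^ (-s * p - N) * GG u x ^ p ≠ ⊤ →
      ∃ c : ℝ, ∀ R : ℝ,
        ∫⁻ x in {x : Euc N | R ≤ ‖x‖}, JJ x ^ (-(s + 1) * p - N) * ‖u x - c‖ₑ ^ p ≤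
          C * ∫⁻ x in {x : Euc N | R / 4 - 1 ≤ ‖x‖}, JJ x ^ (-s * p - N) * GG u x ^ p := by
  obtain ⟨C, hC, hH⟩ := hardy_op (N := N) hs hp
  set b := volume (ball (0 : Euc N) 1) with hb
  have hbt : b ≠ ⊤ := measure_ball_lt_top.ne
  have hb0 : b ≠ 0 := (measure_ball_pos _ _ one_pos).ne'
  have hp0 : 0 < p := by linarith
  have hbp : b⁻¹ ^ p ≠ ⊤ := ENNReal.rpow_ne_top_of_nonneg hp0.le (by simpa using hb0)
  refine ⟨b⁻¹ ^ p * C + b⁻¹ ^ p * C, by finiteness, ?_⟩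
  intro u hu hK
  set e1 : Euc N := EuclideanSpace.single ⟨0, by omega⟩ 1
  set e2 : Euc N := EuclideanSpace.single ⟨1, hN⟩ 1
  have he1 : ‖e1‖ = 1 := by simp [e1]
  have he2 : ‖e2‖ = 1 := by simp [e2]
  have hee : inner ℝ e1 e2 = 0 := by
    simp [e1, e2, EuclideanSpace.inner_single_left]
  obtain ⟨c, hc⟩ := aux_exists_const hN hs hp hu hK he1 he2 hee
  refine ⟨c, fun R => ?_⟩
  set T : Set (Euc N) := {x : Euc N | R / 4 - 1 ≤ ‖x‖} with hT
  have hTm : MeasurableSet T := measurableSet_le measurable_const measurable_norm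
  set S : Set (Euc N) := {x : Euc N | R ≤ ‖x‖} with hS
  have hSm : MeasurableSet S := measurableSet_le measurable_const measurable_norm
  set G := T.indicator (GG u) with hG
  have hGm : Measurable G := (continuous_GG hu).measurable.indicator hTm
  have hKT : ∫⁻ x, JJ x ^ (-s * p - N) * G x ^ p =
      ∫⁻ x in T, JJ x ^ (-s * p - N) * GG u x ^ p := by
    rw [← lintegral_indicator hTm]
    apply lintegral_congr
    intro x
    by_cases hx : x ∈ T
    · simp [hG, Set.indicator_of_mem hx]
    · simp [hG, Set.indicator_of_notMem hx, hp0]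
  have hhalf : ∀ e : Euc N, (e = e1 ∨ e = -e1) →
      ∫⁻ x in S ∩ {x : Euc N | 0 ≤ inner ℝ x e}, JJ x ^ (-(s + 1) * p - N) * ‖u x - c‖ₑ ^ p ≤
        b⁻¹ ^ p * C * ∫⁻ x in T, JJ x ^ (-s * p - N) * GG u x ^ p := by
    intro e hee'
    have he : ‖e‖ = 1 := by rcases hee' with rfl | rfl <;> simp [he1]
    have hHm : MeasurableSet {x : Euc N | 0 ≤ inner ℝ x e} :=
      measurableSet_le measurable_const (by fun_prop)
    calc _ ≤ ∫⁻ x in S ∩ {x : Euc N | 0 ≤ inner ℝ x e},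
          b⁻¹ ^ p * (JJ x ^ (-s * p - N) * PP e G x ^ p) := by
          apply setLIntegral_mono' (hSm.inter hHm)
          intro x hx
          have h1 : PP e (GG u) x ≤ PP e G x := by
            unfold PP
            apply setLIntegral_mono' measurableSet_Ioi
            intro l hl
            apply setLIntegral_mono' measurableSet_ball
            intro z hz
            have hz1 : ‖z‖ ≤ 1 := by simpa using (mem_ball_zero_iff.1 hz).le
            have hl1 : (1 : ℝ) < l := hl
            have h2 := ray_lower he hx.2 hz1 hl1.le
            have h3 : R ≤ ‖x‖ := hx.1
            have h4 : ray e x z l ∈ T := by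
              simp only [hT, Set.mem_ofPred_eq]
              have := norm_nonneg x
              nlinarith
            rw [hG, Set.indicator_of_mem h4]
          have h5 := (hc e hee' x hx.2).trans (by gcongr : _ ≤ b⁻¹ * (JJ x * PP e G x))
          calc _ ≤ JJ x ^ (-(s + 1) * p - N) * (b⁻¹ * (JJ x * PP e G x)) ^ p := by gcongr
            _ = b⁻¹ ^ p * ((JJ x ^ (-(s + 1) * p - N) * JJ x ^ p) * PP e G x ^ p) := by
              rw [ENNReal.mul_rpow_of_nonneg _ _ hp0.le, ENNReal.mul_rpow_of_nonneg _ _ hp0.le]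
              ring
            _ = _ := by
              rw [← ENNReal.rpow_add _ _ (JJ_ne_zero x) (JJ_ne_top x)]
              ring_nf
      _ ≤ ∫⁻ x in {x : Euc N | 0 ≤ inner ℝ x e},
          b⁻¹ ^ p * (JJ x ^ (-s * p - N) * PP e G x ^ p) :=
          lintegral_mono_set Set.inter_subset_right
      _ = b⁻¹ ^ p * ∫⁻ x in {x : Euc N | 0 ≤ inner ℝ x e},
          (JJ x ^ (-s * p - N) * PP e G x ^ p) := lintegral_const_mul' _ _ hbp
      _ ≤ b⁻¹ ^ p * (C * ∫⁻ x, JJ x ^ (-s * p - N) * G x ^ p) :=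
          mul_le_mul' le_rfl (hH e he G hGm)
      _ = _ := by rw [hKT, mul_assoc]
  have hcov : S ⊆ (S ∩ {x : Euc N | 0 ≤ inner ℝ x e1}) ∪ (S ∩ {x : Euc N | 0 ≤ inner ℝ x (-e1)}) := by
    intro x hx
    rcases le_total 0 (inner ℝ x e1) with h | h
    · exact Or.inl ⟨hx, h⟩
    · refine Or.inr ⟨hx, ?_⟩
      simp only [Set.mem_ofPred_eq, inner_neg_right]
      linarith
  refine (lintegral_mono_set hcov).trans ((lintegral_union_le _ _ _).trans ?_)
  rw [add_mul]
  exact add_le_add (hhalf e1 (Or.inl rfl)) (hhalf (-e1) (Or.inr rfl))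

lemma aux_local {N : ℕ} {p : ℝ} (hp : 1 ≤ p) (σ : ℝ) :
    ∃ C : ℝ≥0∞, C ≠ ⊤ ∧ ∀ F : Euc N → ℝ≥0∞, Measurable F → ∀ (x : Euc N) (A : ℝ≥0∞),
      ∫⁻ z in ball x ((1 + ‖x‖) / 4), JJ z ^ (-σ * p - N) * F z ^ p ≤ A ^ p →
      ∀ t : ℝ, 0 < t → t ≤ 1 →
        ∫⁻ z in ball (0 : Euc N) 1, F (x + (t * ((1 + ‖x‖) / 4)) • z) ≤
          C * (ENNReal.ofReal t ^ (-(N : ℝ) / p) * JJ x ^ σ * A) := by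
  have hp0 : 0 < p := by linarith
  set a := -σ * p - N with ha
  set C1 : ℝ≥0∞ := volume (ball (0 : Euc N) 1) ^ (p - 1) * ENNReal.ofReal 2 ^ |a| with hC1
  have hC1t : C1 ≠ ⊤ := by
    apply ENNReal.mul_ne_top
    · exact ENNReal.rpow_ne_top_of_nonneg (by linarith) measure_ball_lt_top.ne
    · exact ENNReal.rpow_ne_top_of_nonneg (abs_nonneg _) ENNReal.ofReal_ne_top
  have h4t : ENNReal.ofReal (1 / 4) ^ (-(N : ℝ)) ≠ ⊤ :=
    ENNReal.rpow_ne_top_of_ne_zero (by norm_num) ENNReal.ofReal_ne_top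
  refine ⟨(C1 * ENNReal.ofReal (1 / 4) ^ (-(N : ℝ))) ^ (1 / p),
    ENNReal.rpow_ne_top_of_nonneg (by positivity) (ENNReal.mul_ne_top hC1t h4t), ?_⟩
  intro F hF x A hA t ht0 ht1
  have hR : 0 < 1 + ‖x‖ := by positivity
  have hball : ball x (t * ((1 + ‖x‖) / 4)) ⊆ ball x ((1 + ‖x‖) / 4) := by
    apply ball_subset_ball
    nlinarith
  have hz : ∀ z ∈ ball x (t * ((1 + ‖x‖) / 4)),
      1 + ‖x‖ ≤ 2 * (1 + ‖z‖) ∧ 1 + ‖z‖ ≤ 2 * (1 + ‖x‖) := by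
    intro z hz
    have h1 := hball hz
    rw [mem_ball, dist_eq_norm] at h1
    have h2 := norm_sub_norm_le z x
    have h3 := norm_sub_norm_le x z
    rw [norm_sub_rev] at h3
    constructor <;> linarith
  have h1 := aux_ball_bound hF hp a (by norm_num : (1 : ℝ) ≤ 2) x (r := t * ((1 + ‖x‖) / 4))
    (by positivity) hR (fun z h => (hz z h).1) (fun z h => (hz z h).2)
  have h2 : ∫⁻ z in ball x (t * ((1 + ‖x‖) / 4)), JJ z ^ a * F z ^ p ≤ A ^ p :=
    (lintegral_mono_set hball).trans hA
  rw [← ENNReal.rpow_le_rpow_iff hp0]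
  refine h1.trans ?_
  have e1 : ENNReal.ofReal (t * ((1 + ‖x‖) / 4)) ^ (-(N : ℝ)) =
      ENNReal.ofReal (1 / 4) ^ (-(N : ℝ)) * (ENNReal.ofReal t ^ (-(N : ℝ)) * JJ x ^ (-(N : ℝ))) := by
    rw [JJ, ENNReal.ofReal_rpow_of_pos (by positivity), ENNReal.ofReal_rpow_of_pos (by positivity),
      ENNReal.ofReal_rpow_of_pos (by positivity), ENNReal.ofReal_rpow_of_pos (by positivity),
      ← ENNReal.ofReal_mul (by positivity), ← ENNReal.ofReal_mul (by positivity),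
      ← Real.mul_rpow (by positivity) (by positivity),
      ← Real.mul_rpow (by positivity) (by positivity)]
    congr 2
    ring
  have e2 : JJ x ^ (-(N : ℝ)) * JJ x ^ (-a) = JJ x ^ (σ * p) := by
    rw [← ENNReal.rpow_add _ _ (JJ_ne_zero x) (JJ_ne_top x)]
    congr 1
    rw [ha]; ring
  calc _ ≤ C1 * (ENNReal.ofReal (t * ((1 + ‖x‖) / 4)) ^ (-(N : ℝ)) * JJ x ^ (-a) * A ^ p) := by
        refine mul_le_mul' le_rfl (mul_le_mul' le_rfl h2)
    _ = C1 * ENNReal.ofReal (1 / 4) ^ (-(N : ℝ)) *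
        (ENNReal.ofReal t ^ (-(N : ℝ)) * (JJ x ^ (-(N : ℝ)) * JJ x ^ (-a)) * A ^ p) := by
        rw [e1]; ring
    _ = _ := by
        rw [e2, ENNReal.mul_rpow_of_nonneg _ _ hp0.le, ENNReal.mul_rpow_of_nonneg _ _ hp0.le,
          ENNReal.mul_rpow_of_nonneg _ _ hp0.le, ← ENNReal.rpow_mul, ← ENNReal.rpow_mul,
          ← ENNReal.rpow_mul]
        congr 2
        · rw [one_div_mul_cancel hp0.ne', ENNReal.rpow_one]
        · congr 2
          field_simp

lemma aux_int_t {N : ℕ} {p : ℝ} (hp : 1 ≤ p) (hNp : (N : ℝ) < p) :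
    ∫⁻ t in Set.Ioc (0 : ℝ) 1, ENNReal.ofReal t ^ (-(N : ℝ) / p) ≠ ⊤ := by
  have hp0 : 0 < p := by linarith
  have h1 : IntegrableOn (fun t : ℝ => t ^ (-(N : ℝ) / p)) (Set.Ioc (0 : ℝ) 1) := by
    have := intervalIntegral.intervalIntegrable_rpow' (a := 0) (b := 1) (r := -(N : ℝ) / p) (by
      rw [lt_div_iff₀ hp0]; linarith)
    rwa [intervalIntegrable_iff_integrableOn_Ioc_of_le zero_le_one] at this
  have h2 := h1.lintegral_lt_top
  refine ne_of_lt (lt_of_le_of_lt (le_of_eq ?_) h2)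
  apply setLIntegral_congr_fun measurableSet_Ioc
  intro t ht
  simp only
  rw [ENNReal.ofReal_rpow_of_pos ht.1]

/-- Pointwise weighted Morrey estimate. -/
lemma aux_morrey {N : ℕ} {s p : ℝ} (hp : 1 ≤ p) (hNp : (N : ℝ) < p) :
    ∃ C : ℝ≥0∞, C ≠ ⊤ ∧ ∀ w : Euc N → ℝ, ContDiff ℝ 1 w → ∀ (x : Euc N) (A : ℝ≥0∞),
      ∫⁻ z in ball x ((1 + ‖x‖) / 4), JJ z ^ (-s * p - N) * GG w z ^ p ≤ A ^ p →
      ∫⁻ z in ball x ((1 + ‖x‖) / 4), JJ z ^ (-(s + 1) * p - N) * ‖w z‖ₑ ^ p ≤ A ^ p →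
      JJ x ^ (-(s + 1)) * ‖w x‖ₑ ≤ C * A := by
  obtain ⟨C1, hC1, H1⟩ := aux_local (N := N) hp s
  obtain ⟨C2, hC2, H2⟩ := aux_local (N := N) hp (s + 1)
  set b := volume (ball (0 : Euc N) 1) with hb
  have hbt : b ≠ ⊤ := measure_ball_lt_top.ne
  have hb0 : b ≠ 0 := (measure_ball_pos _ _ one_pos).ne'
  set I := ∫⁻ t in Set.Ioc (0 : ℝ) 1, ENNReal.ofReal t ^ (-(N : ℝ) / p) with hI
  have hIt : I ≠ ⊤ := aux_int_t hp hNp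
  have hbi : b⁻¹ ≠ ⊤ := by simpa using hb0
  refine ⟨b⁻¹ * (C2 + C1 * I), by finiteness, ?_⟩
  intro w hw x A hG hW
  set ρ := (1 + ‖x‖) / 4 with hρ
  have hρ0 : 0 < ρ := by positivity
  have hwm : Measurable fun z => ‖w z‖ₑ := hw.continuous.enorm.measurable
  have hGm := (continuous_GG hw).measurable
  have h1 := H2 _ hwm x A hW 1 one_pos le_rfl
  simp only [ENNReal.ofReal_one, ENNReal.one_rpow, one_mul] at h1
  have hpt : ∀ z ∈ ball (0 : Euc N) 1, ‖w x‖ₑ ≤ ‖w (x + ρ • z)‖ₑ +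
      ENNReal.ofReal ρ * ∫⁻ t in Set.Ioc (0 : ℝ) 1, GG w (x + (t * ρ) • z) := by
    intro z hz
    have h2 := aux_seg hw x (ρ • z) (zero_le_one (α := ℝ))
    simp only [one_smul, zero_smul, add_zero] at h2
    have h3 : ‖ρ • z‖ₑ ≤ ENNReal.ofReal ρ := by
      rw [← ofReal_norm]
      apply ENNReal.ofReal_le_ofReal
      rw [norm_smul, Real.norm_of_nonneg hρ0.le]
      have := mem_ball_zero_iff.1 hz
      nlinarith
    have h4 : ‖w x‖ₑ ≤ ‖w (x + ρ • z)‖ₑ + ‖w (x + ρ • z) - w x‖ₑ := by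
      rw [← enorm_neg (w (x + ρ • z) - w x)]
      refine le_trans (le_of_eq ?_) (enorm_add_le _ _)
      congr 1; abel
    refine h4.trans (add_le_add le_rfl (h2.trans ?_))
    simp only [smul_smul]
    gcongr
  have hm2 : Measurable (Function.uncurry fun (z : Euc N) (t : ℝ) => GG w (x + (t * ρ) • z)) :=
    hGm.comp (by fun_prop)
  have h5 : b * ‖w x‖ₑ ≤ C2 * (JJ x ^ (s + 1) * A) +
      ENNReal.ofReal ρ * ∫⁻ t in Set.Ioc (0 : ℝ) 1,
        C1 * (ENNReal.ofReal t ^ (-(N : ℝ) / p) * JJ x ^ s * A) := by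
    calc b * ‖w x‖ₑ = ∫⁻ z in ball (0 : Euc N) 1, ‖w x‖ₑ := by
          rw [setLIntegral_const, mul_comm]
      _ ≤ ∫⁻ z in ball (0 : Euc N) 1, (‖w (x + ρ • z)‖ₑ +
          ENNReal.ofReal ρ * ∫⁻ t in Set.Ioc (0 : ℝ) 1, GG w (x + (t * ρ) • z)) :=
          setLIntegral_mono' measurableSet_ball hpt
      _ = (∫⁻ z in ball (0 : Euc N) 1, ‖w (x + ρ • z)‖ₑ) + ENNReal.ofReal ρ *
          ∫⁻ z in ball (0 : Euc N) 1, ∫⁻ t in Set.Ioc (0 : ℝ) 1, GG w (x + (t * ρ) • z) := by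
          have hwm2 : Measurable fun z => ‖w (x + ρ • z)‖ₑ := hwm.comp (by fun_prop)
          rw [lintegral_add_left hwm2,
            lintegral_const_mul' _ _ ENNReal.ofReal_ne_top]
      _ ≤ _ := by
          refine add_le_add h1 (mul_le_mul' le_rfl ?_)
          rw [lintegral_lintegral_swap hm2.aemeasurable]
          apply setLIntegral_mono' measurableSet_Ioc
          intro t ht
          exact H1 _ hGm x A hG t ht.1 ht.2
  have h6 : ENNReal.ofReal ρ * ∫⁻ t in Set.Ioc (0 : ℝ) 1,
        C1 * (ENNReal.ofReal t ^ (-(N : ℝ) / p) * JJ x ^ s * A) ≤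
      C1 * I * (JJ x ^ (s + 1) * A) := by
    have e1 : ∫⁻ t in Set.Ioc (0 : ℝ) 1,
        C1 * (ENNReal.ofReal t ^ (-(N : ℝ) / p) * JJ x ^ s * A) = C1 * I * (JJ x ^ s * A) := by
      rw [lintegral_const_mul' _ _ hC1, mul_assoc C1]
      congr 1
      rw [hI, ← lintegral_mul_const]
      · simp only [mul_assoc]
      · fun_prop
    have e2 : ENNReal.ofReal ρ ≤ JJ x := by
      apply ENNReal.ofReal_le_ofReal
      rw [hρ]; linarith [norm_nonneg x]
    rw [e1]
    calc _ ≤ JJ x * (C1 * I * (JJ x ^ s * A)) := by gcongr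
      _ = C1 * I * ((JJ x ^ (1:ℝ) * JJ x ^ s) * A) := by rw [ENNReal.rpow_one]; ring
      _ = _ := by rw [← ENNReal.rpow_add _ _ (JJ_ne_zero x) (JJ_ne_top x), add_comm]
  have h7 : b * ‖w x‖ₑ ≤ (C2 + C1 * I) * (JJ x ^ (s + 1) * A) :=
    h5.trans ((add_le_add le_rfl h6).trans (by rw [add_mul]))
  calc JJ x ^ (-(s + 1)) * ‖w x‖ₑ = JJ x ^ (-(s + 1)) * (b⁻¹ * (b * ‖w x‖ₑ)) := by
        rw [← mul_assoc b⁻¹, ENNReal.inv_mul_cancel hb0 hbt, one_mul]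
    _ ≤ JJ x ^ (-(s + 1)) * (b⁻¹ * ((C2 + C1 * I) * (JJ x ^ (s + 1) * A))) := by gcongr
    _ = (JJ x ^ (-(s + 1)) * JJ x ^ (s + 1)) * (b⁻¹ * (C2 + C1 * I) * A) := by ring
    _ = _ := by rw [JJ_cancel, one_mul]

lemma aux_rpow_compare_real {A B C0 : ℝ} (hA : 0 < A) (hB : 0 < B) (hC : 1 ≤ C0)
    (h1 : A ≤ C0 * B) (h2 : B ≤ C0 * A) (a : ℝ) : A ^ a ≤ C0 ^ |a| * B ^ a := by
  have h := aux_rpow_compare hA hB hC h1 h2 a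
  have hC' : 0 < C0 := by linarith
  rw [ENNReal.ofReal_rpow_of_pos hA, ENNReal.ofReal_rpow_of_pos hB, ENNReal.ofReal_rpow_of_pos hC',
    ← ENNReal.ofReal_mul (by positivity)] at h
  exact (ENNReal.ofReal_le_ofReal_iff (by positivity)).1 h

/-- Smooth compactly supported approximations of the weight `(1+|x|)^α`. -/
lemma aux_cutoff {N : ℕ} (α : ℝ) :
    ∃ C : ℝ, 0 < C ∧ ∀ n : ℕ, 1 ≤ n → ∃ k : Euc N → ℝ, ContDiff ℝ 1 k ∧ HasCompactSupport k ∧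
      (∀ x, ‖k x‖ ≤ C * (1 + ‖x‖) ^ α) ∧ (∀ x, ‖fderiv ℝ k x‖ ≤ C * (1 + ‖x‖) ^ (α - 1)) ∧
      (∀ x, ‖x‖ ≤ n → (1 + ‖x‖) ^ α ≤ C * ‖k x‖) := by
  set χ : ContDiffBump (0 : Euc N) := ⟨1, 2, one_pos, by norm_num⟩ with hχ
  have hχc : ContDiff ℝ 1 χ := χ.contDiff
  obtain ⟨L, hL⟩ := (hχc.continuous_fderiv one_ne_zero).bounded_above_of_compact_support
    (χ.hasCompactSupport.fderiv (𝕜 := ℝ))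
  have hL0 : 0 ≤ L := (norm_nonneg _).trans (hL 0)
  set D : ℝ → ℝ := fun β => 2 ^ |β / 2| with hD
  have hD0 : ∀ β, 0 < D β := fun β => by simp only [hD]; positivity
  have e1 : ∀ (x : Euc N) (β : ℝ), ((1 + ‖x‖) ^ 2) ^ (β / 2) = (1 + ‖x‖) ^ β := by
    intro x β
    rw [← Real.rpow_natCast, ← Real.rpow_mul (by positivity)]
    congr 1
    push_cast; ring
  have hm1 : ∀ (x : Euc N) (β : ℝ), (1 + ‖x‖ ^ 2) ^ (β / 2) ≤ D β * (1 + ‖x‖) ^ β := by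
    intro x β
    rw [← e1 x β]
    have := norm_nonneg x
    exact aux_rpow_compare_real (by positivity) (by positivity) (by norm_num) (by nlinarith)
      (by nlinarith [sq_nonneg (1 - ‖x‖)]) _
  have hm2 : ∀ (x : Euc N) (β : ℝ), (1 + ‖x‖) ^ β ≤ D β * (1 + ‖x‖ ^ 2) ^ (β / 2) := by
    intro x β
    rw [← e1 x β]
    have := norm_nonneg x
    exact aux_rpow_compare_real (by positivity) (by positivity) (by norm_num)
      (by nlinarith [sq_nonneg (1 - ‖x‖)]) (by nlinarith) _
  refine ⟨D α * (1 + 3 * L) + |α| * D (α - 2), by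
    have := hD0 α; have := hD0 (α - 2); positivity, ?_⟩
  intro n hn
  have hn1 : (1 : ℝ) ≤ n := by exact_mod_cast hn
  have hn0 : (0 : ℝ) < n := by linarith
  set χn : Euc N → ℝ := fun x => χ ((n : ℝ)⁻¹ • x) with hχn
  set m : Euc N → ℝ := fun x => (1 + ‖x‖ ^ 2) ^ (α / 2) with hm
  have hχnc : ContDiff ℝ 1 χn := hχc.comp (by fun_prop)
  have hbase : ∀ x : Euc N, HasFDerivAt (fun x : Euc N => 1 + ‖x‖ ^ 2) (2 • innerSL ℝ x) x :=
    fun x => ((hasStrictFDerivAt_norm_sq x).hasFDerivAt).const_add 1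
  have hmc : ContDiff ℝ 1 m := by
    apply ContDiff.rpow_const_of_ne
    · exact contDiff_const.add (contDiff_norm_sq ℝ)
    · intro x; positivity
  have hmd : ∀ x, ‖fderiv ℝ m x‖ ≤ |α| * D (α - 2) * (1 + ‖x‖) ^ (α - 1) := by
    intro x
    have h1 := (hbase x).rpow_const (p := α / 2) (Or.inl (by positivity))
    rw [h1.fderiv, norm_smul]
    have h2 : ‖(2 : ℕ) • innerSL ℝ x‖ ≤ 2 * ‖x‖ := by
      refine (norm_nsmul_le).trans ?_
      rw [innerSL_apply_norm]; norm_num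
    have h3 := hm1 x (α - 2)
    have h4 : (α - 2) / 2 = α / 2 - 1 := by ring
    rw [h4] at h3
    have h5 : (1 + ‖x‖) ^ (α - 1) = (1 + ‖x‖) ^ (α - 2) * (1 + ‖x‖) := by
      rw [← Real.rpow_add_one (by positivity)]; ring_nf
    have hDD := hD0 (α - 2)
    rw [norm_mul, Real.norm_eq_abs, Real.norm_of_nonneg (by positivity), abs_div, abs_two, h5]
    calc _ ≤ |α| / 2 * (D (α - 2) * (1 + ‖x‖) ^ (α - 2)) * (2 * (1 + ‖x‖)) := by
          gcongr
          exact h2.trans (by linarith [norm_nonneg x])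
      _ = _ := by ring
  have hχ1 : ∀ x, ‖χn x‖ ≤ 1 := by
    intro x
    rw [Real.norm_of_nonneg χ.nonneg]; exact χ.le_one
  have hχd : ∀ x, ‖fderiv ℝ χn x‖ ≤ 3 * L / (1 + ‖x‖) := by
    intro x
    have h1 : fderiv ℝ χn x = (n : ℝ)⁻¹ • fderiv ℝ χ ((n : ℝ)⁻¹ • x) := by
      rw [hχn]
      exact fderiv_comp_smul (f := (χ : Euc N → ℝ)) _ 
    by_cases hx : ‖x‖ ≤ 2 * n
    · rw [h1, norm_smul, norm_inv, Real.norm_of_nonneg hn0.le, le_div_iff₀ (by positivity)]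
      have h2 := hL ((n : ℝ)⁻¹ • x)
      calc _ ≤ (n : ℝ)⁻¹ * L * (3 * n) := by
            gcongr; linarith
        _ = _ := by field_simp
    · have h2 : χ =ᶠ[𝓝 ((n : ℝ)⁻¹ • x)] 0 := by
        have : (n : ℝ)⁻¹ • x ∉ tsupport χ := by
          rw [χ.tsupport_eq, mem_closedBall_zero_iff, norm_smul, norm_inv,
            Real.norm_of_nonneg hn0.le, inv_mul_le_iff₀ hn0, mul_comm]
          exact hx
        exact notMem_tsupport_iff_eventuallyEq.1 this
      rw [h1, h2.fderiv_eq]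
      simp
      positivity
  refine ⟨fun x => χn x * m x, hχnc.mul hmc, ?_, ?_, ?_, ?_⟩
  · apply HasCompactSupport.mul_right
    exact χ.hasCompactSupport.comp_smul (inv_ne_zero hn0.ne')
  · intro x
    rw [norm_mul]
    have h1 := hm1 x α
    have hmn : ‖m x‖ = m x := Real.norm_of_nonneg (by simp only [hm]; positivity)
    have hX : 0 < (1 + ‖x‖) ^ α := by positivity
    have := hD0 α
    have := hD0 (α - 2)
    calc _ ≤ 1 * (D α * (1 + ‖x‖) ^ α) := by
          rw [hmn]; gcongr; exact hχ1 x
      _ ≤ _ := by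
          rw [one_mul]; gcongr
          have : 0 ≤ D α * (3 * L) + |α| * D (α - 2) := by positivity
          nlinarith
  · intro x
    have h1 := hm1 x α
    have hmn : ‖m x‖ = m x := Real.norm_of_nonneg (by simp only [hm]; positivity)
    have hDa := hD0 α
    have hDb := hD0 (α - 2)
    have h5 : (1 + ‖x‖) ^ α = (1 + ‖x‖) ^ (α - 1) * (1 + ‖x‖) := by
      rw [← Real.rpow_add_one (by positivity)]; ring_nf
    rw [fderiv_fun_mul (hχnc.differentiable one_ne_zero x) (hmc.differentiable one_ne_zero x)]
    refine (norm_add_le _ _).trans ?_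
    rw [norm_smul, norm_smul, hmn]
    calc _ ≤ 1 * (|α| * D (α - 2) * (1 + ‖x‖) ^ (α - 1)) +
          (D α * (1 + ‖x‖) ^ α) * (3 * L / (1 + ‖x‖)) := by
          gcongr
          · exact hχ1 x
          · exact hmd x
          · exact hχd x
      _ = (D α * (3 * L) + |α| * D (α - 2)) * (1 + ‖x‖) ^ (α - 1) := by
          rw [h5]; field_simp; ring
      _ ≤ _ := by gcongr; linarith
  · intro x hx
    have h1 := hm2 x α
    have hmn : ‖m x‖ = m x := Real.norm_of_nonneg (by simp only [hm]; positivity)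
    have hDa := hD0 α
    have hDb := hD0 (α - 2)
    have h2 : χn x = 1 := by
      apply χ.one_of_mem_closedBall
      rw [mem_closedBall_zero_iff, norm_smul, norm_inv, Real.norm_of_nonneg hn0.le,
        inv_mul_le_iff₀ hn0, mul_one]
      exact hx
    beta_reduce
    rw [h2, one_mul, hmn]
    refine h1.trans ?_
    have : 0 ≤ m x := by simp only [hm]; positivity
    gcongr
    have : 0 ≤ D α * (3 * L) + |α| * D (α - 2) := by positivity
    nlinarith

/-- Weighted Gagliardo-Nirenberg-Sobolev inequality. -/
lemma aux_gns {N : ℕ} {p q : ℝ} (hp : 1 ≤ p) (hpN : p < N) (hq : q = N * p / (N - p)) (α : ℝ) :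
    ∃ C : ℝ≥0∞, C ≠ ⊤ ∧ ∀ f : Euc N → ℝ, ContDiff ℝ 1 f →
      (∫⁻ x, (JJ x ^ α * ‖f x‖ₑ) ^ q) ^ (1 / q) ≤
        C * (∫⁻ x, (JJ x ^ α * GG f x + JJ x ^ (α - 1) * ‖f x‖ₑ) ^ p) ^ (1 / p) := by
  obtain ⟨C, hC, H⟩ := aux_cutoff (N := N) α
  have hp0 : 0 < p := by linarith
  have hN0 : (0 : ℝ) < N := by linarith
  have hNp : (0 : ℝ) < N - p := by linarith
  have hq0 : 0 < q := by rw [hq]; positivity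
  set p' : NNReal := p.toNNReal
  set q' : NNReal := q.toNNReal
  have hp' : (p' : ℝ) = p := Real.coe_toNNReal _ hp0.le
  have hq' : (q' : ℝ) = q := Real.coe_toNNReal _ hq0.le
  set K : ℝ≥0∞ := ((eLpNormLESNormFDerivOfEqInnerConst (volume : Measure (Euc N)) p : NNReal) : ℝ≥0∞) with hK
  refine ⟨ENNReal.ofReal C * (K * ENNReal.ofReal C), by finiteness, ?_⟩
  intro f hf
  set RHS := (∫⁻ x, (JJ x ^ α * GG f x + JJ x ^ (α - 1) * ‖f x‖ₑ) ^ p) ^ (1 / p) with hR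
  have hJ : ∀ (x : Euc N) (β : ℝ), ENNReal.ofReal ((1 + ‖x‖) ^ β) = JJ x ^ β := by
    intro x β
    rw [JJ, ENNReal.ofReal_rpow_of_pos (by positivity)]
  have key : ∀ n : ℕ, 1 ≤ n → (∫⁻ x in closedBall 0 n, (JJ x ^ α * ‖f x‖ₑ) ^ q) ^ (1 / q) ≤
      ENNReal.ofReal C * (K * ENNReal.ofReal C) * RHS := by
    intro n hn
    obtain ⟨k, hk, hks, hk1, hk2, hk3⟩ := H n hn
    have h1 := eLpNorm_le_eLpNorm_fderiv_of_eq_inner (volume : Measure (Euc N)) (hk.mul hf)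
      (hks.mul_right (f' := f)) (p := p') (p' := q') (by
        rw [← NNReal.coe_le_coe, hp']; exact_mod_cast hp) (by
        simp only [finrank_euclideanSpace, Fintype.card_fin]; exact_mod_cast hN0) (by
        rw [NNReal.coe_inv, hp', hq']
        simp only [finrank_euclideanSpace, Fintype.card_fin]
        rw [hq]
        field_simp)
    have hq0' : (q' : ℝ≥0∞) ≠ 0 := by
      simp only [ne_eq, ENNReal.coe_eq_zero]; intro h; rw [h] at hq'; simp at hq'; linarith
    have hp0' : (p' : ℝ≥0∞) ≠ 0 := by
      simp only [ne_eq, ENNReal.coe_eq_zero]; intro h; rw [h] at hp'; simp at hp'; linarith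
    rw [eLpNorm_eq_lintegral_rpow_enorm_toReal hq0' ENNReal.coe_ne_top,
      eLpNorm_eq_lintegral_rpow_enorm_toReal hp0' ENNReal.coe_ne_top,
      ENNReal.coe_toReal, ENNReal.coe_toReal, hp', hq', ← hK] at h1
    have h2 : (∫⁻ x, ‖fderiv ℝ (fun x => k x * f x) x‖ₑ ^ p) ^ (1 / p) ≤ ENNReal.ofReal C * RHS := by
      have : ∫⁻ x, ‖fderiv ℝ (fun x => k x * f x) x‖ₑ ^ p ≤
          ENNReal.ofReal C ^ p * ∫⁻ x, (JJ x ^ α * GG f x + JJ x ^ (α - 1) * ‖f x‖ₑ) ^ p := by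
        rw [← lintegral_const_mul' _ _ (ENNReal.rpow_ne_top_of_nonneg hp0.le ENNReal.ofReal_ne_top)]
        apply lintegral_mono
        intro x
        simp only
        rw [← ENNReal.mul_rpow_of_nonneg _ _ hp0.le]
        refine ENNReal.rpow_le_rpow ?_ hp0.le
        rw [fderiv_fun_mul (hk.differentiable one_ne_zero x) (hf.differentiable one_ne_zero x)]
        refine (enorm_add_le (k x • fderiv ℝ f x) (f x • fderiv ℝ k x)).trans ?_
        rw [enorm_smul, enorm_smul, mul_add, ← mul_assoc, ← mul_assoc, mul_comm ‖f x‖ₑ]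
        have h3 : ‖k x‖ₑ ≤ ENNReal.ofReal C * JJ x ^ α := by
          rw [← hJ, ← ENNReal.ofReal_mul hC.le, ← ofReal_norm]
          exact ENNReal.ofReal_le_ofReal (hk1 x)
        have h4 : ‖fderiv ℝ k x‖ₑ ≤ ENNReal.ofReal C * JJ x ^ (α - 1) := by
          rw [← hJ, ← ENNReal.ofReal_mul hC.le, ← ofReal_norm]
          exact ENNReal.ofReal_le_ofReal (hk2 x)
        exact add_le_add (mul_le_mul' h3 le_rfl) (mul_le_mul' h4 le_rfl)
      refine (ENNReal.rpow_le_rpow this (by positivity)).trans (le_of_eq ?_)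
      rw [ENNReal.mul_rpow_of_nonneg _ _ (by positivity), ← ENNReal.rpow_mul,
        mul_one_div_cancel hp0.ne', ENNReal.rpow_one]
    have h5 : (∫⁻ x in closedBall 0 n, (JJ x ^ α * ‖f x‖ₑ) ^ q) ^ (1 / q) ≤
        ENNReal.ofReal C * (∫⁻ x, ‖k x * f x‖ₑ ^ q) ^ (1 / q) := by
      have : ∫⁻ x in closedBall (0 : Euc N) n, (JJ x ^ α * ‖f x‖ₑ) ^ q ≤
          ENNReal.ofReal C ^ q * ∫⁻ x, ‖k x * f x‖ₑ ^ q := by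
        rw [← lintegral_const_mul' _ _ (ENNReal.rpow_ne_top_of_nonneg hq0.le ENNReal.ofReal_ne_top)]
        refine le_trans ?_ (setLIntegral_le_lintegral (closedBall (0 : Euc N) n) _)
        apply setLIntegral_mono' measurableSet_closedBall
        intro x hx
        rw [← ENNReal.mul_rpow_of_nonneg _ _ hq0.le]
        refine ENNReal.rpow_le_rpow ?_ hq0.le
        rw [enorm_mul, ← mul_assoc]
        gcongr
        rw [← hJ, ← ofReal_norm, ← ENNReal.ofReal_mul hC.le]
        exact ENNReal.ofReal_le_ofReal (hk3 x (by simpa using hx))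
      refine (ENNReal.rpow_le_rpow this (by positivity)).trans (le_of_eq ?_)
      rw [ENNReal.mul_rpow_of_nonneg _ _ (by positivity), ← ENNReal.rpow_mul,
        mul_one_div_cancel hq0.ne', ENNReal.rpow_one]
    calc _ ≤ _ := h5
      _ ≤ ENNReal.ofReal C * (K * (ENNReal.ofReal C * RHS)) := by
        gcongr
        exact h1.trans (mul_le_mul' le_rfl h2)
      _ = _ := by ring
  have hcov : AECover (volume : Measure (Euc N)) atTop
      (fun n : ℕ => closedBall (0 : Euc N) n) :=
    aecover_closedBall tendsto_natCast_atTop_atTop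
  have hmeas : Measurable fun x => (JJ x ^ α * ‖f x‖ₑ) ^ q :=
    ((measurable_JJ_rpow α).mul hf.continuous.enorm.measurable).pow_const q
  have hlim := hcov.lintegral_tendsto_of_countably_generated hmeas.aemeasurable
  have hlim2 := ((ENNReal.continuous_rpow_const (y := 1 / q)).tendsto _).comp hlim
  refine le_of_tendsto hlim2 ?_
  filter_upwards [eventually_ge_atTop 1] with n hn
  exact key n hn

lemma JJ_add {N : ℕ} (x : Euc N) (a b : ℝ) : JJ x ^ (a + b) = JJ x ^ a * JJ x ^ b :=
  ENNReal.rpow_add _ _ (JJ_ne_zero x) (JJ_ne_top x)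

lemma JJ_conv {N : ℕ} (x : Euc N) (y : ℝ≥0∞) (τ : ℝ) {q : ℝ} (hq : 0 ≤ q) :
    JJ x ^ (τ * q - N) * y ^ q = JJ x ^ (-(N : ℝ)) * (JJ x ^ τ * y) ^ q := by
  rw [ENNReal.mul_rpow_of_nonneg _ _ hq, ← ENNReal.rpow_mul, sub_eq_add_neg, JJ_add]
  ring

lemma aux_interp (x : ℝ≥0∞) {r q t : ℝ} (h1 : r ≤ q) (h2 : q ≤ t) : x ^ q ≤ x ^ r + x ^ t := by
  rcases le_total x 1 with h | h
  · exact (ENNReal.rpow_le_rpow_of_exponent_ge h h1).trans le_self_add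
  · exact (ENNReal.rpow_le_rpow_of_exponent_le h h2).trans le_add_self

/-- Weighted function `(1+|x|)^{-(s+1)} |w|`. -/
def WW {N : ℕ} (s : ℝ) (w : Euc N → ℝ) (x : Euc N) : ℝ≥0∞ := JJ x ^ (-(s + 1)) * ‖w x‖ₑ

/-- Weighted gradient `(1+|x|)^{-s} |∇w|`. -/
def G1 {N : ℕ} (s : ℝ) (w : Euc N → ℝ) (x : Euc N) : ℝ≥0∞ := JJ x ^ (-s) * GG w x

lemma measurable_WW {N : ℕ} (s : ℝ) {w : Euc N → ℝ} (hw : ContDiff ℝ 1 w) : Measurable (WW s w) :=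
  (measurable_JJ_rpow _).mul hw.continuous.enorm.measurable

lemma measurable_G1 {N : ℕ} (s : ℝ) {w : Euc N → ℝ} (hw : ContDiff ℝ 1 w) : Measurable (G1 s w) :=
  (measurable_JJ_rpow _).mul (continuous_GG hw).measurable

lemma measurable_JW {N : ℕ} (s : ℝ) {w : Euc N → ℝ} (hw : ContDiff ℝ 1 w) (r : ℝ) :
    Measurable fun x => JJ x ^ (-(N : ℝ)) * WW s w x ^ r :=
  (measurable_JJ_rpow _).mul ((measurable_WW s hw).pow_const r)

lemma measurable_JG {N : ℕ} (s : ℝ) {w : Euc N → ℝ} (hw : ContDiff ℝ 1 w) (r : ℝ) :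
    Measurable fun x => JJ x ^ (-(N : ℝ)) * G1 s w x ^ r :=
  (measurable_JJ_rpow _).mul ((measurable_G1 s hw).pow_const r)

lemma aux_interp_int {N : ℕ} (s : ℝ) {w : Euc N → ℝ} (hw : ContDiff ℝ 1 w) {r q t : ℝ}
    (h1 : r ≤ q) (h2 : q ≤ t) :
    ∫⁻ x, JJ x ^ (-(N : ℝ)) * WW s w x ^ q ≤
      (∫⁻ x, JJ x ^ (-(N : ℝ)) * WW s w x ^ r) + ∫⁻ x, JJ x ^ (-(N : ℝ)) * WW s w x ^ t := by
  rw [← lintegral_add_left (measurable_JW s hw r)]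
  apply lintegral_mono
  intro x
  simp only
  rw [← mul_add]
  gcongr
  exact aux_interp _ h1 h2

lemma aux_crit {N : ℕ} {s p q : ℝ} (hp : 1 ≤ p) (hpN : p < N) (hq : q = N * p / (N - p)) :
    ∃ C : ℝ≥0∞, C ≠ ⊤ ∧ ∀ w : Euc N → ℝ, ContDiff ℝ 1 w →
      ∫⁻ x, JJ x ^ (-(N : ℝ)) * G1 s w x ^ p ≤ 1 → ∫⁻ x, JJ x ^ (-(N : ℝ)) * WW s w x ^ p ≤ 1 →
      ∫⁻ x, JJ x ^ (-(N : ℝ)) * WW s w x ^ q ≤ C := by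
  obtain ⟨C, hC, H⟩ := aux_gns hp hpN hq (-s - N / p)
  have hp0 : 0 < p := by linarith
  have hN0 : (0 : ℝ) < N := by linarith
  have hNp : (0 : ℝ) < N - p := by linarith
  have hq0 : 0 < q := by rw [hq]; positivity
  have h2t : ((2 : ℝ≥0∞) ^ (p - 1) * 2) ^ (1 / p) ≠ ⊤ :=
    ENNReal.rpow_ne_top_of_nonneg (by positivity) (ENNReal.mul_ne_top
      (ENNReal.rpow_ne_top_of_nonneg (by linarith) (by norm_num)) (by norm_num))
  refine ⟨(C * ((2 : ℝ≥0∞) ^ (p - 1) * 2) ^ (1 / p)) ^ q,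
    ENNReal.rpow_ne_top_of_nonneg hq0.le (ENNReal.mul_ne_top hC h2t), ?_⟩
  intro w hw hG hW
  have h := H w hw
  have e1 : ∫⁻ x, (JJ x ^ (-s - N / p) * ‖w x‖ₑ) ^ q = ∫⁻ x, JJ x ^ (-(N : ℝ)) * WW s w x ^ q := by
    apply lintegral_congr
    intro x
    rw [WW, ← JJ_conv _ _ _ hq0.le, ENNReal.mul_rpow_of_nonneg _ _ hq0.le, ← ENNReal.rpow_mul]
    congr 2
    rw [hq]; field_simp; ring
  have e2 : ∫⁻ x, (JJ x ^ (-s - N / p) * GG w x + JJ x ^ (-s - N / p - 1) * ‖w x‖ₑ) ^ p ≤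
      2 ^ (p - 1) * 2 := by
    calc _ ≤ ∫⁻ x, 2 ^ (p - 1) * (JJ x ^ (-(N : ℝ)) * G1 s w x ^ p +
          JJ x ^ (-(N : ℝ)) * WW s w x ^ p) := by
          apply lintegral_mono
          intro x
          refine (ENNReal.rpow_add_le_mul_rpow_add_rpow _ _ hp).trans (le_of_eq ?_)
          simp only [WW, G1]
          rw [← JJ_conv _ _ _ hp0.le, ← JJ_conv _ _ _ hp0.le,
            ENNReal.mul_rpow_of_nonneg _ _ hp0.le, ENNReal.mul_rpow_of_nonneg _ _ hp0.le,
            ← ENNReal.rpow_mul, ← ENNReal.rpow_mul]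
          congr 4
          · field_simp
          · field_simp; ring
      _ ≤ _ := by
          rw [lintegral_const_mul' _ _ (ENNReal.rpow_ne_top_of_nonneg (by linarith) (by norm_num)),
            lintegral_add_left (measurable_JG s hw p)]
          gcongr
          calc _ ≤ (1 : ℝ≥0∞) + 1 := add_le_add hG hW
            _ = 2 := by norm_num
  rw [e1] at h
  have h3 : (∫⁻ x, JJ x ^ (-(N : ℝ)) * WW s w x ^ q) ^ (1 / q) ≤
      C * ((2 : ℝ≥0∞) ^ (p - 1) * 2) ^ (1 / p) := h.trans (by gcongr)
  calc _ = ((∫⁻ x, JJ x ^ (-(N : ℝ)) * WW s w x ^ q) ^ (1 / q)) ^ q := by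
        rw [← ENNReal.rpow_mul, one_div_mul_cancel hq0.ne', ENNReal.rpow_one]
    _ ≤ _ := by gcongr

lemma GG_pow_le {N : ℕ} {w : Euc N → ℝ} (hw : ContDiff ℝ 1 w) (k : ℕ) (x : Euc N) :
    GG (fun x => w x ^ (k + 1)) x ≤ ((k + 1 : ℕ) : ℝ≥0∞) * (‖w x‖ₑ ^ (k : ℝ) * GG w x) := by
  have h := (hw.differentiable one_ne_zero x).hasFDerivAt.pow (k + 1)
  have h2 : fderiv ℝ (fun x => w x ^ (k + 1)) x = (((k + 1 : ℕ) : ℝ) * w x ^ k) • fderiv ℝ w x := by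
    rw [HasFDerivAt.fderiv h]
    simp [nsmul_eq_mul]
  rw [GG, h2, enorm_smul, enorm_mul, enorm_pow, ENNReal.rpow_natCast, GG, mul_assoc]
  gcongr
  rw [Real.enorm_of_nonneg (by positivity), ENNReal.ofReal_natCast]

lemma aux_mid {N : ℕ} (hN : 1 < N) (s : ℝ) (k : ℕ) (hk : N - 1 ≤ k) :
    ∃ C : ℝ≥0∞, C ≠ ⊤ ∧ ∀ w : Euc N → ℝ, ContDiff ℝ 1 w →
      ∫⁻ x, JJ x ^ (-(N : ℝ)) * G1 s w x ^ (N : ℝ) ≤ 1 →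
      ∫⁻ x, JJ x ^ (-(N : ℝ)) * WW s w x ^ (N : ℝ) ≤ 1 →
      ∫⁻ x, JJ x ^ (-(N : ℝ)) * WW s w x ^ ((k : ℝ) * N / (N - 1)) ≤ C := by
  have hN1 : (1 : ℝ) < N := by exact_mod_cast hN
  have hN1' : (0 : ℝ) < N - 1 := by linarith
  induction k, hk using Nat.le_induction with
  | base =>
    refine ⟨1, one_ne_top, fun w _ _ hW => ?_⟩
    have : ((N - 1 : ℕ) : ℝ) * N / (N - 1) = N := by
      rw [Nat.cast_sub hN.le, Nat.cast_one]; field_simp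
    rw [this]; exact hW
  | succ k hk ih =>
    obtain ⟨C, hC, ih⟩ := ih
    set q0 : ℝ := (k : ℝ) * N / (N - 1) with hq0
    set q : ℝ := N / (N - 1) with hq
    have hqpos : 0 < q := by rw [hq]; positivity
    obtain ⟨D, hD, H⟩ := aux_gns (N := N) (p := 1) (q := q) le_rfl hN1 (by rw [mul_one])
      (-(s + 1) * (k + 1) - (N - 1))
    have hkN : (N : ℝ) ≤ (k : ℝ) + 1 := by
      have : N ≤ k + 1 := by omega
      exact_mod_cast this
    have hk2 : (k : ℝ) + 1 ≤ q0 := by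
      rw [hq0, le_div_iff₀ hN1']; nlinarith
    refine ⟨(D * (((k + 1 : ℕ) : ℝ≥0∞) * (C + 1) + (1 + C))) ^ q, ?_, ?_⟩
    · apply ENNReal.rpow_ne_top_of_nonneg hqpos.le
      have : ((k + 1 : ℕ) : ℝ≥0∞) ≠ ⊤ := ENNReal.natCast_ne_top _
      finiteness
    intro w hw hG hW
    have h1 := ih w hw hG hW
    have h := H (fun x => w x ^ (k + 1)) (hw.pow _)
    have e1 : ∫⁻ x, (JJ x ^ (-(s + 1) * (k + 1) - (N - 1) : ℝ) * ‖w x ^ (k + 1)‖ₑ) ^ q =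
        ∫⁻ x, JJ x ^ (-(N : ℝ)) * WW s w x ^ (((k + 1 : ℕ) : ℝ) * N / (N - 1)) := by
      apply lintegral_congr
      intro x
      rw [WW, ← JJ_conv _ _ _ (by positivity), ENNReal.mul_rpow_of_nonneg _ _ hqpos.le,
        ← ENNReal.rpow_mul, enorm_pow, ← ENNReal.rpow_natCast, ← ENNReal.rpow_mul]
      congr 2
      · rw [hq]; push_cast; field_simp
      · rw [hq]; push_cast; field_simp
    have e2 : ∫⁻ x, (JJ x ^ (-(s + 1) * (k + 1) - (N - 1) : ℝ) * GG (fun x => w x ^ (k + 1)) x +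
        JJ x ^ (-(s + 1) * (k + 1) - (N - 1) - 1 : ℝ) * ‖w x ^ (k + 1)‖ₑ) ^ (1 : ℝ) ≤
        ((k + 1 : ℕ) : ℝ≥0∞) * (C + 1) + (1 + C) := by
      have hmW : ∀ r : ℝ, Measurable fun x => JJ x ^ (-(N : ℝ)) * WW s w x ^ r := fun r =>
        (measurable_JJ_rpow _).mul ((measurable_WW s hw).pow_const r)
      have hmG : ∀ r : ℝ, Measurable fun x => JJ x ^ (-(N : ℝ)) * G1 s w x ^ r := fun r =>
        (measurable_JJ_rpow _).mul ((measurable_G1 s hw).pow_const r)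
      calc _ ≤ ∫⁻ x, (((k + 1 : ℕ) : ℝ≥0∞) * (JJ x ^ (-(N : ℝ)) * WW s w x ^ q0 +
            JJ x ^ (-(N : ℝ)) * G1 s w x ^ (N : ℝ)) + (JJ x ^ (-(N : ℝ)) * WW s w x ^ (N : ℝ) +
            JJ x ^ (-(N : ℝ)) * WW s w x ^ q0)) := by
            apply lintegral_mono
            intro x
            simp only
            rw [ENNReal.rpow_one]
            refine add_le_add ?_ ?_
            · have hy : WW s w x ^ (k : ℝ) * G1 s w x ≤ WW s w x ^ q0 + G1 s w x ^ (N : ℝ) := by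
                have hconj : q.HolderConjugate N := by
                  rw [Real.holderConjugate_iff]
                  constructor
                  · rw [hq, lt_div_iff₀ hN1']; linarith
                  · rw [hq]; field_simp; ring
                have hy := ENNReal.young_inequality (WW s w x ^ (k : ℝ)) (G1 s w x) hconj
                refine hy.trans (add_le_add ?_ ?_)
                · rw [← ENNReal.rpow_mul]
                  have : (k : ℝ) * q = q0 := by rw [hq, hq0]; ring
                  rw [this]
                  apply ENNReal.div_le_of_le_mul
                  refine le_mul_of_one_le_right' ?_
                  rw [ENNReal.one_le_ofReal]
                  exact hconj.lt.le
                · apply ENNReal.div_le_of_le_mul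
                  refine le_mul_of_one_le_right' ?_
                  rw [ENNReal.one_le_ofReal]
                  exact hN1.le
              calc _ ≤ JJ x ^ (-(s + 1) * (k + 1) - (N - 1) : ℝ) *
                    (((k + 1 : ℕ) : ℝ≥0∞) * (‖w x‖ₑ ^ (k : ℝ) * GG w x)) := by
                    gcongr; exact GG_pow_le hw k x
                _ = ((k + 1 : ℕ) : ℝ≥0∞) * (JJ x ^ (-(N : ℝ)) *
                    (WW s w x ^ (k : ℝ) * G1 s w x)) := by
                    have : (-(s + 1) * (k + 1) - (N - 1) : ℝ) = (-(N : ℝ)) +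
                      ((-(s + 1)) * k + (-s)) := by ring
                    rw [this, JJ_add, JJ_add, WW, G1, ENNReal.mul_rpow_of_nonneg _ _ (by positivity),
                      ← ENNReal.rpow_mul]
                    ring
                _ ≤ _ := by
                    rw [← mul_add]
                    gcongr
            · have e3 : JJ x ^ (-(s + 1) * (k + 1) - (N - 1) - 1 : ℝ) * ‖w x ^ (k + 1)‖ₑ =
                  JJ x ^ (-(N : ℝ)) * WW s w x ^ ((k : ℝ) + 1) := by
                rw [WW, ← JJ_conv _ _ _ (by positivity), enorm_pow, ← ENNReal.rpow_natCast]
                congr 2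
                · ring
                · push_cast; ring
              rw [e3, ← mul_add]
              gcongr
              exact aux_interp _ hkN hk2
        _ = ((k + 1 : ℕ) : ℝ≥0∞) * ((∫⁻ x, JJ x ^ (-(N : ℝ)) * WW s w x ^ q0) +
            ∫⁻ x, JJ x ^ (-(N : ℝ)) * G1 s w x ^ (N : ℝ)) +
            ((∫⁻ x, JJ x ^ (-(N : ℝ)) * WW s w x ^ (N : ℝ)) +
            ∫⁻ x, JJ x ^ (-(N : ℝ)) * WW s w x ^ q0) := by
            have hm3 : Measurable fun x => ((k + 1 : ℕ) : ℝ≥0∞) * (JJ x ^ (-(N : ℝ)) * WW s w x ^ q0 +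
                JJ x ^ (-(N : ℝ)) * G1 s w x ^ (N : ℝ)) := ((hmW _).add (hmG _)).const_mul _
            rw [lintegral_add_left hm3,
              lintegral_const_mul' _ _ (ENNReal.natCast_ne_top _), lintegral_add_left (hmW _),
              lintegral_add_left (hmW _)]
        _ ≤ _ := by gcongr
    rw [e1] at h
    rw [div_one, ENNReal.rpow_one] at h
    have h3 := h.trans (mul_le_mul' le_rfl e2)
    calc _ = ((∫⁻ x, JJ x ^ (-(N : ℝ)) *
          WW s w x ^ (((k + 1 : ℕ) : ℝ) * N / (N - 1))) ^ (1 / q)) ^ q := by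
          rw [← ENNReal.rpow_mul, one_div_mul_cancel hqpos.ne', ENNReal.rpow_one]
      _ ≤ _ := by gcongr

lemma wt_enorm {N : ℕ} (s : ℝ) (q : ℝ≥0∞) (x : Euc N) (y : ℝ) :
    ‖wt N s q x * y‖ₑ = JJ x ^ (-s - N / q.toReal) * ‖y‖ₑ := by
  rw [enorm_mul, wt, Real.enorm_of_nonneg (by positivity), JJ,
    ENNReal.ofReal_rpow_of_pos (by positivity)]

lemma wt_eLpNorm {N : ℕ} (s : ℝ) {q : ℝ} (hq : 0 < q) (w : Euc N → ℝ) :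
    eLpNorm (fun x => wt N s (ENNReal.ofReal q) x * w x) (ENNReal.ofReal q) volume =
      (∫⁻ x, JJ x ^ (-s * q - N) * ‖w x‖ₑ ^ q) ^ (1 / q) := by
  rw [eLpNorm_eq_lintegral_rpow_enorm_toReal (by simpa using hq) ENNReal.ofReal_ne_top,
    ENNReal.toReal_ofReal hq.le]
  congr 1
  apply lintegral_congr
  intro x
  rw [wt_enorm, ENNReal.toReal_ofReal hq.le, ENNReal.mul_rpow_of_nonneg _ _ hq.le,
    ← ENNReal.rpow_mul]
  congr 2
  field_simp

/-- For finite exponents: normalized bound. -/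
lemma aux_q_fin {N : ℕ} (hN : 1 < N) {s p : ℝ} (hp : 1 ≤ p) {q : ℝ} (hpq : p ≤ q)
    (hq : p < N → q ≤ N * p / (N - p)) :
    ∃ C : ℝ≥0∞, C ≠ ⊤ ∧ ∀ w : Euc N → ℝ, ContDiff ℝ 1 w →
      ∫⁻ x, JJ x ^ (-(N : ℝ)) * G1 s w x ^ p ≤ 1 → ∫⁻ x, JJ x ^ (-(N : ℝ)) * WW s w x ^ p ≤ 1 →
      ∫⁻ x, JJ x ^ (-(N : ℝ)) * WW s w x ^ q ≤ C := by
  have hp0 : 0 < p := by linarith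
  have hN1 : (1 : ℝ) < N := by exact_mod_cast hN
  rcases lt_trichotomy p (N : ℝ) with h | h | h
  · obtain ⟨C, hC, H⟩ := aux_crit (s := s) hp h rfl
    refine ⟨1 + C, by finiteness, fun w hw hG hW => ?_⟩
    exact (aux_interp_int s hw hpq (hq h)).trans (add_le_add hW (H w hw hG hW))
  · subst h
    obtain ⟨k, hk1, hk2⟩ : ∃ k : ℕ, N - 1 ≤ k ∧ q ≤ (k : ℝ) * N / (N - 1) := by
      obtain ⟨k, hk⟩ := exists_nat_ge q
      refine ⟨max k N, by omega, ?_⟩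
      rw [le_div_iff₀ (by linarith)]
      have h1 : q ≤ ((max k N : ℕ) : ℝ) := hk.trans (by exact_mod_cast le_max_left _ _)
      have h2 : (0 : ℝ) ≤ ((max k N : ℕ) : ℝ) := by positivity
      nlinarith
    obtain ⟨C, hC, H⟩ := aux_mid hN s k hk1
    refine ⟨1 + C, by finiteness, fun w hw hG hW => ?_⟩
    exact (aux_interp_int s hw hpq hk2).trans (add_le_add hW (H w hw hG hW))
  · obtain ⟨C, hC, H⟩ := aux_morrey (N := N) (s := s) hp h
    refine ⟨C ^ (q - p), ENNReal.rpow_ne_top_of_nonneg (by linarith) hC, fun w hw hG hW => ?_⟩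
    have hpt : ∀ x, WW s w x ≤ C := by
      intro x
      have := H w hw x 1 (by
        rw [ENNReal.one_rpow]
        refine (setLIntegral_le_lintegral _ _).trans (le_trans (le_of_eq ?_) hG)
        apply lintegral_congr; intro z; rw [JJ_conv _ _ _ hp0.le, G1]) (by
        rw [ENNReal.one_rpow]
        refine (setLIntegral_le_lintegral _ _).trans (le_trans (le_of_eq ?_) hW)
        apply lintegral_congr; intro z; rw [JJ_conv _ _ _ hp0.le, WW])
      rw [mul_one] at this
      exact this
    calc _ ≤ ∫⁻ x, C ^ (q - p) * (JJ x ^ (-(N : ℝ)) * WW s w x ^ p) := by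
          apply lintegral_mono
          intro x
          simp only
          have : WW s w x ^ q = WW s w x ^ (q - p) * WW s w x ^ p := by
            rw [← ENNReal.rpow_add_of_nonneg _ _ (by linarith) hp0.le, sub_add_cancel]
          rw [this, mul_left_comm]
          gcongr
          exact hpt x
      _ = C ^ (q - p) * ∫⁻ x, JJ x ^ (-(N : ℝ)) * WW s w x ^ p :=
          lintegral_const_mul' _ _ (ENNReal.rpow_ne_top_of_nonneg (by linarith) hC)
      _ ≤ C ^ (q - p) * 1 := by gcongr
      _ = _ := mul_one _

lemma Ijp_cases {N : ℕ} (hN : 1 < N) {p : ℝ} (hp : 1 ≤ p) {q : ℝ≥0∞} (hq : q ∈ Ijp N 1 p) :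
    (q = ⊤ ∧ (N : ℝ) < p) ∨ ∃ q' : ℝ, q = ENNReal.ofReal q' ∧ p ≤ q' ∧
      (p < N → q' ≤ N * p / (N - p)) := by
  have hp0 : 0 < p := by linarith
  unfold Ijp at hq
  simp only [Nat.cast_one, div_one, one_mul] at hq
  have hfin : q ≠ ⊤ → ENNReal.ofReal p ≤ q → (p < N → q.toReal ≤ N * p / (N - p)) →
      ∃ q' : ℝ, q = ENNReal.ofReal q' ∧ p ≤ q' ∧ (p < N → q' ≤ N * p / (N - p)) := by
    intro h1 h2 h3
    refine ⟨q.toReal, (ENNReal.ofReal_toReal h1).symm, ?_, h3⟩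
    exact (ENNReal.ofReal_le_iff_le_toReal h1).1 h2
  split_ifs at hq with h1 h2
  · right
    exact hfin hq.2.ne hq.1 (fun h => absurd h1.1 h.ne)
  · right
    have ht : q ≠ ⊤ := ne_top_of_le_ne_top ENNReal.ofReal_ne_top hq.2
    refine hfin ht hq.1 (fun h => ?_)
    have : (0 : ℝ) < N - p := by linarith
    exact ENNReal.toReal_le_of_le_ofReal (by positivity) hq.2
  · have h3 : (N : ℝ) < p := lt_of_le_of_ne (not_lt.1 h2) (fun h => h1 ⟨h.symm, hN⟩)
    by_cases ht : q = ⊤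
    · exact Or.inl ⟨ht, h3⟩
    · exact Or.inr (hfin ht hq.1 (fun h => absurd h (not_lt.2 h3.le)))

lemma GG_smul {N : ℕ} {w : Euc N → ℝ} (hw : ContDiff ℝ 1 w) (l : ℝ) (x : Euc N) :
    GG (fun x => l * w x) x = ‖l‖ₑ * GG w x := by
  rw [GG, fderiv_const_mul (hw.differentiable one_ne_zero x), enorm_smul, GG]

/-- The weighted embedding for smooth functions, all admissible exponents. -/
lemma aux_q {N : ℕ} (hN : 1 < N) {s p : ℝ} (hp : 1 ≤ p) {q : ℝ≥0∞} (hq : q ∈ Ijp N 1 p) :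
    ∃ C : ℝ≥0∞, C ≠ ⊤ ∧ ∀ w : Euc N → ℝ, ContDiff ℝ 1 w → ∀ A : ℝ, 0 < A →
      ∫⁻ x, JJ x ^ (-s * p - N) * GG w x ^ p ≤ ENNReal.ofReal A ^ p →
      ∫⁻ x, JJ x ^ (-(s + 1) * p - N) * ‖w x‖ₑ ^ p ≤ ENNReal.ofReal A ^ p →
      eLpNorm (fun x => wt N (s + 1) q x * w x) q volume ≤ C * ENNReal.ofReal A := by
  have hp0 : 0 < p := by linarith
  suffices hnorm : ∃ C : ℝ≥0∞, C ≠ ⊤ ∧ ∀ w : Euc N → ℝ, ContDiff ℝ 1 w →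
      ∫⁻ x, JJ x ^ (-s * p - N) * GG w x ^ p ≤ 1 →
      ∫⁻ x, JJ x ^ (-(s + 1) * p - N) * ‖w x‖ₑ ^ p ≤ 1 →
      eLpNorm (fun x => wt N (s + 1) q x * w x) q volume ≤ C by
    obtain ⟨C, hC, H⟩ := hnorm
    refine ⟨C, hC, fun w hw A hA hG hW => ?_⟩
    have hAe : ‖A⁻¹‖ₑ = (ENNReal.ofReal A)⁻¹ := by
      rw [Real.enorm_of_nonneg (by positivity), ENNReal.ofReal_inv_of_pos hA]
    have hA0 : ENNReal.ofReal A ≠ 0 := by simpa using hA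
    have hAt : ENNReal.ofReal A ≠ ⊤ := ENNReal.ofReal_ne_top
    have hinv : (ENNReal.ofReal A)⁻¹ ^ p * ENNReal.ofReal A ^ p = 1 := by
      rw [← ENNReal.mul_rpow_of_nonneg _ _ hp0.le, ENNReal.inv_mul_cancel hA0 hAt, ENNReal.one_rpow]
    have hit : (ENNReal.ofReal A)⁻¹ ^ p ≠ ⊤ :=
      ENNReal.rpow_ne_top_of_nonneg hp0.le (by simpa using hA)
    have h1 := H (fun x => A⁻¹ * w x) (contDiff_const.mul hw) (by
      rw [← hinv]
      refine le_trans (le_of_eq ?_) (mul_le_mul' le_rfl hG)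
      rw [← lintegral_const_mul' _ _ hit]
      apply lintegral_congr; intro x
      rw [GG_smul hw, hAe, ENNReal.mul_rpow_of_nonneg _ _ hp0.le]
      ring) (by
      rw [← hinv]
      refine le_trans (le_of_eq ?_) (mul_le_mul' le_rfl hW)
      rw [← lintegral_const_mul' _ _ hit]
      apply lintegral_congr; intro x
      rw [enorm_mul, hAe, ENNReal.mul_rpow_of_nonneg _ _ hp0.le]
      ring)
    have h2 : (fun x => wt N (s + 1) q x * w x) =
        A • fun x => wt N (s + 1) q x * (A⁻¹ * w x) := by
      ext x
      simp only [Pi.smul_apply, smul_eq_mul]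
      field_simp
    rw [h2, eLpNorm_const_smul, Real.enorm_of_nonneg hA.le, mul_comm]
    gcongr
  rcases Ijp_cases hN hp hq with ⟨rfl, hNp⟩ | ⟨q', rfl, h1, h2⟩
  · obtain ⟨C, hC, H⟩ := aux_morrey (N := N) (s := s) hp hNp
    refine ⟨C, hC, fun w hw hG hW => ?_⟩
    rw [eLpNorm_exponent_top]
    apply eLpNormEssSup_le_of_ae_enorm_bound
    refine Eventually.of_forall fun x => ?_
    rw [wt_enorm]
    have := H w hw x 1 (by
        rw [ENNReal.one_rpow]
        exact (setLIntegral_le_lintegral _ _).trans hG) (by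
        rw [ENNReal.one_rpow]
        exact (setLIntegral_le_lintegral _ _).trans hW)
    rw [mul_one] at this
    simpa using this
  · obtain ⟨C, hC, H⟩ := aux_q_fin hN (s := s) hp h1 h2
    have hq0 : 0 < q' := by linarith
    refine ⟨C ^ (1 / q'), ENNReal.rpow_ne_top_of_nonneg (by positivity) hC, fun w hw hG hW => ?_⟩
    rw [wt_eLpNorm _ hq0]
    gcongr
    refine le_trans (le_of_eq ?_) (H w hw ?_ ?_)
    · apply lintegral_congr; intro x; rw [JJ_conv _ _ _ hq0.le, WW]
    · refine le_trans (le_of_eq ?_) hG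
      apply lintegral_congr; intro x; rw [JJ_conv _ _ _ hp0.le, G1]
    · refine le_trans (le_of_eq ?_) hW
      apply lintegral_congr; intro x; rw [JJ_conv _ _ _ hp0.le, WW]

lemma aux_polar {N : ℕ} (hN : 1 < N) {F : Euc N → ℝ≥0∞} (hF : Measurable F) :
    ∫⁻ σ : sphere (0 : Euc N) 1, (∫⁻ l in Set.Ioc (1 : ℝ) 2, F (l • (σ : Euc N)))
        ∂((volume : Measure (Euc N)).toSphere) ≤
      ∫⁻ y in {y : Euc N | 1 < ‖y‖ ∧ ‖y‖ ≤ 2}, F y := by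
  haveI : Nonempty (Fin N) := ⟨⟨0, by omega⟩⟩
  set S : Set (Euc N) := {y : Euc N | 1 < ‖y‖ ∧ ‖y‖ ≤ 2} with hS
  have hSm : MeasurableSet S :=
    (measurableSet_lt measurable_const measurable_norm).inter
      (measurableSet_le measurable_norm measurable_const)
  set F' : Euc N → ℝ≥0∞ := S.indicator F with hF'
  have hF'm : Measurable F' := hF.indicator hSm
  rw [← lintegral_indicator hSm]
  have hmp := (volume : Measure (Euc N)).measurePreserving_homeomorphUnitSphereProd
  have h1 : ∫⁻ y, F' y = ∫⁻ y : ({0}ᶜ : Set (Euc N)), F' y ∂((volume : Measure (Euc N)).comap (↑)) := by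
    rw [lintegral_subtype_comap (measurableSet_singleton _).compl, restrict_compl_singleton]
  have h2 : ∫⁻ y : ({0}ᶜ : Set (Euc N)), F' y ∂((volume : Measure (Euc N)).comap (↑)) =
      ∫⁻ q : sphere (0 : Euc N) 1 × Set.Ioi (0 : ℝ), F' (q.2.1 • q.1.1)
        ∂((volume : Measure (Euc N)).toSphere.prod
          (Measure.volumeIoiPow (Module.finrank ℝ (Euc N) - 1))) := by
    rw [← hmp.lintegral_comp (by fun_prop)]
    apply lintegral_congr
    intro y
    have h := (homeomorphUnitSphereProd (Euc N)).symm_apply_apply y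
    have h3 := congrArg Subtype.val h
    rw [homeomorphUnitSphereProd_symm_apply_coe] at h3
    rw [h3]
  rw [show (∫⁻ a, S.indicator F a) = ∫⁻ y, F' y from rfl, h1, h2,
    lintegral_prod _ (by fun_prop)]
  apply lintegral_mono
  intro σ
  have hσ : ‖(σ : Euc N)‖ = 1 := by simpa using σ.2
  dsimp only
  rw [Measure.volumeIoiPow, lintegral_withDensity_eq_lintegral_mul _ (by fun_prop) (by fun_prop)]
  have h4 := lintegral_subtype_comap (μ := (volume : Measure ℝ)) (measurableSet_Ioi (a := (0:ℝ)))
    (fun l : ℝ => ENNReal.ofReal (l ^ (Module.finrank ℝ (Euc N) - 1)) * F' (l • (σ : Euc N)))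
  refine le_trans ?_ h4.symm.le
  have hsub : Set.Ioc (1 : ℝ) 2 ⊆ Set.Ioi 0 := fun l hl => by
    have := hl.1; simp only [Set.mem_Ioi]; linarith
  refine le_trans ?_ (lintegral_mono_set hsub)
  apply setLIntegral_mono' measurableSet_Ioc
  intro l hl
  have hmem : l • (σ : Euc N) ∈ S := by
    have : ‖l • (σ : Euc N)‖ = l := by
      rw [norm_smul, hσ, mul_one, Real.norm_of_nonneg (by linarith [hl.1])]
    simp only [hS, Set.mem_ofPred_eq, this]
    exact hl
  rw [hF', Set.indicator_of_mem hmem]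
  have : (1 : ℝ≥0∞) ≤ ENNReal.ofReal (l ^ (Module.finrank ℝ (Euc N) - 1)) := by
    rw [← ENNReal.ofReal_one]
    exact ENNReal.ofReal_le_ofReal (one_le_pow₀ hl.1.le)
  calc F (l • (σ : Euc N)) = 1 * F (l • (σ : Euc N)) := (one_mul _).symm
    _ ≤ _ := by gcongr

lemma aux_annulus {N : ℕ} {p : ℝ} (hp : 1 ≤ p) :
    ∃ C : ℝ≥0∞, C ≠ ⊤ ∧ ∀ H : Euc N → ℝ≥0∞, Measurable H → ∀ A : ℝ≥0∞,
      ∫⁻ x, JJ x ^ (-(N : ℝ)) * H x ^ p ≤ A ^ p → ∀ r : ℝ, 1 ≤ r →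
      ∫⁻ y in {y : Euc N | 1 < ‖y‖ ∧ ‖y‖ ≤ 2}, H (r • y) ≤ C * A := by
  have hp0 : 0 < p := by linarith
  set S : Set (Euc N) := {y : Euc N | 1 < ‖y‖ ∧ ‖y‖ ≤ 2} with hS
  have hSm : MeasurableSet S :=
    (measurableSet_lt measurable_const measurable_norm).inter
      (measurableSet_le measurable_norm measurable_const)
  have hSv : volume S ≠ ⊤ := by
    refine ((measure_mono ?_).trans_lt (measure_closedBall_lt_top (x := (0 : Euc N)) (r := 2))).ne
    intro y hy
    simpa using hy.2
  refine ⟨(volume S ^ (p - 1) * ENNReal.ofReal 3 ^ (N : ℝ)) ^ (1 / p), ?_, fun H hH A hA r hr => ?_⟩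
  · refine ENNReal.rpow_ne_top_of_nonneg (by positivity) (ENNReal.mul_ne_top ?_ ?_)
    · exact ENNReal.rpow_ne_top_of_nonneg (by linarith) hSv
    · exact ENNReal.rpow_ne_top_of_nonneg (by positivity) ENNReal.ofReal_ne_top
  have hr0 : 0 < r := by linarith
  have hJ := aux_jensen (volume.restrict S) (f := fun y => H (r • y))
    (by fun_prop) hp
  rw [Measure.restrict_apply_univ] at hJ
  have h2 : ∫⁻ y in S, H (r • y) ^ p ≤ ENNReal.ofReal 3 ^ (N : ℝ) * A ^ p := by
    calc ∫⁻ y in S, H (r • y) ^ p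
        ≤ ∫⁻ y in S, ENNReal.ofReal 3 ^ (N : ℝ) * ENNReal.ofReal r ^ (N : ℝ) *
            (JJ (r • y) ^ (-(N : ℝ)) * H (r • y) ^ p) := by
          apply setLIntegral_mono' hSm
          intro y hy
          have hny : ‖r • y‖ = r * ‖y‖ := by rw [norm_smul, Real.norm_of_nonneg hr0.le]
          have h3 := aux_rpow_compare (A := 1 + ‖r • y‖) (B := r) (C0 := 3) (by positivity) hr0
            (by norm_num) (by rw [hny]; nlinarith [hy.2]) (by rw [hny]; nlinarith [hy.1]) (N : ℝ)
          rw [abs_of_nonneg (by positivity)] at h3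
          calc H (r • y) ^ p = JJ (r • y) ^ (N : ℝ) * (JJ (r • y) ^ (-(N : ℝ)) * H (r • y) ^ p) := by
                rw [← mul_assoc, mul_comm (JJ (r • y) ^ (N : ℝ)), JJ_cancel, one_mul]
            _ ≤ _ := by
                gcongr
                exact h3
      _ = ENNReal.ofReal 3 ^ (N : ℝ) * ENNReal.ofReal r ^ (N : ℝ) *
            ∫⁻ y in S, (JJ (r • y) ^ (-(N : ℝ)) * H (r • y) ^ p) := by
          rw [lintegral_const_mul']
          exact ENNReal.mul_ne_top
            (ENNReal.rpow_ne_top_of_nonneg (by positivity) ENNReal.ofReal_ne_top)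
            (ENNReal.rpow_ne_top_of_nonneg (by positivity) ENNReal.ofReal_ne_top)
      _ ≤ ENNReal.ofReal 3 ^ (N : ℝ) * ENNReal.ofReal r ^ (N : ℝ) *
            (ENNReal.ofReal r ^ (-(N : ℝ)) * A ^ p) := by
          gcongr
          refine (setLIntegral_le_lintegral _ _).trans ?_
          have := aux_lintegral_affine (fun x : Euc N => JJ x ^ (-(N : ℝ)) * H x ^ p) 0 hr0
          simp only [zero_add] at this
          rw [this]
          gcongr
      _ = _ := by
          have : ENNReal.ofReal r ^ (N : ℝ) * ENNReal.ofReal r ^ (-(N : ℝ)) = 1 := by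
            rw [← ENNReal.rpow_add _ _ (by simpa using hr0) ENNReal.ofReal_ne_top]; simp
          rw [mul_assoc, ← mul_assoc (ENNReal.ofReal r ^ (N : ℝ)), this, one_mul]
  have h3 := hJ.trans (mul_le_mul_right h2 _)
  have h4 := ENNReal.rpow_le_rpow h3 (z := 1 / p) (by positivity)
  rw [← ENNReal.rpow_mul, mul_one_div_cancel hp0.ne', ENNReal.rpow_one, ← mul_assoc,
    ENNReal.mul_rpow_of_nonneg _ _ (by positivity), ← ENNReal.rpow_mul,
    mul_one_div_cancel hp0.ne', ENNReal.rpow_one] at h4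
  exact h4

lemma aux_sphere {N : ℕ} (hN : 1 < N) {s p : ℝ} (hp : 1 ≤ p) :
    ∃ C : ℝ≥0∞, C ≠ ⊤ ∧ ∀ w : Euc N → ℝ, ContDiff ℝ 1 w → ∀ A : ℝ≥0∞,
      ∫⁻ x, JJ x ^ (-s * p - N) * GG w x ^ p ≤ A ^ p →
      ∫⁻ x, JJ x ^ (-(s + 1) * p - N) * ‖w x‖ₑ ^ p ≤ A ^ p → ∀ r : ℝ, 1 ≤ r →
      ∫⁻ σ : sphere (0 : Euc N) 1, ‖w (r • (σ : Euc N))‖ₑ ∂((volume : Measure (Euc N)).toSphere) ≤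
        C * (ENNReal.ofReal r ^ (s + 1) * A) := by
  have hp0 : 0 < p := by linarith
  obtain ⟨C, hC, H⟩ := aux_annulus (N := N) hp
  set S : Set (Euc N) := {y : Euc N | 1 < ‖y‖ ∧ ‖y‖ ≤ 2} with hS
  have hSm : MeasurableSet S :=
    (measurableSet_lt measurable_const measurable_norm).inter
      (measurableSet_le measurable_norm measurable_const)
  have h3t : ∀ a : ℝ, ENNReal.ofReal 3 ^ |a| ≠ ⊤ := fun a =>
    ENNReal.rpow_ne_top_of_nonneg (abs_nonneg _) ENNReal.ofReal_ne_top
  refine ⟨(ENNReal.ofReal 3 ^ |s + 1| + ENNReal.ofReal 3 ^ |s|) * C,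
    ENNReal.mul_ne_top (ENNReal.add_ne_top.2 ⟨h3t _, h3t _⟩) hC, fun w hw A hG hW r hr => ?_⟩
  have hr0 : 0 < r := by linarith
  have hGm : Measurable (GG w) := (continuous_GG hw).measurable
  have hwm : Measurable fun x => ‖w x‖ₑ := hw.continuous.enorm.measurable
  have hA1 := H (WW s w) (measurable_WW s hw) A (le_trans (le_of_eq (by
    apply lintegral_congr; intro z; rw [JJ_conv _ _ _ hp0.le, WW])) hW) r hr
  have hA2 := H (G1 s w) ((measurable_JJ_rpow _).mul hGm) A (le_trans (le_of_eq (by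
    apply lintegral_congr; intro z; rw [JJ_conv _ _ _ hp0.le, G1])) hG) r hr
  set F : Euc N → ℝ≥0∞ := fun y => ‖w (r • y)‖ₑ + ENNReal.ofReal r * GG w (r • y) with hF
  have hFm : Measurable F :=
    (hwm.comp (measurable_const_smul r)).add ((hGm.comp (measurable_const_smul r)).const_mul _)
  have hpt : ∀ σ : sphere (0 : Euc N) 1, ‖w (r • (σ : Euc N))‖ₑ ≤
      ∫⁻ l in Set.Ioc (1 : ℝ) 2, F (l • (σ : Euc N)) := by
    intro σ
    have hσ : ‖(σ : Euc N)‖ = 1 := by simpa using σ.2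
    have hnv : ‖r • (σ : Euc N)‖ₑ = ENNReal.ofReal r := by
      rw [← ofReal_norm, norm_smul, hσ, mul_one, Real.norm_of_nonneg hr0.le]
    set I := ∫⁻ t in Set.Ioc (1 : ℝ) 2, GG w (r • t • (σ : Euc N)) with hI
    have hl : ∀ l ∈ Set.Ioc (1 : ℝ) 2, ‖w (r • (σ : Euc N))‖ₑ ≤
        ‖w (r • l • (σ : Euc N))‖ₑ + ENNReal.ofReal r * I := by
      intro l hl
      have h := aux_seg hw 0 (r • (σ : Euc N)) hl.1.le
      simp only [zero_add, one_smul, hnv] at h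
      have h5 : ∫⁻ t in Set.Ioc 1 l, GG w (t • r • (σ : Euc N)) ≤ I := by
        rw [hI]
        simp only [smul_comm r _ (σ : Euc N)]
        exact lintegral_mono_set (Set.Ioc_subset_Ioc_right hl.2)
      calc ‖w (r • (σ : Euc N))‖ₑ
          = ‖w (l • r • (σ : Euc N)) - (w (l • r • (σ : Euc N)) - w (r • (σ : Euc N)))‖ₑ := by
            congr 1; ring
        _ ≤ ‖w (l • r • (σ : Euc N))‖ₑ + ‖w (l • r • (σ : Euc N)) - w (r • (σ : Euc N))‖ₑ :=
            enorm_sub_le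
        _ ≤ _ := by
            rw [smul_comm l r]
            rw [smul_comm l r] at h
            gcongr
            exact h.trans (by gcongr)
    have hvol : volume (Set.Ioc (1 : ℝ) 2) = 1 := by simp; norm_num
    calc ‖w (r • (σ : Euc N))‖ₑ = ∫⁻ l in Set.Ioc (1 : ℝ) 2, ‖w (r • (σ : Euc N))‖ₑ := by
          rw [setLIntegral_const, hvol, mul_one]
      _ ≤ ∫⁻ l in Set.Ioc (1 : ℝ) 2, (‖w (r • l • (σ : Euc N))‖ₑ + ENNReal.ofReal r * I) :=
          setLIntegral_mono' measurableSet_Ioc hl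
      _ = (∫⁻ l in Set.Ioc (1 : ℝ) 2, ‖w (r • l • (σ : Euc N))‖ₑ) + ENNReal.ofReal r * I := by
          rw [lintegral_add_right _ measurable_const, setLIntegral_const, hvol, mul_one]
      _ = _ := by
          rw [hI, ← lintegral_const_mul' _ _ ENNReal.ofReal_ne_top, ← lintegral_add_right _ (by fun_prop)]
  have hJJ : ∀ y ∈ S, ∀ a : ℝ, JJ (r • y) ^ a ≤ ENNReal.ofReal 3 ^ |a| * ENNReal.ofReal r ^ a := by
    intro y hy a
    have hny : ‖r • y‖ = r * ‖y‖ := by rw [norm_smul, Real.norm_of_nonneg hr0.le]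
    exact aux_rpow_compare (A := 1 + ‖r • y‖) (B := r) (C0 := 3) (by positivity) hr0
            (by norm_num) (by rw [hny]; nlinarith [hy.2]) (by rw [hny]; nlinarith [hy.1]) a
  have hFle : ∀ y ∈ S, F y ≤ ENNReal.ofReal 3 ^ |s + 1| * ENNReal.ofReal r ^ (s + 1) * WW s w (r • y) +
      ENNReal.ofReal 3 ^ |s| * ENNReal.ofReal r ^ (s + 1) * G1 s w (r • y) := by
    intro y hy
    apply add_le_add
    · calc ‖w (r • y)‖ₑ = JJ (r • y) ^ (s + 1) * WW s w (r • y) := by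
            rw [WW, ← mul_assoc, mul_comm (JJ (r • y) ^ (s + 1)), JJ_cancel, one_mul]
        _ ≤ _ := by gcongr; exact hJJ y hy _
    · calc ENNReal.ofReal r * GG w (r • y) = ENNReal.ofReal r * (JJ (r • y) ^ s * G1 s w (r • y)) := by
            rw [G1, ← mul_assoc (JJ (r • y) ^ s), mul_comm (JJ (r • y) ^ s), JJ_cancel, one_mul]
        _ ≤ ENNReal.ofReal r * (ENNReal.ofReal 3 ^ |s| * ENNReal.ofReal r ^ s * G1 s w (r • y)) := by
            gcongr; exact hJJ y hy _
        _ = _ := by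
            rw [ENNReal.rpow_add _ _ (by simpa using hr0) ENNReal.ofReal_ne_top, ENNReal.rpow_one]
            ring
  have hrt : ENNReal.ofReal r ^ (s + 1) ≠ ⊤ :=
    ENNReal.rpow_ne_top_of_ne_zero (by simpa using hr0) ENNReal.ofReal_ne_top
  calc _ ≤ ∫⁻ σ : sphere (0 : Euc N) 1, (∫⁻ l in Set.Ioc (1 : ℝ) 2, F (l • (σ : Euc N)))
        ∂((volume : Measure (Euc N)).toSphere) := lintegral_mono hpt
    _ ≤ ∫⁻ y in S, F y := aux_polar hN hFm
    _ ≤ ∫⁻ y in S, (ENNReal.ofReal 3 ^ |s + 1| * ENNReal.ofReal r ^ (s + 1) * WW s w (r • y) +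
      ENNReal.ofReal 3 ^ |s| * ENNReal.ofReal r ^ (s + 1) * G1 s w (r • y)) :=
        setLIntegral_mono' hSm hFle
    _ = ENNReal.ofReal 3 ^ |s + 1| * ENNReal.ofReal r ^ (s + 1) * (∫⁻ y in S, WW s w (r • y)) +
      ENNReal.ofReal 3 ^ |s| * ENNReal.ofReal r ^ (s + 1) * ∫⁻ y in S, G1 s w (r • y) := by
        have hm : Measurable fun y => WW s w (r • y) :=
          (measurable_WW s hw).comp (by fun_prop)
        rw [lintegral_add_left (hm.const_mul _),
          lintegral_const_mul' _ _ (ENNReal.mul_ne_top (h3t _) hrt),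
          lintegral_const_mul' _ _ (ENNReal.mul_ne_top (h3t _) hrt)]
    _ ≤ ENNReal.ofReal 3 ^ |s + 1| * ENNReal.ofReal r ^ (s + 1) * (C * A) +
      ENNReal.ofReal 3 ^ |s| * ENNReal.ofReal r ^ (s + 1) * (C * A) := by gcongr
    _ = _ := by ring

lemma enorm_clm_le {N : ℕ} (L : Euc N →L[ℝ] ℝ) :
    ‖L‖ₑ ≤ ∑ i, ‖L (EuclideanSpace.single i 1)‖ₑ := by
  have h : ‖L‖ ≤ ∑ i, ‖L (EuclideanSpace.single i 1)‖ := by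
    apply L.opNorm_le_bound (by positivity)
    intro v
    have hv : v = ∑ i, v i • EuclideanSpace.single i (1 : ℝ) := by
      ext j
      simp [Pi.single_apply]
    calc ‖L v‖ = ‖∑ i, v i • L (EuclideanSpace.single i 1)‖ := by
          conv_lhs => rw [hv]
          rw [map_sum]; simp
      _ ≤ ∑ i, ‖v i • L (EuclideanSpace.single i 1)‖ := norm_sum_le _ _
      _ ≤ ∑ i, ‖L (EuclideanSpace.single i 1)‖ * ‖v‖ := by
          apply Finset.sum_le_sum
          intro i _
          rw [norm_smul, mul_comm]
          gcongr
          exact PiLp.norm_apply_le v i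
      _ = _ := by rw [Finset.sum_mul]
  rw [← ofReal_norm]
  refine (ENNReal.ofReal_le_ofReal h).trans ?_
  rw [ENNReal.ofReal_sum_of_nonneg (fun _ _ => norm_nonneg _)]
  simp only [ofReal_norm]
  exact le_rfl

lemma fderiv_moll {N : ℕ} {u gi φ : Euc N → ℝ} {i : Fin N} (h : IsWeakPartialDeriv i u gi)
    (hφ : ContDiff ℝ (⊤ : ℕ∞) φ) (hc : HasCompactSupport φ) (x : Euc N) :
    fderiv ℝ (convolution φ u (ContinuousLinearMap.lsmul ℝ ℝ) volume) x (EuclideanSpace.single i 1) =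
      ∫ y, gi y * φ (x - y) := by
  obtain ⟨hu, hg, hw⟩ := h
  rw [← convolution_flip]
  have h1 := hc.hasFDerivAt_convolution_right (ContinuousLinearMap.lsmul ℝ ℝ (E := ℝ)).flip hu
    (hφ.of_le (by exact_mod_cast le_top)) x
  rw [h1.fderiv, convolution_precompR_apply _ hu (hc.fderiv (𝕜 := ℝ))
    (hφ.continuous_fderiv (by simp)), convolution]
  have hψ : ContDiff ℝ (⊤ : ℕ∞) fun y => φ (x - y) := hφ.comp (by fun_prop)
  have hψc : HasCompactSupport fun y => φ (x - y) :=
    hc.comp_homeomorph (Homeomorph.subLeft x)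
  have h2 := hw (fun y => φ (x - y)) hψ hψc
  have h3 : ∀ y, pderivList [i] (fun y => φ (x - y)) y =
      - fderiv ℝ φ (x - y) (EuclideanSpace.single i 1) := by
    intro y
    simp only [pderivList]
    have hd : HasFDerivAt (fun y => φ (x - y)) ((fderiv ℝ φ (x - y)).comp
        (-ContinuousLinearMap.id ℝ (Euc N))) y :=
      ((hφ.differentiable (by simp)) (x - y)).hasFDerivAt.comp y
        ((hasFDerivAt_id y).const_sub x)
    rw [hd.fderiv]
    simp
  simp only [h3, List.length_singleton, pow_one, mul_neg, integral_neg, neg_mul, one_mul, neg_inj] at h2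
  rw [← h2]
  apply integral_congr_ae
  filter_upwards with y
  simp [mul_comm]

lemma GG_moll {N : ℕ} {u φ : Euc N → ℝ} {g : Fin N → Euc N → ℝ} (h : ∀ i, IsWeakPartialDeriv i u (g i))
    (hφ : ContDiff ℝ (⊤ : ℕ∞) φ) (hc : HasCompactSupport φ) (h0 : ∀ x, 0 ≤ φ x) (x : Euc N) :
    GG (convolution φ u (ContinuousLinearMap.lsmul ℝ ℝ) volume) x ≤
      N * ∫⁻ y, ENNReal.ofReal (φ (x - y)) * ‖gradNorm1 g y‖ₑ := by
  refine (enorm_clm_le _).trans ?_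
  have : ∀ i ∈ (Finset.univ : Finset (Fin N)),
      ‖fderiv ℝ (convolution φ u (ContinuousLinearMap.lsmul ℝ ℝ) volume) x (EuclideanSpace.single i 1)‖ₑ
      ≤ ∫⁻ y, ENNReal.ofReal (φ (x - y)) * ‖gradNorm1 g y‖ₑ := by
    intro i _
    rw [fderiv_moll (h i) hφ hc x]
    refine (enorm_integral_le_lintegral_enorm _).trans ?_
    apply lintegral_mono
    intro y
    dsimp only
    rw [enorm_mul, mul_comm, Real.enorm_of_nonneg (h0 _)]
    gcongr
    rw [← ofReal_norm, ← ofReal_norm]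
    apply ENNReal.ofReal_le_ofReal
    rw [Real.norm_eq_abs, gradNorm1, Real.norm_of_nonneg (Real.sqrt_nonneg _)]
    apply Real.abs_le_sqrt
    exact Finset.single_le_sum (f := fun i => g i y ^ 2) (fun _ _ => sq_nonneg _) (Finset.mem_univ i)
  refine (Finset.sum_le_card_nsmul _ _ _ this).trans ?_
  simp

lemma moll_bound {N : ℕ} {p : ℝ} (hp : 1 ≤ p) (a : ℝ) {φ : Euc N → ℝ} (hφ : Continuous φ)
    (hs : ∀ x, 1 ≤ ‖x‖ → φ x = 0) (h0 : ∀ x, 0 ≤ φ x) (hi : Integrable φ) (h1 : ∫ x, φ x = 1)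
    {F : Euc N → ℝ≥0∞} (hF : AEMeasurable F) (R : ℝ) :
    ∫⁻ x in {x : Euc N | R ≤ ‖x‖}, JJ x ^ a * (∫⁻ y, ENNReal.ofReal (φ (x - y)) * F y) ^ p ≤
      ENNReal.ofReal 2 ^ |a| * ∫⁻ y in {y : Euc N | R - 1 ≤ ‖y‖}, JJ y ^ a * F y ^ p := by
  wlog hFm : Measurable F generalizing F
  · have h := this hF.measurable_mk.aemeasurable hF.measurable_mk
    have e1 : ∀ x, ∫⁻ y, ENNReal.ofReal (φ (x - y)) * F y =
        ∫⁻ y, ENNReal.ofReal (φ (x - y)) * hF.mk F y := by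
      intro x
      apply lintegral_congr_ae
      filter_upwards [hF.ae_eq_mk] with y hy
      rw [hy]
    simp only [e1]
    refine h.trans (le_of_eq ?_)
    congr 1
    apply lintegral_congr_ae
    filter_upwards [ae_restrict_of_ae hF.ae_eq_mk] with y hy
    rw [hy]
  have hφm : Measurable fun z => ENNReal.ofReal (φ z) := by fun_prop
  have hone : ∫⁻ z, ENNReal.ofReal (φ z) = 1 := by
    rw [← ofReal_integral_eq_lintegral_ofReal hi (ae_of_all _ h0), h1, ENNReal.ofReal_one]
  have hJ : ∀ x, (∫⁻ y, ENNReal.ofReal (φ (x - y)) * F y) ^ p ≤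
      ∫⁻ y, ENNReal.ofReal (φ (x - y)) * F y ^ p := by
    intro x
    have hm : Measurable fun y => ENNReal.ofReal (φ (x - y)) := by fun_prop
    have h := aux_jensen (volume.withDensity fun y => ENNReal.ofReal (φ (x - y))) hFm.aemeasurable hp
    rw [lintegral_withDensity_eq_lintegral_mul _ hm hFm,
      lintegral_withDensity_eq_lintegral_mul _ hm (hFm.pow_const p),
      withDensity_apply _ MeasurableSet.univ, Measure.restrict_univ,
      lintegral_sub_left_eq_self (fun z => ENNReal.ofReal (φ z)) x, hone, ENNReal.one_rpow, one_mul] at h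
    exact h
  have hRm : ∀ R : ℝ, MeasurableSet {x : Euc N | R ≤ ‖x‖} := fun R =>
    measurableSet_le measurable_const measurable_norm
  set T : Euc N → ℝ≥0∞ := {y : Euc N | R - 1 ≤ ‖y‖}.indicator fun y => JJ y ^ a * F y ^ p with hT
  have hTm : Measurable T := ((measurable_JJ_rpow a).mul (hFm.pow_const p)).indicator (hRm _)
  have h2t : ENNReal.ofReal 2 ^ |a| ≠ ⊤ :=
    ENNReal.rpow_ne_top_of_nonneg (abs_nonneg _) ENNReal.ofReal_ne_top
  calc _ ≤ ∫⁻ x in {x : Euc N | R ≤ ‖x‖}, ENNReal.ofReal 2 ^ |a| *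
        ∫⁻ y, ENNReal.ofReal (φ (x - y)) * T y := by
        apply setLIntegral_mono' (hRm R)
        intro x hx
        refine (mul_le_mul_right (hJ x) _).trans ?_
        rw [← lintegral_const_mul' _ _ (JJ_rpow_ne_top x a), ← lintegral_const_mul' _ _ h2t]
        apply lintegral_mono
        intro y
        dsimp only
        by_cases hxy : 1 ≤ ‖x - y‖
        · simp [hs _ hxy]
        push Not at hxy
        have hx' : R ≤ ‖x‖ := hx
        have e1 : ‖x‖ ≤ ‖y‖ + 1 := by
          have := norm_sub_norm_le x y; linarith
        have e2 : ‖y‖ ≤ ‖x‖ + 1 := by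
          have := norm_sub_norm_le y x; rw [norm_sub_rev] at this; linarith
        have hy : y ∈ {y : Euc N | R - 1 ≤ ‖y‖} := by
          simp only [Set.mem_ofPred_eq]; linarith
        rw [hT, Set.indicator_of_mem hy]
        have h3 := aux_rpow_compare (A := 1 + ‖x‖) (B := 1 + ‖y‖) (C0 := 2) (by positivity)
          (by positivity) (by norm_num) (by linarith [norm_nonneg y]) (by linarith [norm_nonneg x]) a
        change JJ x ^ a ≤ _ * JJ y ^ a at h3
        calc _ ≤ (ENNReal.ofReal 2 ^ |a| * JJ y ^ a) * (ENNReal.ofReal (φ (x - y)) * F y ^ p) := by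
              gcongr
          _ = _ := by ring
    _ ≤ ∫⁻ x, ENNReal.ofReal 2 ^ |a| * ∫⁻ y, ENNReal.ofReal (φ (x - y)) * T y :=
        setLIntegral_le_lintegral _ _
    _ = ENNReal.ofReal 2 ^ |a| * ∫⁻ x, ∫⁻ y, ENNReal.ofReal (φ (x - y)) * T y :=
        lintegral_const_mul' _ _ h2t
    _ = ENNReal.ofReal 2 ^ |a| * ∫⁻ y, ∫⁻ x, ENNReal.ofReal (φ (x - y)) * T y := by
        rw [lintegral_lintegral_swap]
        have : Measurable fun q : Euc N × Euc N => ENNReal.ofReal (φ (q.1 - q.2)) * T q.2 := by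
          fun_prop
        exact this.aemeasurable
    _ = ENNReal.ofReal 2 ^ |a| * ∫⁻ y, T y := by
        congr 1
        apply lintegral_congr
        intro y
        rw [lintegral_mul_const _ (by fun_prop),
          lintegral_sub_right_eq_self (fun z => ENNReal.ofReal (φ z)) y, hone, one_mul]
    _ = _ := by rw [hT, lintegral_indicator (hRm _)]

lemma aemeasurable_gradNorm1 {N : ℕ} {g : Fin N → Euc N → ℝ}
    (hg : ∀ i, LocallyIntegrable (g i) volume) : AEMeasurable (gradNorm1 g) := by
  unfold gradNorm1
  have : ∀ i, AEMeasurable (g i) := fun i => (hg i).aestronglyMeasurable.aemeasurable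
  fun_prop

lemma exists_moll {N : ℕ} (hN : 1 < N) {u : Euc N → ℝ} {g : Fin N → Euc N → ℝ}
    (h : ∀ i, IsWeakPartialDeriv i u (g i)) {p : ℝ} (hp : 1 ≤ p) (a : ℝ) :
    ∃ U : ℕ → Euc N → ℝ, (∀ n, ContDiff ℝ 1 (U n)) ∧
      (∀ᵐ x, Tendsto (fun n => U n x) atTop (nhds (u x))) ∧
      ∀ n (R : ℝ), ∫⁻ x in {x : Euc N | R ≤ ‖x‖}, JJ x ^ a * GG (U n) x ^ p ≤
        ((N : ℝ≥0∞) ^ p * ENNReal.ofReal 2 ^ |a|) *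
          ∫⁻ y in {y : Euc N | R - 1 ≤ ‖y‖}, JJ y ^ a * ‖gradNorm1 g y‖ₑ ^ p := by
  have hp0 : 0 < p := by linarith
  have hu : LocallyIntegrable u volume := (h ⟨0, by omega⟩).1
  let φ : ℕ → ContDiffBump (0 : Euc N) := fun n =>
    { rIn := 1 / ((n : ℝ) + 2) / 2
      rOut := 1 / ((n : ℝ) + 2)
      rIn_pos := by positivity
      rIn_lt_rOut := by
        have : 0 < 1 / ((n : ℝ) + 2) := by positivity
        linarith }
  have hsm : ∀ n, ContDiff ℝ (⊤ : ℕ∞) ((φ n).normed volume) := fun n => (φ n).contDiff_normed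
  have hcs : ∀ n, HasCompactSupport ((φ n).normed volume) := fun n => (φ n).hasCompactSupport_normed
  refine ⟨fun n => convolution ((φ n).normed volume) u (ContinuousLinearMap.lsmul ℝ ℝ) volume,
    fun n => ?_, ?_, fun n R => ?_⟩
  · exact_mod_cast (hcs n).contDiff_convolution_left (n := 1) (ContinuousLinearMap.lsmul ℝ ℝ)
      ((hsm n).of_le (by exact_mod_cast le_top)) hu
  · apply ContDiffBump.ae_convolution_tendsto_right_of_locallyIntegrable (K := 2)
    · change Tendsto (fun n : ℕ => 1 / ((n : ℝ) + 2)) atTop (nhds 0)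
      have := tendsto_one_div_add_atTop_nhds_zero_nat (𝕜 := ℝ)
      have h2 := this.comp (tendsto_add_atTop_nat 1)
      refine h2.congr fun n => ?_
      simp only [Function.comp]; push_cast; ring
    · filter_upwards with n
      change 1 / ((n : ℝ) + 2) ≤ 2 * (1 / ((n : ℝ) + 2) / 2)
      linarith
    · exact hu
  · have hle : (φ n).rOut ≤ 1 := by
      change 1 / ((n : ℝ) + 2) ≤ 1
      rw [div_le_one (by positivity)]
      have : (0 : ℝ) ≤ n := by positivity
      linarith
    have hb := moll_bound hp a (φ := (φ n).normed volume) (hsm n).continuous (fun x hx => by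
      by_contra hne
      have hx2 : x ∈ Function.support ((φ n).normed volume) := hne
      rw [ContDiffBump.support_normed_eq, mem_ball_zero_iff] at hx2
      linarith) (fun x => (φ n).nonneg_normed x) (φ n).integrable_normed (φ n).integral_normed
      (F := fun y => ‖gradNorm1 g y‖ₑ)
      (aemeasurable_gradNorm1 fun i => (h i).2.1).enorm R
    have hNt : (N : ℝ≥0∞) ^ p ≠ ⊤ := ENNReal.rpow_ne_top_of_nonneg hp0.le (ENNReal.natCast_ne_top _)
    calc _ ≤ ∫⁻ x in {x : Euc N | R ≤ ‖x‖}, (N : ℝ≥0∞) ^ p * (JJ x ^ a *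
          (∫⁻ y, ENNReal.ofReal ((φ n).normed volume (x - y)) * ‖gradNorm1 g y‖ₑ) ^ p) := by
          apply lintegral_mono
          intro x
          have h3 := GG_moll h (hsm n) (hcs n) (fun x => (φ n).nonneg_normed x) x
          have h4 := ENNReal.rpow_le_rpow h3 hp0.le
          rw [ENNReal.mul_rpow_of_nonneg _ _ hp0.le] at h4
          refine (mul_le_mul_right h4 _).trans (le_of_eq (by ring))
      _ = (N : ℝ≥0∞) ^ p * ∫⁻ x in {x : Euc N | R ≤ ‖x‖}, (JJ x ^ a *
          (∫⁻ y, ENNReal.ofReal ((φ n).normed volume (x - y)) * ‖gradNorm1 g y‖ₑ) ^ p) :=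
          lintegral_const_mul' _ _ hNt
      _ ≤ _ := by
          rw [mul_assoc]
          gcongr

lemma memLs_gradNorm1 {N : ℕ} {s : ℝ} {q : ℝ≥0∞} {g : Fin N → Euc N → ℝ}
    (hg : ∀ i, LocallyIntegrable (g i) volume) (h : ∀ i, MemLs N s q (g i)) :
    MemLs N s q (gradNorm1 g) := by
  have hsum : MemLp (fun x => ∑ i, ‖wt N s q x * g i x‖) q volume :=
    memLp_finsetSum _ (fun i _ => (h i).norm)
  have hwm : Measurable (wt N s q) := by unfold wt; fun_prop
  refine hsum.mono' (hwm.aemeasurable.mul (aemeasurable_gradNorm1 hg)).aestronglyMeasurable ?_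
  filter_upwards with x
  simp only [norm_mul, ← Finset.mul_sum]
  gcongr
  rw [gradNorm1, Real.norm_of_nonneg (Real.sqrt_nonneg _)]
  apply Real.sqrt_le_iff.2 ⟨by positivity, ?_⟩
  calc ∑ i, g i x ^ 2 = ∑ i, ‖g i x‖ ^ 2 := by simp
    _ ≤ _ := Finset.sum_sq_le_sq_sum_of_nonneg (fun i _ => norm_nonneg _)

/-- Tail of the weighted gradient integral. -/
def tailG {N : ℕ} (a p : ℝ) (g : Fin N → Euc N → ℝ) (ρ : ℝ) : ℝ≥0∞ :=
  ∫⁻ y in {y : Euc N | ρ ≤ ‖y‖}, JJ y ^ a * ‖gradNorm1 g y‖ₑ ^ p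

lemma tailG_anti {N : ℕ} (a p : ℝ) (g : Fin N → Euc N → ℝ) {ρ ρ' : ℝ} (h : ρ ≤ ρ') :
    tailG a p g ρ' ≤ tailG a p g ρ :=
  lintegral_mono_set (fun _ hy => le_trans h hy)

lemma tailG_le {N : ℕ} (a p : ℝ) (g : Fin N → Euc N → ℝ) (ρ : ℝ) :
    tailG a p g ρ ≤ ∫⁻ y, JJ y ^ a * ‖gradNorm1 g y‖ₑ ^ p :=
  setLIntegral_le_lintegral _ _

lemma tailG_tendsto {N : ℕ} (a p : ℝ) {g : Fin N → Euc N → ℝ}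
    (hg : ∀ i, LocallyIntegrable (g i) volume)
    (hM : ∫⁻ y, JJ y ^ a * ‖gradNorm1 g y‖ₑ ^ p ≠ ⊤) :
    Tendsto (tailG a p g) atTop (nhds 0) := by
  have hm : AEMeasurable fun y : Euc N => JJ y ^ a * ‖gradNorm1 g y‖ₑ ^ p :=
    (measurable_JJ_rpow a).aemeasurable.mul ((aemeasurable_gradNorm1 hg).enorm.pow_const p)
  have hRm : ∀ R : ℝ, MeasurableSet {x : Euc N | R ≤ ‖x‖} := fun R =>
    measurableSet_le measurable_const measurable_norm
  have h := tendsto_lintegral_filter_of_dominated_convergence' (μ := (volume : Measure (Euc N)))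
    (l := (atTop : Filter ℝ))
    (F := fun ρ => {y : Euc N | ρ ≤ ‖y‖}.indicator fun y => JJ y ^ a * ‖gradNorm1 g y‖ₑ ^ p)
    (f := fun _ => 0) _ (Eventually.of_forall fun ρ => hm.indicator (hRm ρ))
    (Eventually.of_forall fun ρ => ae_of_all _ fun y => Set.indicator_le_self _ _ y) hM
    (ae_of_all _ fun y => by
      refine tendsto_const_nhds.congr' ?_
      filter_upwards [eventually_gt_atTop ‖y‖] with ρ hρ
      rw [Set.indicator_of_notMem]
      simpa using hρ)
  simp only [lintegral_zero] at h
  refine h.congr fun ρ => ?_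
  rw [lintegral_indicator (hRm ρ), tailG]

lemma core {N : ℕ} (hN : 1 < N) {s p : ℝ} (hs : s < -1) (hp : 1 ≤ p) :
    ∃ K : ℝ≥0∞, K ≠ ⊤ ∧ ∀ (u : Euc N → ℝ) (g : Fin N → Euc N → ℝ),
      (∀ i, IsWeakPartialDeriv i u (g i)) →
      ∫⁻ y, JJ y ^ (-s * p - N) * ‖gradNorm1 g y‖ₑ ^ p ≠ ⊤ →
      ∃ (c : ℝ) (W : ℕ → Euc N → ℝ), (∀ n, ContDiff ℝ 1 (W n)) ∧
        (∀ᵐ x, Tendsto (fun n => W n x) atTop (nhds (u x - c))) ∧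
        (∀ n (R : ℝ), 0 ≤ R → ∫⁻ x in {x : Euc N | R ≤ ‖x‖}, JJ x ^ (-s * p - N) * GG (W n) x ^ p ≤
          K * tailG (-s * p - N) p g (R / 4 - 2)) ∧
        (∀ n (R : ℝ), 0 ≤ R →
          ∫⁻ x in {x : Euc N | R ≤ ‖x‖}, JJ x ^ (-(s + 1) * p - N) * ‖W n x‖ₑ ^ p ≤
          K * tailG (-s * p - N) p g (R / 4 - 2)) := by
  have hp0 : 0 < p := by linarith
  obtain ⟨C, hC, H⟩ := hardy_smooth hN hs hp
  set Cm : ℝ≥0∞ := (N : ℝ≥0∞) ^ p * ENNReal.ofReal 2 ^ |-s * p - N| with hCm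
  have hCmt : Cm ≠ ⊤ := ENNReal.mul_ne_top
    (ENNReal.rpow_ne_top_of_nonneg hp0.le (ENNReal.natCast_ne_top _))
    (ENNReal.rpow_ne_top_of_nonneg (abs_nonneg _) ENNReal.ofReal_ne_top)
  have hKt : Cm + C * Cm ≠ ⊤ := ENNReal.add_ne_top.2 ⟨hCmt, ENNReal.mul_ne_top hC hCmt⟩
  refine ⟨Cm + C * Cm, hKt, fun u g hw hM => ?_⟩
  obtain ⟨U, hU1, hU2, hU3⟩ := exists_moll hN hw hp (-s * p - N)
  have huniv : ∀ R : ℝ, R ≤ 0 → {x : Euc N | R ≤ ‖x‖} = Set.univ := fun R hR => by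
    ext x; simp only [Set.mem_ofPred_eq, Set.mem_univ, iff_true]; exact hR.trans (norm_nonneg _)
  have hfin : ∀ n, ∫⁻ x, JJ x ^ (-s * p - N) * GG (U n) x ^ p ≠ ⊤ := by
    intro n
    have := hU3 n 0
    rw [huniv 0 le_rfl, Measure.restrict_univ] at this
    exact ne_top_of_le_ne_top (ENNReal.mul_ne_top hCmt
      (ne_top_of_le_ne_top hM (tailG_le _ _ _ _))) this
  choose d hd using fun n => H (U n) (hU1 n) (hfin n)
  have hd2 : ∀ n (R : ℝ), ∫⁻ x in {x : Euc N | R ≤ ‖x‖}, JJ x ^ (-(s + 1) * p - N) * ‖U n x - d n‖ₑ ^ p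
      ≤ (C * Cm) * tailG (-s * p - N) p g (R / 4 - 2) := by
    intro n R
    refine (hd n R).trans ?_
    rw [mul_assoc]
    gcongr
    refine (hU3 n (R / 4 - 1)).trans (le_of_eq ?_)
    rw [tailG]
    congr! 4
    ring_nf
  -- boundedness of the constants
  have hbdd : ∃ k : ℕ, ∃ᶠ n in atTop, d n ∈ closedBall (0 : ℝ) k := by
    by_contra hcon
    push Not at hcon
    have hdt : Tendsto (fun n => ‖d n‖) atTop atTop := by
      rw [Filter.tendsto_atTop]
      intro b
      obtain ⟨k, hk⟩ := exists_nat_ge b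
      have := hcon k
      filter_upwards [this] with n hn
      simp only [mem_closedBall, dist_zero_right, not_le] at hn
      linarith
    have hlim : ∀ᵐ x, liminf (fun n => JJ x ^ (-(s + 1) * p - N) * ‖U n x - d n‖ₑ ^ p) atTop = ⊤ := by
      filter_upwards [hU2] with x hx
      apply Tendsto.liminf_eq
      have h1 : Tendsto (fun n => ‖U n x - d n‖) atTop atTop := by
        have hb : Tendsto (fun n => ‖d n‖ - ‖U n x‖) atTop atTop :=
          tendsto_atTop_add_right_of_le' _ (-(‖u x‖ + 1)) hdt (by
            filter_upwards [hx.norm.eventually (gt_mem_nhds (lt_add_one _))] with n hn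
            linarith)
        refine tendsto_atTop_mono (fun n => ?_) hb
        rw [norm_sub_rev]
        exact norm_sub_norm_le _ _
      have h2 : Tendsto (fun n => ‖U n x - d n‖ₑ) atTop (nhds ⊤) := by
        simp only [← ofReal_norm]
        exact ENNReal.tendsto_ofReal_nhds_top.2 h1
      have h3 := (ENNReal.continuous_rpow_const (y := p)).tendsto ⊤
      rw [ENNReal.top_rpow_of_pos hp0] at h3
      have h4 := ENNReal.Tendsto.const_mul (a := JJ x ^ (-(s + 1) * p - N)) (h3.comp h2)
        (Or.inl (by simp))
      rw [ENNReal.mul_top (JJ_rpow_ne_zero x _)] at h4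
      exact h4
    have hF := lintegral_liminf_le (μ := (volume : Measure (Euc N))) (u := atTop)
      (f := fun n x => JJ x ^ (-(s + 1) * p - N) * ‖U n x - d n‖ₑ ^ p)
      (fun n => (measurable_JJ_rpow _).mul
        (((hU1 n).continuous.sub continuous_const).enorm.measurable.pow_const p))
    rw [lintegral_congr_ae hlim] at hF
    have h5 : ∀ n, ∫⁻ x, JJ x ^ (-(s + 1) * p - N) * ‖U n x - d n‖ₑ ^ p ≤
        (C * Cm) * ∫⁻ y, JJ y ^ (-s * p - N) * ‖gradNorm1 g y‖ₑ ^ p := by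
      intro n
      have := hd2 n 0
      rw [huniv 0 le_rfl, Measure.restrict_univ] at this
      exact this.trans (by gcongr; exact tailG_le _ _ _ _)
    have h6 := hF.trans (liminf_le_of_le (by isBoundedDefault) (fun b hb => by
      obtain ⟨n, hn⟩ := hb.exists
      exact hn.trans (h5 n)))
    have : Nonempty (Fin N) := ⟨⟨0, by omega⟩⟩
    have h7 : ∫⁻ _ : Euc N, (⊤ : ℝ≥0∞) = ⊤ := by
      rw [lintegral_const, ENNReal.top_mul]
      simp
    rw [h7, top_le_iff] at h6
    exact ENNReal.mul_ne_top (ENNReal.mul_ne_top hC hCmt) hM h6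
  obtain ⟨k, hk⟩ := hbdd
  obtain ⟨c, -, φ, hφ, hc⟩ := tendsto_subseq_of_frequently_bounded isBounded_closedBall hk
  refine ⟨c, fun n x => U (φ n) x - d (φ n), fun n => (hU1 _).sub contDiff_const, ?_, ?_, ?_⟩
  · filter_upwards [hU2] with x hx
    exact (hx.comp hφ.tendsto_atTop).sub hc
  · intro n R hR
    have : GG (fun x => U (φ n) x - d (φ n)) = GG (U (φ n)) := by
      funext x; rw [GG, GG, fderiv_sub_const]
    rw [this]
    refine (hU3 (φ n) R).trans ?_
    refine mul_le_mul' le_self_add ?_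
    exact tailG_anti _ _ _ (by linarith)
  · intro n R _
    refine (hd2 (φ n) R).trans ?_
    gcongr
    exact le_add_self

lemma uniq_const {N : ℕ} (hN : 1 < N) {s : ℝ} (hs : s < -1) {q : ℝ≥0∞}
    (hq : q = ⊤ ∨ ∃ q' : ℝ, q = ENNReal.ofReal q' ∧ 1 ≤ q') {d : ℝ}
    (hd : MemLs N (s + 1) q (fun _ => d)) : d = 0 := by
  have : Nonempty (Fin N) := ⟨⟨0, by omega⟩⟩
  by_contra hne
  have hd0 : ‖d‖ₑ ≠ 0 := by simpa using hne
  have hs' : 0 < -(s + 1) := by linarith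
  have hkey : ∃ B V : ℝ≥0∞, B ≠ ⊤ ∧ V ≠ 0 ∧ ∀ r : ℝ, 1 ≤ r →
      V * (ENNReal.ofReal r ^ (-(s + 1)) * ‖d‖ₑ) ≤ B := by
    have hmono : ∀ (r : ℝ) (x : Euc N), r ≤ ‖x‖ →
        ENNReal.ofReal r ^ (-(s + 1)) * ‖d‖ₑ ≤ JJ x ^ (-(s + 1)) * ‖d‖ₑ := by
      intro r x hx
      gcongr
      exact ENNReal.ofReal_le_ofReal (by linarith)
    rcases hq with rfl | ⟨q', rfl, hq'⟩
    · refine ⟨eLpNorm (fun x => wt N (s + 1) ⊤ x * d) ⊤ volume, 1, hd.2.ne, one_ne_zero, fun r hr => ?_⟩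
      have hae := ae_le_eLpNormEssSup (f := fun x : Euc N => wt N (s + 1) ⊤ x * d) (μ := volume)
      have hfr : ∃ x : Euc N, r ≤ ‖x‖ ∧
          ‖wt N (s + 1) ⊤ x * d‖ₑ ≤ eLpNormEssSup (fun x => wt N (s + 1) ⊤ x * d) volume := by
        by_contra hcon
        push Not at hcon
        have hz : volume {x : Euc N | r < ‖x‖} = 0 := by
          refine measure_mono_null ?_ hae
          intro x hx hx2
          exact absurd hx2 (not_le.2 (hcon x (le_of_lt hx)))
        have ho : IsOpen {x : Euc N | r < ‖x‖} := isOpen_lt continuous_const continuous_norm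
        obtain ⟨x, hx⟩ := NormedSpace.exists_lt_norm ℝ (Euc N) r
        exact (ho.measure_pos volume ⟨x, hx⟩).ne' hz
      obtain ⟨x, hx1, hx2⟩ := hfr
      rw [one_mul, eLpNorm_exponent_top]
      refine (hmono r x hx1).trans (le_trans (le_of_eq ?_) hx2)
      rw [wt_enorm]
      simp
    · have hq0 : 0 < q' := by linarith
      obtain ⟨C, hC, H⟩ := aux_annulus (N := N) hq'
      set A := eLpNorm (fun x => wt N (s + 1) (ENNReal.ofReal q') x * d) (ENNReal.ofReal q') volume
        with hA
      have hAt : A ≠ ⊤ := hd.2.ne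
      rw [wt_eLpNorm (s + 1) hq0] at hA
      have h1 := H (fun x => JJ x ^ (-(s + 1)) * ‖d‖ₑ) ((measurable_JJ_rpow _).mul_const _) A (by
        rw [hA, ← ENNReal.rpow_mul, one_div_mul_cancel hq0.ne', ENNReal.rpow_one]
        apply le_of_eq
        apply lintegral_congr
        intro x
        rw [JJ_conv _ _ _ hq0.le])
      set S : Set (Euc N) := {y : Euc N | 1 < ‖y‖ ∧ ‖y‖ ≤ 2} with hS
      have hSm : MeasurableSet S :=
        (measurableSet_lt measurable_const measurable_norm).inter
          (measurableSet_le measurable_norm measurable_const)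
      have hS0 : volume S ≠ 0 := by
        have ho : IsOpen {x : Euc N | 1 < ‖x‖ ∧ ‖x‖ < 2} :=
          (isOpen_lt continuous_const continuous_norm).inter (isOpen_lt continuous_norm continuous_const)
        obtain ⟨x, hx⟩ := exists_norm_eq (Euc N) (show (0 : ℝ) ≤ 3 / 2 by norm_num)
        have h2 := ho.measure_pos volume ⟨x, by
          simp only [Set.mem_ofPred_eq, hx]; norm_num⟩
        have h3 : {x : Euc N | 1 < ‖x‖ ∧ ‖x‖ < 2} ⊆ S := fun y hy => ⟨hy.1, le_of_lt hy.2⟩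
        exact (h2.trans_le (measure_mono h3)).ne'
      refine ⟨C * A, volume S, ENNReal.mul_ne_top hC hAt, hS0, fun r hr => ?_⟩
      refine le_trans ?_ (h1 r hr)
      rw [mul_comm, ← setLIntegral_const]
      apply setLIntegral_mono' hSm
      intro y hy
      apply hmono
      rw [norm_smul, Real.norm_of_nonneg (by linarith)]
      nlinarith [hy.1]
  obtain ⟨B, V, hB, hV, hle⟩ := hkey
  have ht : Tendsto (fun r : ℝ => V * (ENNReal.ofReal r ^ (-(s + 1)) * ‖d‖ₑ)) atTop (nhds ⊤) := by
    have h3 := ((ENNReal.continuous_rpow_const (y := -(s + 1))).tendsto ⊤).comp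
      ENNReal.tendsto_ofReal_atTop
    rw [ENNReal.top_rpow_of_pos hs'] at h3
    have h4 := ENNReal.Tendsto.mul_const (b := ‖d‖ₑ) h3 (Or.inl (by simp))
    rw [ENNReal.top_mul hd0] at h4
    have h5 := ENNReal.Tendsto.const_mul (a := V) h4 (Or.inl (by simp))
    rw [ENNReal.mul_top hV] at h5
    exact h5
  have := le_of_tendsto ht (by filter_upwards [eventually_ge_atTop 1] with r hr using hle r hr)
  exact hB (top_le_iff.1 this)

/-- A measurable representative controlled pointwise by the liminf. -/
lemma exists_rep {N : ℕ} {u : Euc N → ℝ} {c : ℝ} {W : ℕ → Euc N → ℝ} (hW : ∀ n, ContDiff ℝ 1 (W n))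
    (hlim : ∀ᵐ x, Tendsto (fun n => W n x) atTop (nhds (u x - c))) :
    ∃ v : Euc N → ℝ, Measurable v ∧ v =ᵐ[volume] u ∧
      ∀ x, ‖v x - c‖ₑ ≤ liminf (fun n => ‖W n x‖ₑ) atTop := by
  classical
  have hm : ∀ n, StronglyMeasurable (W n) := fun n => (hW n).continuous.stronglyMeasurable
  set E : Set (Euc N) := {x | ∃ l, Tendsto (fun n => W n x) atTop (nhds l)} with hE
  have hEm : MeasurableSet E := StronglyMeasurable.measurableSet_exists_tendsto hm
  have hLm : Measurable fun x => limUnder atTop (fun n => W n x) :=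
    (StronglyMeasurable.limUnder hm).measurable
  refine ⟨fun x => c + E.indicator (fun x => limUnder atTop (fun n => W n x)) x,
    measurable_const.add (hLm.indicator hEm), ?_, fun x => ?_⟩
  · filter_upwards [hlim] with x hx
    have hxE : x ∈ E := ⟨_, hx⟩
    rw [Set.indicator_of_mem hxE, hx.limUnder_eq]
    ring
  · dsimp only
    by_cases hx : x ∈ E
    · rw [Set.indicator_of_mem hx, add_sub_cancel_left]
      have := tendsto_nhds_limUnder hx
      rw [(this.enorm).liminf_eq]
    · rw [Set.indicator_of_notMem hx]
      simp

lemma liminf_le_const {f : ℕ → ℝ≥0∞} {B : ℝ≥0∞} (h : ∀ n, f n ≤ B) : liminf f atTop ≤ B :=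
  liminf_le_of_le (by isBoundedDefault) (fun b hb => by
    obtain ⟨n, hn⟩ := hb.exists
    exact hn.trans (h n))

lemma sphere_limit {N : ℕ} (hN : 1 < N) {s : ℝ} (hs : s < -1) {v : Euc N → ℝ} (hv : Measurable v)
    {c : ℝ} {B : ℝ≥0∞} (hB : B ≠ ⊤)
    (h : ∀ r : ℝ, 1 ≤ r → ∫⁻ σ : sphere (0 : Euc N) 1, ‖v (r • (σ : Euc N)) - c‖ₑ
      ∂((volume : Measure (Euc N)).toSphere) ≤ B * ENNReal.ofReal r ^ (s + 1)) :
    Tendsto (fun r : ℝ => ((N : ℝ) * (volume (ball (0 : Euc N) 1)).toReal)⁻¹ *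
                ∫ σ : sphere (0 : Euc N) 1, v (r • (σ : Euc N))
                  ∂((volume : Measure (Euc N)).toSphere))
              atTop (nhds c) := by
  have hNpos : (0 : ℝ) < N := by exact_mod_cast (by omega : 0 < N)
  set κ : ℝ := (N : ℝ) * (volume (ball (0 : Euc N) 1)).toReal with hκ
  have hκ0 : 0 < κ := mul_pos hNpos (ENNReal.toReal_pos (measure_ball_pos _ _ one_pos).ne'
    measure_ball_lt_top.ne)
  have huniv : ((volume : Measure (Euc N)).toSphere).real Set.univ = κ := by
    rw [Measure.toSphere_real_apply_univ]
    simp [hκ, measureReal_def]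
  rw [← tendsto_sub_nhds_zero_iff, tendsto_zero_iff_enorm_tendsto_zero]
  have hr0 : Tendsto (fun r : ℝ => ‖κ⁻¹‖ₑ * (B * ENNReal.ofReal r ^ (s + 1))) atTop (nhds 0) := by
    have h1 : Tendsto (fun r : ℝ => ENNReal.ofReal r ^ (s + 1)) atTop (nhds 0) := by
      have h2 := ENNReal.tendsto_ofReal (tendsto_rpow_neg_atTop (y := -(s + 1)) (by linarith))
      rw [ENNReal.ofReal_zero] at h2
      refine h2.congr' ?_
      filter_upwards [eventually_gt_atTop 0] with r hr
      rw [ENNReal.ofReal_rpow_of_pos hr, neg_neg]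
    have h3 := ENNReal.Tendsto.const_mul (a := ‖κ⁻¹‖ₑ)
      (ENNReal.Tendsto.const_mul (a := B) h1 (Or.inr hB)) (Or.inr (by simp))
    simpa using h3
  refine tendsto_of_tendsto_of_tendsto_of_le_of_le' tendsto_const_nhds hr0
    (Eventually.of_forall fun _ => zero_le) ?_
  filter_upwards [eventually_ge_atTop 1] with r hr
  have hm : Measurable fun σ : sphere (0 : Euc N) 1 => v (r • (σ : Euc N)) - c :=
    (hv.comp (by fun_prop)).sub_const c
  have hintg : Integrable (fun σ : sphere (0 : Euc N) 1 => v (r • (σ : Euc N)) - c)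
      ((volume : Measure (Euc N)).toSphere) := by
    refine ⟨hm.aestronglyMeasurable, (h r hr).trans_lt ?_⟩
    exact ENNReal.mul_lt_top hB.lt_top (ENNReal.rpow_ne_top_of_ne_zero
      (by simpa using (by linarith : 0 < r)) ENNReal.ofReal_ne_top).lt_top
  have hsplit : ∫ σ : sphere (0 : Euc N) 1, v (r • (σ : Euc N)) ∂((volume : Measure (Euc N)).toSphere) =
      (∫ σ : sphere (0 : Euc N) 1, (v (r • (σ : Euc N)) - c) ∂((volume : Measure (Euc N)).toSphere))
        + κ * c := by
    have := integral_add hintg (integrable_const (μ := (volume : Measure (Euc N)).toSphere) c)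
    simp only [sub_add_cancel, integral_const, huniv, smul_eq_mul] at this
    exact this
  have heq : κ⁻¹ * (∫ σ : sphere (0 : Euc N) 1, v (r • (σ : Euc N))
      ∂((volume : Measure (Euc N)).toSphere)) - c = κ⁻¹ *
      ∫ σ : sphere (0 : Euc N) 1, (v (r • (σ : Euc N)) - c) ∂((volume : Measure (Euc N)).toSphere) := by
    rw [hsplit]
    field_simp
    ring
  rw [heq, enorm_mul]
  gcongr
  exact (enorm_integral_le_lintegral_enorm _).trans (h r hr)

lemma main_aux {N : ℕ} (hN : 1 < N) (s p : ℝ) (hs : s < -1) (hp : 1 ≤ p) :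
    ∃ C : ℝ≥0∞ → ℝ, (∀ q ∈ Ijp N 1 p, 0 < C q) ∧
      ∀ (u : Euc N → ℝ) (g : Fin N → Euc N → ℝ),
        (∀ i, IsWeakPartialDeriv i u (g i)) →
        (∀ i, MemLs N s (ENNReal.ofReal p) (g i)) →
        ∃ c : ℝ,
          (∃ v : Euc N → ℝ, v =ᵐ[volume] u ∧
            Tendsto
              (fun r : ℝ => ((N : ℝ) * (volume (ball (0 : Euc N) 1)).toReal)⁻¹ *
                ∫ σ : sphere (0 : Euc N) 1, v (r • (σ : Euc N))
                  ∂((volume : Measure (Euc N)).toSphere))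
              atTop (nhds c)) ∧
          (∀ q ∈ Ijp N 1 p,
            MemLs N (s + 1) q (fun x => u x - c) ∧
              LsNorm N (s + 1) q (fun x => u x - c)
                ≤ C q * LsNorm N s (ENNReal.ofReal p) (gradNorm1 g)) ∧
          (∀ (c' : ℝ) (q : ℝ≥0∞), q ∈ Ijp N 1 p →
            MemLs N (s + 1) q (fun x => u x - c') → c' = c) ∧
          ((N : ℝ) < p →
            ∃ v : Euc N → ℝ, v =ᵐ[volume] u ∧
              Tendsto (fun x : Euc N => ‖x‖ ^ (-(s + 1)) * (v x - c))
                (cocompact (Euc N)) (nhds 0)) := by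
  have hp0 : 0 < p := by linarith
  obtain ⟨K, hK, hcore⟩ := core hN hs hp
  have hQ : ∀ q : ℝ≥0∞, ∃ C : ℝ≥0∞, C ≠ ⊤ ∧ (q ∈ Ijp N 1 p → ∀ w : Euc N → ℝ, ContDiff ℝ 1 w →
      ∀ A : ℝ, 0 < A →
      ∫⁻ x, JJ x ^ (-s * p - N) * GG w x ^ p ≤ ENNReal.ofReal A ^ p →
      ∫⁻ x, JJ x ^ (-(s + 1) * p - N) * ‖w x‖ₑ ^ p ≤ ENNReal.ofReal A ^ p →
      eLpNorm (fun x => wt N (s + 1) q x * w x) q volume ≤ C * ENNReal.ofReal A) := by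
    intro q
    by_cases hq : q ∈ Ijp N 1 p
    · obtain ⟨C, hC, H⟩ := aux_q (s := s) hN hp hq
      exact ⟨C, hC, fun _ => H⟩
    · exact ⟨0, by simp, fun h => absurd h hq⟩
  choose CQ hCQ hQ using hQ
  set k : ℝ≥0∞ := K ^ (1 / p) with hk
  have hkt : k ≠ ⊤ := ENNReal.rpow_ne_top_of_nonneg (by positivity) hK
  refine ⟨fun q => (CQ q * k).toReal + 1, fun q _ => by positivity, fun u g hw hg => ?_⟩
  have hgl : ∀ i, LocallyIntegrable (g i) volume := fun i => (hw i).2.1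
  have hul : LocallyIntegrable u volume := (hw ⟨0, by omega⟩).1
  have hgrad := memLs_gradNorm1 hgl hg
  set m : ℝ≥0∞ := eLpNorm (fun x => wt N s (ENNReal.ofReal p) x * gradNorm1 g x)
    (ENNReal.ofReal p) volume with hm
  have hmt : m ≠ ⊤ := hgrad.2.ne
  set M := ∫⁻ y, JJ y ^ (-s * p - N) * ‖gradNorm1 g y‖ₑ ^ p with hM
  have hmM : m = M ^ (1 / p) := by rw [hm, wt_eLpNorm s hp0]
  have hMm : M = m ^ p := by
    rw [hmM, ← ENNReal.rpow_mul, one_div_mul_cancel hp0.ne', ENNReal.rpow_one]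
  have hMt : M ≠ ⊤ := by rw [hMm]; exact ENNReal.rpow_ne_top_of_nonneg hp0.le hmt
  have hkp : k ^ p = K := by
    rw [hk, ← ENNReal.rpow_mul, one_div_mul_cancel hp0.ne', ENNReal.rpow_one]
  have hkm : (k * m) ^ p = K * M := by
    rw [ENNReal.mul_rpow_of_nonneg _ _ hp0.le, hkp, ← hMm]
  obtain ⟨c, W, hW1, hW2, hW3, hW4⟩ := hcore u g hw hMt
  have huniv : {x : Euc N | (0 : ℝ) ≤ ‖x‖} = Set.univ := by
    ext x; simp
  have hG : ∀ n, ∫⁻ x, JJ x ^ (-s * p - N) * GG (W n) x ^ p ≤ (k * m) ^ p := by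
    intro n
    have := hW3 n 0 le_rfl
    rw [huniv, Measure.restrict_univ] at this
    rw [hkm]
    exact this.trans (by gcongr; exact tailG_le _ _ _ _)
  have hH : ∀ n, ∫⁻ x, JJ x ^ (-(s + 1) * p - N) * ‖W n x‖ₑ ^ p ≤ (k * m) ^ p := by
    intro n
    have := hW4 n 0 le_rfl
    rw [huniv, Measure.restrict_univ] at this
    rw [hkm]
    exact this.trans (by gcongr; exact tailG_le _ _ _ _)
  have hwtm : ∀ q, Measurable (wt N (s + 1) q) := fun q => by unfold wt; fun_prop
  obtain ⟨v, hvm, hvu, hvlim⟩ := exists_rep hW1 hW2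
  have hLq : ∀ q ∈ Ijp N 1 p, eLpNorm (fun x => wt N (s + 1) q x * (u x - c)) q volume ≤
      CQ q * k * m := by
    intro q hq
    have hF := Lp.eLpNorm_lim_le_liminf_eLpNorm (μ := (volume : Measure (Euc N))) (p := q)
      (f := fun n x => wt N (s + 1) q x * W n x)
      (fun n => ((hwtm q).mul (hW1 n).continuous.measurable).aestronglyMeasurable)
      (fun x => wt N (s + 1) q x * (u x - c)) (by
        filter_upwards [hW2] with x hx
        exact hx.const_mul _)
    have hε : ∀ ε : ℝ, 0 < ε → eLpNorm (fun x => wt N (s + 1) q x * (u x - c)) q volume ≤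
        CQ q * (k * m + ENNReal.ofReal ε) := by
      intro ε hε
      refine hF.trans (liminf_le_const fun n => ?_)
      have hA : ENNReal.ofReal ((k * m).toReal + ε) = k * m + ENNReal.ofReal ε := by
        rw [ENNReal.ofReal_add (by positivity) hε.le, ENNReal.ofReal_toReal (ENNReal.mul_ne_top hkt hmt)]
      have hle : (k * m) ^ p ≤ ENNReal.ofReal ((k * m).toReal + ε) ^ p := by
        rw [hA]
        exact ENNReal.rpow_le_rpow le_self_add hp0.le
      have := hQ q hq (W n) (hW1 n) ((k * m).toReal + ε) (by positivity) ((hG n).trans hle)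
        ((hH n).trans hle)
      rwa [hA] at this
    have ht : Tendsto (fun ε : ℝ => CQ q * (k * m + ENNReal.ofReal ε)) (𝓝[>] 0)
        (nhds (CQ q * (k * m + ENNReal.ofReal 0))) := by
      apply ENNReal.Tendsto.const_mul _ (Or.inr (hCQ q))
      exact tendsto_const_nhds.add
        (ENNReal.tendsto_ofReal (tendsto_nhdsWithin_of_tendsto_nhds tendsto_id))
    have := ge_of_tendsto ht (by filter_upwards [self_mem_nhdsWithin] with ε h using hε ε h)
    rw [ENNReal.ofReal_zero, add_zero, ← mul_assoc] at this
    exact this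
  have hMem : ∀ q ∈ Ijp N 1 p, MemLs N (s + 1) q (fun x => u x - c) := by
    intro q hq
    refine ⟨((hwtm q).aemeasurable.mul
      (hul.aestronglyMeasurable.aemeasurable.sub_const c)).aestronglyMeasurable, ?_⟩
    exact (hLq q hq).trans_lt
      (ENNReal.mul_lt_top (ENNReal.mul_lt_top (hCQ q).lt_top hkt.lt_top) hmt.lt_top)
  refine ⟨c, ⟨v, hvu, ?_⟩, fun q hq => ⟨hMem q hq, ?_⟩, ?_, fun hNp => ⟨v, hvu, ?_⟩⟩
  · obtain ⟨C, hC, HS⟩ := aux_sphere hN (s := s) hp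
    refine sphere_limit hN hs hvm (B := C * (k * m))
      (ENNReal.mul_ne_top hC (ENNReal.mul_ne_top hkt hmt)) (fun r hr => ?_)
    have hF := lintegral_liminf_le (μ := (volume : Measure (Euc N)).toSphere) (u := atTop)
      (f := fun n (σ : sphere (0 : Euc N) 1) => ‖W n (r • (σ : Euc N))‖ₑ)
      (fun n => ((hW1 n).continuous.comp (by fun_prop)).enorm.measurable)
    refine (lintegral_mono fun σ => hvlim _).trans (hF.trans (liminf_le_const fun n => ?_))
    refine (HS (W n) (hW1 n) (k * m) (hG n) (hH n) r hr).trans (le_of_eq (by ring))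
  · have h1 := ENNReal.toReal_mono
      (ENNReal.mul_ne_top (ENNReal.mul_ne_top (hCQ q) hkt) hmt) (hLq q hq)
    rw [ENNReal.toReal_mul] at h1
    refine h1.trans ?_
    change (CQ q * k).toReal * m.toReal ≤ ((CQ q * k).toReal + 1) * m.toReal
    gcongr
    linarith
  · intro c' q hq hc'
    have hsub := (hMem q hq).sub hc'
    have h2 : MemLs N (s + 1) q (fun _ => c' - c) := by
      refine (memLp_congr_ae (ae_of_all _ fun x => ?_)).1 hsub
      simp only [Pi.sub_apply]
      ring
    have := uniq_const hN hs (by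
      rcases Ijp_cases hN hp hq with ⟨h, _⟩ | ⟨q', h, h', _⟩
      · exact Or.inl h
      · exact Or.inr ⟨q', h, hp.trans h'⟩) h2
    linarith
  · obtain ⟨C, hC, HM⟩ := aux_morrey (N := N) (s := s) hp hNp
    rw [tendsto_zero_iff_enorm_tendsto_zero]
    set T : ℝ → ℝ≥0∞ := fun ρ => C * (K * tailG (-s * p - N) p g ρ) ^ (1 / p) with hT
    have hT0 : Tendsto T atTop (nhds 0) := by
      have h1 := tailG_tendsto (-s * p - N) p hgl hMt
      have h2 := ENNReal.Tendsto.const_mul (a := K) h1 (Or.inr hK)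
      rw [mul_zero] at h2
      have h3 := ((ENNReal.continuous_rpow_const (y := 1 / p)).tendsto 0).comp h2
      rw [ENNReal.zero_rpow_of_pos (by positivity)] at h3
      have h4 := ENNReal.Tendsto.const_mul (a := C) h3 (Or.inr hC)
      rw [mul_zero] at h4
      exact h4
    have hρ : Tendsto (fun x : Euc N => (3 * ‖x‖ - 1) / 4 / 4 - 2) (cocompact (Euc N)) atTop := by
      have h1 := tendsto_norm_cocompact_atTop (E := Euc N)
      have h2 := tendsto_atTop_add_const_right (cocompact (Euc N)) (-(33 / 16) : ℝ)
        (h1.const_mul_atTop (by norm_num : (0 : ℝ) < 3 / 16))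
      refine h2.congr fun x => ?_
      ring
    refine tendsto_of_tendsto_of_tendsto_of_le_of_le' tendsto_const_nhds (hT0.comp hρ)
      (Eventually.of_forall fun _ => zero_le) ?_
    filter_upwards [(tendsto_norm_cocompact_atTop (E := Euc N)).eventually (eventually_ge_atTop 1)]
      with x hx
    have hx0 : 0 < ‖x‖ := by linarith
    set R := (3 * ‖x‖ - 1) / 4 with hR
    have hR0 : 0 ≤ R := by rw [hR]; linarith
    have hsub : ball x ((1 + ‖x‖) / 4) ⊆ {z : Euc N | R ≤ ‖z‖} := by
      intro z hz
      rw [mem_ball, dist_eq_norm, norm_sub_rev] at hz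
      have := norm_sub_norm_le x z
      simp only [Set.mem_ofPred_eq, hR]
      linarith
    set A : ℝ≥0∞ := (K * tailG (-s * p - N) p g (R / 4 - 2)) ^ (1 / p) with hA
    have hAp : A ^ p = K * tailG (-s * p - N) p g (R / 4 - 2) := by
      rw [hA, ← ENNReal.rpow_mul, one_div_mul_cancel hp0.ne', ENNReal.rpow_one]
    have hn : ∀ n, JJ x ^ (-(s + 1)) * ‖W n x‖ₑ ≤ C * A := fun n =>
      HM (W n) (hW1 n) x A
        ((lintegral_mono_set hsub).trans ((hW3 n R hR0).trans hAp.ge))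
        ((lintegral_mono_set hsub).trans ((hW4 n R hR0).trans hAp.ge))
    have hn2 : ∀ n, ‖W n x‖ₑ ≤ JJ x ^ (s + 1) * (C * A) := by
      intro n
      calc ‖W n x‖ₑ = JJ x ^ (s + 1) * (JJ x ^ (-(s + 1)) * ‖W n x‖ₑ) := by
            rw [← mul_assoc, mul_comm (JJ x ^ (s + 1)), JJ_cancel, one_mul]
        _ ≤ _ := mul_le_mul_right (hn n) _
    have h5 := (hvlim x).trans (liminf_le_const hn2)
    rw [enorm_mul, Real.enorm_of_nonneg (by positivity), ← ENNReal.ofReal_rpow_of_pos hx0]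
    calc _ ≤ JJ x ^ (-(s + 1)) * (JJ x ^ (s + 1) * (C * A)) := by
          gcongr
          · linarith
          · exact ENNReal.ofReal_le_ofReal (by linarith)
      _ = C * A := by rw [← mul_assoc, JJ_cancel, one_mul]

/-- Theorem 8(ii). If `N > 1`, `s < -1`, `1 ≤ p < ∞` and
`∇u ∈ (L^p_s)^N`, there is a unique constant `c_u`, given by the limit of the sphere
averages `(Nω_N)⁻¹ ∫_{S^{N-1}} u(rσ) dσ` as `r → ∞` (hence independent of `s` and `p`),
such that `u - c_u ∈ L^q_{s+1}` for every `q ∈ I_{1,p}`, with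
`‖u - c_u‖_{L^q_{s+1}} ≤ C(s,p,q) ‖|∇u|‖_{L^p_s}`; and if `p > N` then (a representative
of) `u` satisfies `|x|^{-(s+1)}(u(x) - c_u) → 0` as `|x| → ∞`. -/
theorem stmt_12 {N : ℕ} (hN : 1 < N) (s p : ℝ) (hs : s < -1) (hp : 1 ≤ p) :
    ∃ C : ℝ≥0∞ → ℝ, (∀ q ∈ Ijp N 1 p, 0 < C q) ∧
      ∀ (u : Euc N → ℝ) (g : Fin N → Euc N → ℝ),
        (∀ i, IsWeakPartialDeriv i u (g i)) →
        (∀ i, MemLs N s (ENNReal.ofReal p) (g i)) →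
        ∃ c : ℝ,
          (∃ v : Euc N → ℝ, v =ᵐ[volume] u ∧
            Tendsto
              (fun r : ℝ => ((N : ℝ) * (volume (ball (0 : Euc N) 1)).toReal)⁻¹ *
                ∫ σ : sphere (0 : Euc N) 1, v (r • (σ : Euc N))
                  ∂((volume : Measure (Euc N)).toSphere))
              atTop (nhds c)) ∧
          (∀ q ∈ Ijp N 1 p,
            MemLs N (s + 1) q (fun x => u x - c) ∧
              LsNorm N (s + 1) q (fun x => u x - c)
                ≤ C q * LsNorm N s (ENNReal.ofReal p) (gradNorm1 g)) ∧
          (∀ (c' : ℝ) (q : ℝ≥0∞), q ∈ Ijp N 1 p →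
            MemLs N (s + 1) q (fun x => u x - c') → c' = c) ∧
          ((N : ℝ) < p →
            ∃ v : Euc N → ℝ, v =ᵐ[volume] u ∧
              Tendsto (fun x : Euc N => ‖x‖ ^ (-(s + 1)) * (v x - c))
                (cocompact (Euc N)) (nhds 0)) := by
  exact main_aux hN s p hs hp

end
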